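/- arXiv:1703.02251 — 4 statements merged into one kernel-verified Lean document; each statement's English description precedes it below -/
import Mathlib

section
/- Suppose 1 ≤ k ≤ d−1 and let A be the hypersimplex matrix of the context with trivial scaling c = (1,1,…,1). Then there is a nonzero polynomial G ∈ ℂ[u] such that for every u ∈ ℂ^n with G(u) ≠ 0 the likelihood system for (A,(1,…,1),u) has exactly Σ_{j=0}^{k−1} (−1)^j · binom(d, j) · (k−j)^{d−1} solutions, the Eulerian number A(d−1, k−1). (The ML degree of the toric variety of the hypersimplex with trivial scaling equals the normalized volume of the hypersimplex, the Eulerian number A(d−1,k−1).) -/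
open scoped BigOperators

/-- The likelihood system for a matrix `A`, scaling `c` and data `u`. -/
def mlSolutions {κ ι : Type*} [Fintype κ] [Fintype ι] (A : κ → ι → ℤ)
    (c u : ι → ℂ) : Set (ι → ℂ) :=
  {p | (∀ j, p j ≠ 0) ∧
    (∀ v : ι → ℤ, (∀ i, ∑ j, A i j * v j = 0) → (∑ j, v j = 0) →
      (∏ j, p j ^ (max (v j) 0).toNat) = (∏ j, p j ^ (max (-v j) 0).toNat)) ∧
    (∑ j, c j * p j = 1) ∧
    (∀ i, (∑ j, u j) * (∑ j, (A i j : ℂ) * (c j * p j)) = ∑ j, (A i j : ℂ) * u j)}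

/-- Column indices of the hypersimplex: the 0/1 vectors in `{0,1}^{d-1}` with
exactly `k` or exactly `k-1` entries equal to `1`. -/
abbrev HypIndex (d k : ℕ) : Type :=
  {α : Fin (d - 1) → Fin 2 // (∑ i, (α i : ℕ)) = k ∨ (∑ i, (α i : ℕ)) = k - 1}

/-- The matrix of the hypersimplex toric variety. -/
def hypA (d k : ℕ) : Fin (d - 1) → HypIndex d k → ℤ :=
  fun i α => ((α.1 i : ℕ) : ℤ)

open Polynomial in
/-- A finite extension of domains with integrally closed base of characteristic zero is generically
generated by one element with separable minimal polynomial. -/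
theorem exists_generic_primitive_element (B T : Type*) [CommRing B] [IsDomain B]
    [IsIntegrallyClosed B] [CharZero B] [CommRing T] [IsDomain T] [Algebra B T] [Module.Finite B T]
    [FaithfulSMul B T] :
    ∃ y : T, ∃ g : B, g ≠ 0 ∧ (∀ s : T, ∃ q : B[X], g • s = aeval y q) ∧
      ∃ h : B, h ≠ 0 ∧ ∃ a b : B[X],
        a * minpoly B y + b * derivative (minpoly B y) = C h := by
  let K := FractionRing B
  let L := FractionRing T
  let _ : Algebra K L := FractionRing.liftAlgebra B L
  have : IsScalarTower B K L := FractionRing.isScalarTower_liftAlgebra B L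
  have : Algebra.IsAlgebraic K L := isAlgebraic_of_isFractionRing B T K L
  have hloc : IsLocalization (Algebra.algebraMapSubmonoid T (nonZeroDivisors B)) L := inferInstance
  have : FiniteDimensional K L := .of_isLocalization B T (nonZeroDivisors B)
  have : CharZero K := charZero_of_injective_algebraMap (IsFractionRing.injective B K)
  obtain ⟨α, hα⟩ := Field.exists_primitive_element K L
  obtain ⟨⟨y, s, b, hb, rfl⟩, hy⟩ :=
    IsLocalization.surj (Algebra.algebraMapSubmonoid T (nonZeroDivisors B)) α
  simp only at hy
  have hinjT : Function.Injective (algebraMap T L) := IsFractionRing.injective T L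
  have hinjB : Function.Injective (algebraMap B T) := FaithfulSMul.algebraMap_injective B T
  have hbL : algebraMap T L (algebraMap B T b) = algebraMap K L (algebraMap B K b) := by
    rw [← IsScalarTower.algebraMap_apply, ← IsScalarTower.algebraMap_apply]
  have hb0 : algebraMap B K b ≠ 0 := by
    simpa using nonZeroDivisors.ne_zero hb
  have hytop : IntermediateField.adjoin K {algebraMap T L y} = ⊤ := by
    rw [eq_top_iff, ← hα, IntermediateField.adjoin_simple_le_iff]
    have : α = algebraMap T L y * (algebraMap K L (algebraMap B K b))⁻¹ := by
      rw [← hy, hbL, mul_assoc, mul_inv_cancel₀ (by simpa using nonZeroDivisors.ne_zero hb), mul_one]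
    rw [this]
    exact mul_mem (IntermediateField.mem_adjoin_simple_self _ _)
      (inv_mem (IntermediateField.algebraMap_mem _ _))
  have hyint : IsIntegral B y := Algebra.IsIntegral.isIntegral y
  have key : ∀ s : T, ∃ g : B, g ≠ 0 ∧ ∃ q : B[X], g • s = aeval y q := by
    intro s
    have hs : algebraMap T L s ∈ IntermediateField.adjoin K {algebraMap T L y} := by
      rw [hytop]; trivial
    rw [← IntermediateField.mem_toSubalgebra,
      IntermediateField.adjoin_simple_toSubalgebra_of_isAlgebraic (Algebra.IsAlgebraic.isAlgebraic _),
      Algebra.adjoin_singleton_eq_range_aeval] at hs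
    obtain ⟨q, hq⟩ := hs
    obtain ⟨g, hgm, hg⟩ := IsLocalization.integerNormalization_spec (nonZeroDivisors B) q
    refine ⟨g, nonZeroDivisors.ne_zero hgm, IsLocalization.integerNormalization (nonZeroDivisors B) q, ?_⟩
    apply hinjT
    have h2 : aeval (algebraMap T L y) (g • q) = aeval (algebraMap T L y)
      ((IsLocalization.integerNormalization (nonZeroDivisors B) q).map (algebraMap B K)) := by rw [hg]
    rw [aeval_map_algebraMap, aeval_algebraMap_apply L y
      (IsLocalization.integerNormalization (nonZeroDivisors B) q)] at h2
    rw [← h2, Algebra.smul_def, map_mul]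
    have h3 : aeval (algebraMap T L y) (g • q) = g • aeval (algebraMap T L y) q :=
      by rw [← algebraMap_smul K g q, map_smul, algebraMap_smul]
    rw [h3, Algebra.smul_def, ← IsScalarTower.algebraMap_apply]
    congr 1
    exact hq.symm
  obtain ⟨S, hS⟩ := Module.Finite.fg_top (R := B) (M := T)
  choose G hG Q hQ using key
  refine ⟨y, ∏ x ∈ S, G x, Finset.prod_ne_zero_iff.mpr fun x _ => hG x, ?_, ?_⟩
  · intro s
    have hs : s ∈ Submodule.span B (S : Set T) := by rw [hS]; trivial
    induction hs using Submodule.span_induction with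
    | mem x hx =>
      obtain ⟨c, hc⟩ := Finset.dvd_prod_of_mem G hx
      refine ⟨C c * Q x, ?_⟩
      rw [hc, mul_comm, mul_smul, hQ, map_mul, aeval_C, Algebra.smul_def]
    | zero => exact ⟨0, by simp⟩
    | add x z _ _ hx hz =>
      obtain ⟨q, hq⟩ := hx
      obtain ⟨q', hq'⟩ := hz
      exact ⟨q + q', by rw [smul_add, hq, hq', map_add]⟩
    | smul a x _ hx =>
      obtain ⟨q, hq⟩ := hx
      exact ⟨C a * q, by rw [smul_comm, hq, map_mul, aeval_C, Algebra.smul_def]⟩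
  · have hsep : (minpoly K (algebraMap T L y)).Separable :=
      Algebra.IsSeparable.isSeparable K _
    rw [minpoly.isIntegrallyClosed_eq_field_fractions K L hyint] at hsep
    obtain ⟨a, b, hab⟩ := hsep
    obtain ⟨g, hgm, hg⟩ := IsLocalization.integerNormalization_spec (nonZeroDivisors B) a
    obtain ⟨g', hgm', hg'⟩ := IsLocalization.integerNormalization_spec (nonZeroDivisors B) b
    refine ⟨g * g', mul_ne_zero (nonZeroDivisors.ne_zero hgm) (nonZeroDivisors.ne_zero hgm'),
      C g' * IsLocalization.integerNormalization (nonZeroDivisors B) a,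
      C g * IsLocalization.integerNormalization (nonZeroDivisors B) b, ?_⟩
    apply map_injective _ (IsFractionRing.injective B K)
    simp only [Polynomial.map_add, Polynomial.map_mul, map_C, hg, hg', map_mul]
    have e1 : ∀ (c : B) (p : K[X]), c • p = C (algebraMap B K c) * p := by
      intro c p
      rw [← algebraMap_smul K c p, smul_eq_C_mul]
    have e2 : derivative (map (algebraMap B K) (minpoly B y)) = map (algebraMap B K) (derivative (minpoly B y)) := by
      rw [derivative_map]
    rw [e2] at hab
    simp only [e1]
    linear_combination (C (algebraMap B K g) * C (algebraMap B K g')) * hab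

open Polynomial in
/-- For a finite extension `B ⊆ T` of domains of characteristic zero with `B` integrally closed, the
generic fibre has as many geometric points as the maximal number of `B`-independent elements. -/
theorem exists_generic_fiber_card (B T : Type*) [CommRing B] [IsDomain B]
    [IsIntegrallyClosed B] [CharZero B] [CommRing T] [IsDomain T] [Algebra B T] [Module.Finite B T]
    [FaithfulSMul B T] (F : Type*) [Field F] [IsAlgClosed F] :
    ∃ (r : ℕ) (t : Fin r → T), LinearIndependent B t ∧
      (∃ g : B, g ≠ 0 ∧ ∀ s : T, g • s ∈ Submodule.span B (Set.range t)) ∧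
      ∃ h : B, h ≠ 0 ∧ ∀ ψ : B →+* F, ψ h ≠ 0 →
        {φ : T →+* F | φ.comp (algebraMap B T) = ψ}.encard = r := by
  obtain ⟨y, g, hg, hgen, h, hh, a, b, hab⟩ := exists_generic_primitive_element B T
  have hyint : IsIntegral B y := Algebra.IsIntegral.isIntegral y
  have hmonic := minpoly.monic hyint
  have : Module.IsTorsionFree B T := inferInstance
  refine ⟨(minpoly B y).natDegree, fun i => y ^ (i : ℕ), ?_, ⟨g, hg, ?_⟩, g * h, mul_ne_zero hg hh, ?_⟩
  · rw [Fintype.linearIndependent_iff]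
    intro c hc
    have hp : aeval y (∑ i, C (c i) * X ^ (i : ℕ)) = 0 := by
      rw [map_sum, ← hc]
      exact Finset.sum_congr rfl fun i _ => by simp [Algebra.smul_def]
    have hdeg : (∑ i : Fin (minpoly B y).natDegree, C (c i) * X ^ (i : ℕ)).degree
        < (minpoly B y).degree := by
      rw [degree_eq_natDegree hmonic.ne_zero]
      exact degree_sum_fin_lt c
    have h0 := Polynomial.eq_zero_of_dvd_of_degree_lt
      (minpoly.isIntegrallyClosed_dvd hyint hp) hdeg
    intro i
    have h1 := congrArg (fun p => coeff p i) h0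
    simpa [finsetSum_coeff, coeff_C_mul, coeff_X_pow, Fin.val_inj] using h1
  · intro s
    obtain ⟨q, hq⟩ := hgen s
    have hq' : aeval y q = aeval y (q %ₘ minpoly B y) := by
      conv_lhs => rw [← modByMonic_add_div q (minpoly B y)]
      simp
    rw [hq, hq', aeval_eq_sum_range' (n := (minpoly B y).natDegree)]
    · refine Submodule.sum_mem _ fun i hi => Submodule.smul_mem _ _ (Submodule.subset_span ?_)
      exact ⟨⟨i, Finset.mem_range.mp hi⟩, rfl⟩
    · refine natDegree_modByMonic_lt _ hmonic fun h1 => ?_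
      exact minpoly.ne_one B y h1
  · intro ψ hψ
    rw [map_mul] at hψ
    have hψg : ψ g ≠ 0 := left_ne_zero_of_mul hψ
    have hψh : ψ h ≠ 0 := right_ne_zero_of_mul hψ
    have hsep : ((minpoly B y).map ψ).Separable := by
      have h1 := congrArg (Polynomial.map ψ) hab
      simp only [Polynomial.map_add, Polynomial.map_mul, map_C, ← derivative_map] at h1
      refine ⟨C (ψ h)⁻¹ * a.map ψ, C (ψ h)⁻¹ * b.map ψ, ?_⟩
      have h2 : (C (ψ h)⁻¹ : F[X]) * C (ψ h) = 1 := by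
        rw [← C_mul, inv_mul_cancel₀ hψh, C_1]
      linear_combination C (ψ h)⁻¹ * h1 + h2
    have hcard := card_rootSet_eq_natDegree (K := F) hsep
      (by simpa using IsAlgClosed.splits ((minpoly B y).map ψ))
    rw [hmonic.natDegree_map] at hcard
    have hval : ∀ φ : T →+* F, φ.comp (algebraMap B T) = ψ → ∀ s q, g • s = aeval y q →
        ψ g * φ s = eval₂ ψ (φ y) q := by
      intro φ hφ s q hq
      have h1 := congrArg φ hq
      rw [Algebra.smul_def, map_mul, ← RingHom.comp_apply, hφ] at h1
      rw [h1, aeval_def, hom_eval₂, hφ]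
    rw [← hcard, Set.coe_fintypeCard]
    have hinj : Set.InjOn (fun φ : T →+* F => φ y) {φ | φ.comp (algebraMap B T) = ψ} := by
      intro φ hφ φ' hφ' he
      ext s
      obtain ⟨q, hq⟩ := hgen s
      apply mul_left_cancel₀ hψg
      simp only at he
      rw [hval φ hφ s q hq, hval φ' hφ' s q hq, he]
    rw [← hinj.encard_image]
    congr 1
    ext z
    simp only [Set.mem_image, Set.mem_ofPred_eq, mem_rootSet', aeval_def, Algebra.algebraMap_self,
      eval₂_map, RingHom.id_comp, Polynomial.map_id]
    constructor
    · rintro ⟨φ, hφ, rfl⟩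
      refine ⟨(hmonic.map ψ).ne_zero, ?_⟩
      rw [← hφ, ← hom_eval₂, ← aeval_def, minpoly.aeval, map_zero]
    · rintro ⟨-, hz⟩
      have hE : ∀ q q' : B[X], aeval y q = aeval y q' → eval₂ ψ z q = eval₂ ψ z q' := by
        intro q q' he
        obtain ⟨c, hc⟩ := minpoly.isIntegrallyClosed_dvd hyint (p := q - q')
          (by rw [map_sub, he, sub_self])
        rw [← sub_eq_zero, ← eval₂_sub, hc, eval₂_mul, hz, zero_mul]
      choose Q hQ using hgen
      have hadd : ∀ s t, eval₂ ψ z (Q (s + t)) = eval₂ ψ z (Q s) + eval₂ ψ z (Q t) := by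
        intro s t
        rw [← eval₂_add]
        exact hE _ _ (by rw [map_add, ← hQ, ← hQ, ← hQ, smul_add])
      have hmul : ∀ s t, ψ g * eval₂ ψ z (Q (s * t)) = eval₂ ψ z (Q s) * eval₂ ψ z (Q t) := by
        intro s t
        rw [← eval₂_mul, ← eval₂_C ψ z, ← eval₂_mul]
        exact hE _ _ (by
          rw [map_mul, map_mul, ← hQ, ← hQ, ← hQ, aeval_C]
          simp only [Algebra.smul_def]; ring)
      have halg : ∀ c, eval₂ ψ z (Q (algebraMap B T c)) = ψ g * ψ c := by
        intro c
        rw [← map_mul, ← eval₂_C ψ z]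
        exact hE _ _ (by rw [← hQ, aeval_C, map_mul, Algebra.smul_def])
      have hQ1 : eval₂ ψ z (Q 1) = ψ g := by simpa using halg 1
      have hQ0 : eval₂ ψ z (Q 0) = 0 := by simpa using halg 0
      refine ⟨
        { toFun := fun s => (ψ g)⁻¹ * eval₂ ψ z (Q s)
          map_one' := by rw [hQ1, inv_mul_cancel₀ hψg]
          map_zero' := by rw [hQ0, mul_zero]
          map_add' := fun s t => by rw [hadd, mul_add]
          map_mul' := fun s t => by
            rw [mul_mul_mul_comm, ← hmul, mul_assoc, inv_mul_cancel_left₀ hψg] }, ?_, ?_⟩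
      · ext c
        simp [halg, hψg]
      · have hy : eval₂ ψ z (Q y) = ψ g * z := by
          have : eval₂ ψ z (C g * X) = ψ g * z := by simp
          rw [← this]
          exact hE _ _ (by rw [← hQ, map_mul, aeval_C, aeval_X, Algebra.smul_def])
        simp [hy, hψg]

theorem MvPolynomial.finrank_restrictSupport {σ : Type*} (R : Type*) [CommRing R] [Nontrivial R]
    (s : Set (σ →₀ ℕ)) :
    Module.finrank R (MvPolynomial.restrictSupport R s) = s.ncard :=
  Module.finrank_eq_nat_card_basis (MvPolynomial.basisRestrictSupport R s)

theorem sum_card_finsuppAntidiag (d n : ℕ) :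
    ∑ m ∈ Finset.range (n + 1), (Finset.finsuppAntidiag (Finset.univ : Finset (Fin d)) m).card
      = (n + d).choose d := by
  simp only [Finset.card_finsuppAntidiag_nat_eq_choose, Finset.card_univ, Fintype.card_fin]
  induction n with
  | zero => simp
  | succ n ih =>
    rw [Finset.sum_range_succ, ih, Nat.choose_symm_add.symm, show n + 1 + d = (n + d) + 1 by ring,
      ← Nat.choose_symm (show d ≤ n + d + 1 by omega), show n + d + 1 - d = n + 1 by omega,
      Nat.choose_succ_succ, show d + (n + 1) - 1 = n + d by omega]

theorem finrank_restrictTotalDegree (d n : ℕ) :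
    Module.finrank ℂ (MvPolynomial.restrictTotalDegree (Fin d) ℂ n) = (n + d).choose d := by
  rw [MvPolynomial.restrictTotalDegree, MvPolynomial.finrank_restrictSupport,
    ← sum_card_finsuppAntidiag, ← Finset.card_biUnion, ← Set.ncard_coe_finset]
  · congr 1
    ext α
    simp [Finsupp.sum_fintype]
  · intro a _ b _ hab
    rw [Function.onFun, Finset.disjoint_left]
    intro α ha hb
    simp only [Finset.mem_finsuppAntidiag] at ha hb
    exact hab (ha.1.symm.trans hb.1)

theorem Submodule.pow_le_pow_of_one_le {R A : Type*} [CommSemiring R] [Semiring A] [Algebra R A]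
    {W : Submodule R A} (h : 1 ≤ W) {m n : ℕ} (hmn : m ≤ n) : W ^ m ≤ W ^ n := by
  induction hmn with
  | refl => exact le_rfl
  | @step k _ ih =>
    rw [pow_succ]
    calc W ^ m ≤ W ^ k * 1 := by rwa [mul_one]
      _ ≤ _ := mul_le_mul' le_rfl h

theorem Submodule.prod_pow_mem_pow {R A ι : Type*} [CommSemiring R] [CommSemiring A] [Algebra R A]
    {W : Submodule R A} {θ : ι → A} (hθ : ∀ i, θ i ∈ W) (s : Finset ι) (α : ι → ℕ) :
    ∏ i ∈ s, θ i ^ α i ∈ W ^ (∑ i ∈ s, α i) := by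
  classical
  induction s using Finset.induction_on with
  | empty => exact Submodule.one_le.mp le_rfl
  | insert i s hi ih =>
    rw [Finset.prod_insert hi, Finset.sum_insert hi, pow_add]
    exact Submodule.mul_mem_mul (Submodule.pow_mem_pow _ (hθ i) _) ih

theorem aeval_mem_pow_of_totalDegree_le {T : Type*} [CommRing T] [Algebra ℂ T] {d : ℕ}
    {θ : Fin d → T} {W : Submodule ℂ T} (h1 : 1 ≤ W) (hθ : ∀ i, θ i ∈ W) {n : ℕ}
    {p : MvPolynomial (Fin d) ℂ} (hp : p ∈ MvPolynomial.restrictTotalDegree (Fin d) ℂ n) :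
    MvPolynomial.aeval θ p ∈ W ^ n := by
  rw [MvPolynomial.mem_restrictTotalDegree] at hp
  rw [MvPolynomial.aeval_def, MvPolynomial.eval₂_eq']
  refine Submodule.sum_mem _ fun α hα => ?_
  rw [← Algebra.smul_def]
  refine Submodule.smul_mem _ _ (Submodule.pow_le_pow_of_one_le h1 ?_
    (Submodule.prod_pow_mem_pow hθ _ _))
  refine le_trans ?_ ((MvPolynomial.le_totalDegree hα).trans hp)
  rw [Finsupp.sum_fintype _ _ (fun _ => rfl)]

theorem one_sup_span_pow_le_map {T : Type*} [CommRing T] [Algebra ℂ T] {d : ℕ} (θ : Fin d → T)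
    (n : ℕ) : (1 ⊔ Submodule.span ℂ (Set.range θ)) ^ n ≤
      (MvPolynomial.restrictTotalDegree (Fin d) ℂ n).map (MvPolynomial.aeval θ).toLinearMap := by
  induction n with
  | zero =>
    rw [pow_zero, Submodule.one_le]
    exact ⟨1, by simp [MvPolynomial.mem_restrictTotalDegree], by simp⟩
  | succ n ih =>
    rw [pow_succ]
    refine (mul_le_mul' ih le_rfl).trans ?_
    rw [Submodule.mul_sup, mul_one, sup_le_iff]
    constructor
    · refine Submodule.map_mono fun p hp => ?_
      rw [MvPolynomial.mem_restrictTotalDegree] at hp ⊢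
      omega
    · rw [Submodule.mul_le]
      rintro _ ⟨p, hp, rfl⟩ x hx
      induction hx using Submodule.span_induction with
      | mem x hx =>
        obtain ⟨i, rfl⟩ := hx
        refine ⟨p * MvPolynomial.X i, ?_, by simp⟩
        simp only [SetLike.mem_coe, MvPolynomial.mem_restrictTotalDegree] at hp ⊢
        refine (MvPolynomial.totalDegree_mul _ _).trans ?_
        rw [MvPolynomial.totalDegree_X]
        omega
      | zero => rw [mul_zero]; exact zero_mem _
      | add x y _ _ hx hy => rw [mul_add]; exact add_mem hx hy
      | smul a x _ hx => rw [mul_smul_comm]; exact Submodule.smul_mem _ _ hx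

section Growth

variable {T : Type*} [CommRing T] [IsDomain T] [Algebra ℂ T] {d r : ℕ}

/-- Linear combinations of `t` with coefficients polynomials of degree at most `n` in `θ`. -/
noncomputable def boundedCombination (θ : Fin d → T) (t : Fin r → T) (n : ℕ) :
    (Fin r → MvPolynomial.restrictTotalDegree (Fin d) ℂ n) →ₗ[ℂ] T :=
  ∑ i, (LinearMap.mulRight ℂ (t i)) ∘ₗ (MvPolynomial.aeval θ).toLinearMap ∘ₗ
    (Submodule.subtype _) ∘ₗ (LinearMap.proj i)

omit [IsDomain T] in
theorem boundedCombination_apply (θ : Fin d → T) (t : Fin r → T) (n : ℕ)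
    (c : Fin r → MvPolynomial.restrictTotalDegree (Fin d) ℂ n) :
    boundedCombination θ t n c = ∑ i, MvPolynomial.aeval θ (c i : MvPolynomial (Fin d) ℂ) * t i := by
  simp [boundedCombination]

omit [IsDomain T] in
theorem finrank_range_boundedCombination_le (θ : Fin d → T) (t : Fin r → T) (n : ℕ) :
    Module.finrank ℂ (LinearMap.range (boundedCombination θ t n)) ≤ r * (n + d).choose d := by
  refine (LinearMap.finrank_range_le _).trans ?_
  rw [Module.finrank_pi_fintype]
  simp [finrank_restrictTotalDegree]

omit [IsDomain T] in
theorem exists_le_finrank_pow {θ : Fin d → T} {W : Submodule ℂ T} [FiniteDimensional ℂ W]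
    (h1 : 1 ≤ W) (hθW : ∀ i, θ i ∈ W) (hgen : ∀ s, ∃ n, s ∈ W ^ n) {t : Fin r → T}
    (ht : ∀ c : Fin r → MvPolynomial (Fin d) ℂ,
      ∑ i, MvPolynomial.aeval θ (c i) * t i = 0 → ∀ i, c i = 0) :
    ∃ E, ∀ n, r * (n + d).choose d ≤ Module.finrank ℂ ↥(W ^ (n + E)) := by
  choose e he using fun i => hgen (t i)
  refine ⟨∑ i, e i, fun n => ?_⟩
  have hinj : Function.Injective (boundedCombination θ t n) := by
    rw [injective_iff_map_eq_zero]
    intro c hc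
    rw [boundedCombination_apply] at hc
    funext i
    exact Subtype.ext (ht _ hc i)
  have hr := LinearMap.finrank_range_of_inj hinj
  rw [Module.finrank_pi_fintype] at hr
  simp only [finrank_restrictTotalDegree, Finset.sum_const, Finset.card_univ, Fintype.card_fin,
    smul_eq_mul] at hr
  rw [← hr]
  have : Module.Finite ℂ ↥(W ^ (n + ∑ i, e i)) :=
    Module.Finite.iff_fg.mpr ((Module.Finite.iff_fg.mp ‹_›).pow _)
  apply Submodule.finrank_mono
  rintro _ ⟨c, rfl⟩
  rw [boundedCombination_apply]
  refine Submodule.sum_mem _ fun i _ => ?_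
  rw [pow_add]
  refine Submodule.mul_mem_mul (aeval_mem_pow_of_totalDegree_le h1 hθW (c i).2) ?_
  exact Submodule.pow_le_pow_of_one_le h1
    (Finset.single_le_sum (f := e) (fun _ _ => Nat.zero_le _) (Finset.mem_univ i)) (he i)

omit [IsDomain T] in
theorem pow_add_le_of_pow_succ_le {W Θ : Submodule ℂ T} {M : ℕ}
    (hM : ∀ m, M ≤ m → W ^ (m + 1) ≤ Θ * W ^ m) (n : ℕ) : W ^ (M + n) ≤ Θ ^ n * W ^ M := by
  induction n with
  | zero => simp
  | succ n ih =>
    calc W ^ (M + (n + 1)) ≤ Θ * W ^ (M + n) := hM _ (Nat.le_add_right _ _)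
      _ ≤ Θ * (Θ ^ n * W ^ M) := mul_le_mul' le_rfl ih
      _ = _ := by rw [pow_succ']; ring

theorem exists_finrank_pow_le {θ : Fin d → T} {W : Submodule ℂ T} [FiniteDimensional ℂ W]
    (h1 : 1 ≤ W) {M : ℕ}
    (hM : ∀ m, M ≤ m → W ^ (m + 1) ≤ (1 ⊔ Submodule.span ℂ (Set.range θ)) * W ^ m)
    {t : Fin r → T} {g : T} (hg : g ≠ 0)
    (ht : ∀ s : T, ∃ c : Fin r → MvPolynomial (Fin d) ℂ,
      g * s = ∑ i, MvPolynomial.aeval θ (c i) * t i) :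
    ∃ E, ∀ n, Module.finrank ℂ ↥(W ^ n) ≤ r * (n + E + d).choose d := by
  have hfin : ∀ n, Module.Finite ℂ ↥(W ^ n) := fun n =>
    Module.Finite.iff_fg.mpr ((Module.Finite.iff_fg.mp ‹_›).pow _)
  have hmono : ∀ m n, m ≤ n → LinearMap.range (boundedCombination θ t m) ≤
      LinearMap.range (boundedCombination θ t n) := by
    rintro m n hmn _ ⟨c, rfl⟩
    refine ⟨fun i => ⟨c i, ?_⟩, by simp [boundedCombination_apply]⟩
    have := (c i).2
    rw [MvPolynomial.mem_restrictTotalDegree] at this ⊢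
    exact this.trans hmn
  obtain ⟨S, hS⟩ := Module.Finite.iff_fg.mp (hfin M)
  have hex : ∀ s : T, ∃ E, g * s ∈ LinearMap.range (boundedCombination θ t E) := by
    intro s
    obtain ⟨c, hc⟩ := ht s
    refine ⟨Finset.univ.sup fun i => (c i).totalDegree, fun i => ⟨c i, ?_⟩, ?_⟩
    · rw [MvPolynomial.mem_restrictTotalDegree]
      exact Finset.le_sup (f := fun i => (c i).totalDegree) (Finset.mem_univ i)
    · rw [hc, boundedCombination_apply]
  choose e he using hex
  have hWM : ∀ s ∈ W ^ M, g * s ∈ LinearMap.range (boundedCombination θ t (S.sup e)) := by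
    intro s hs
    rw [← hS] at hs
    induction hs using Submodule.span_induction with
    | mem x hx => exact hmono _ _ (Finset.le_sup hx) (he x)
    | zero => rw [mul_zero]; exact zero_mem _
    | add x y _ _ hx hy => rw [mul_add]; exact add_mem hx hy
    | smul a x _ hx => rw [mul_smul_comm]; exact Submodule.smul_mem _ _ hx
  refine ⟨S.sup e, fun n => ?_⟩
  refine le_trans ?_ (finrank_range_boundedCombination_le θ t (n + S.sup e))
  have hmem : ∀ s ∈ W ^ n, LinearMap.mulLeft ℂ g s ∈
      LinearMap.range (boundedCombination θ t (n + S.sup e)) := by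
    intro s hs
    have hs' := pow_add_le_of_pow_succ_le hM n
      (Submodule.pow_le_pow_of_one_le h1 (Nat.le_add_left n M) hs)
    refine Submodule.mul_induction_on hs' ?_ fun x y hx hy => by rw [map_add]; exact add_mem hx hy
    intro b hb w hw
    obtain ⟨p, hp, rfl⟩ := one_sup_span_pow_le_map θ n hb
    obtain ⟨c, hc⟩ := hWM w hw
    refine ⟨fun i => ⟨p * c i, ?_⟩, ?_⟩
    · have h2 := (c i).2
      simp only [SetLike.mem_coe, MvPolynomial.mem_restrictTotalDegree] at hp h2 ⊢
      exact (MvPolynomial.totalDegree_mul _ _).trans (add_le_add hp h2)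
    · rw [boundedCombination_apply] at hc ⊢
      simp only [AlgHom.toLinearMap_apply, LinearMap.mulLeft_apply, map_mul]
      rw [mul_left_comm, ← hc, Finset.mul_sum]
      exact Finset.sum_congr rfl fun i _ => by rw [mul_assoc]
  refine LinearMap.finrank_le_finrank_of_injective (f := (LinearMap.mulLeft ℂ g).restrict hmem) ?_
  intro a b hab
  exact Subtype.ext (mul_left_cancel₀ hg (congrArg Subtype.val hab))

end Growth

theorem exists_generic_card_and_growth {T : Type*} [CommRing T] [IsDomain T] [Algebra ℂ T] {d : ℕ}
    {θ : Fin d → T} (hθ : AlgebraicIndependent ℂ θ) {W : Submodule ℂ T} [FiniteDimensional ℂ W]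
    (h1 : 1 ≤ W) (hθW : ∀ i, θ i ∈ W) (hgen : ∀ s, ∃ n, s ∈ W ^ n) {M : ℕ}
    (hM : ∀ m, M ≤ m → W ^ (m + 1) ≤ (1 ⊔ Submodule.span ℂ (Set.range θ)) * W ^ m)
    {s : T} (hs : s ≠ 0) :
    ∃ r : ℕ,
      (∃ h : MvPolynomial (Fin d) ℂ, h ≠ 0 ∧ ∀ b : Fin d → ℂ, MvPolynomial.eval b h ≠ 0 →
        {φ : T →ₐ[ℂ] ℂ | ∀ i, φ (θ i) = b i}.encard = r ∧
        ∀ φ : T →ₐ[ℂ] ℂ, (∀ i, φ (θ i) = b i) → φ s ≠ 0) ∧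
      (∃ E, ∀ n, r * (n + d).choose d ≤ Module.finrank ℂ ↥(W ^ (n + E))) ∧
      ∃ E, ∀ n, Module.finrank ℂ ↥(W ^ n) ≤ r * (n + E + d).choose d := by
  let _ : Algebra (MvPolynomial (Fin d) ℂ) T := (MvPolynomial.aeval θ).toRingHom.toAlgebra
  have halg : ∀ p : MvPolynomial (Fin d) ℂ,
      algebraMap (MvPolynomial (Fin d) ℂ) T p = MvPolynomial.aeval θ p := fun _ => rfl
  have hsmul : ∀ (p : MvPolynomial (Fin d) ℂ) (x : T), p • x = MvPolynomial.aeval θ p * x :=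
    fun p x => by rw [Algebra.smul_def, halg]
  have : FaithfulSMul (MvPolynomial (Fin d) ℂ) T :=
    (faithfulSMul_iff_algebraMap_injective _ _).mpr hθ
  have : IsScalarTower ℂ (MvPolynomial (Fin d) ℂ) T := IsScalarTower.of_algebraMap_eq fun c => by
    rw [halg, MvPolynomial.algebraMap_eq, MvPolynomial.aeval_C]
  have hfinM : (W ^ M).FG := (Module.Finite.iff_fg.mp ‹_›).pow _
  have : Module.Finite (MvPolynomial (Fin d) ℂ) T := by
    obtain ⟨S, hS⟩ := hfinM
    refine ⟨⟨S, ?_⟩⟩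
    rw [eq_top_iff]
    intro x _
    obtain ⟨n, hn⟩ := hgen x
    have hx := pow_add_le_of_pow_succ_le hM n
      (Submodule.pow_le_pow_of_one_le h1 (Nat.le_add_left n M) hn)
    refine Submodule.mul_induction_on hx ?_ fun x y hx hy => add_mem hx hy
    intro b hb w hw
    obtain ⟨p, hp, rfl⟩ := one_sup_span_pow_le_map θ n hb
    rw [AlgHom.toLinearMap_apply, ← hsmul]
    refine Submodule.smul_mem _ _ ?_
    rw [← hS] at hw
    exact Submodule.span_le_restrictScalars ℂ (MvPolynomial (Fin d) ℂ) _ hw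
  obtain ⟨r, t, ht, ⟨g, hg, hgt⟩, h, hh, hcard⟩ :=
    exists_generic_fiber_card (MvPolynomial (Fin d) ℂ) T ℂ
  obtain ⟨h', hh', w, hw⟩ := (IsAlgebraic.of_finite (MvPolynomial (Fin d) ℂ) s).exists_nonzero_dvd
    (mem_nonZeroDivisors_of_ne_zero hs)
  refine ⟨r, ⟨h * h', mul_ne_zero hh hh', fun b hb => ⟨?_, ?_⟩⟩, ?_, ?_⟩
  · rw [map_mul] at hb
    rw [← hcard (MvPolynomial.eval b) (left_ne_zero_of_mul hb)]
    have hinj : Function.Injective (fun φ : T →ₐ[ℂ] ℂ => (φ : T →+* ℂ)) :=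
      AlgHom.coe_ringHom_injective
    rw [← hinj.encard_image]
    congr 1
    ext φ
    simp only [Set.mem_image, Set.mem_ofPred_eq]
    constructor
    · rintro ⟨φ, hφ, rfl⟩
      apply MvPolynomial.ringHom_ext
      · intro c
        simp [halg]
      · intro i
        simp [halg, hφ]
    · intro hφ
      have hφ' : ∀ p, φ (MvPolynomial.aeval θ p) = MvPolynomial.eval b p := fun p => by
        rw [← hφ]; rfl
      refine ⟨⟨φ, fun c => ?_⟩, fun i => ?_, rfl⟩
      · simpa using hφ' (MvPolynomial.C c)
      · simpa using hφ' (MvPolynomial.X i)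
  · intro φ hφ h0
    rw [map_mul] at hb
    apply right_ne_zero_of_mul hb
    have h3 : (φ.comp (MvPolynomial.aeval θ)) = MvPolynomial.aeval b := by
      ext i; simp [hφ]
    have h4 := congrArg φ hw
    rw [halg, map_mul, h0, zero_mul, ← AlgHom.comp_apply, h3] at h4
    simpa using h4
  · refine exists_le_finrank_pow h1 hθW hgen (t := t) fun c hc => ?_
    rw [Fintype.linearIndependent_iff] at ht
    exact ht c (by simpa only [hsmul] using hc)
  · refine exists_finrank_pow_le (g := MvPolynomial.aeval θ g) h1 hM (t := t) ?_ fun s => ?_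
    · exact fun h0 => hg (hθ (by rw [h0, map_zero]))
    · obtain ⟨c, hc⟩ := (Submodule.mem_span_range_iff_exists_fun _).mp (hgt s)
      exact ⟨c, by simpa only [hsmul] using hc.symm⟩

namespace Hypersimplex

variable {σ : Type*} [DecidableEq σ]

/-- The exchange relations between the coordinates of a point of the toric variety of the
hypersimplex, indexed by the `k`-element subsets. -/
def IsExchange (k : ℕ) (p : Finset σ → ℂ) : Prop :=
  ∀ S S' : Finset σ, S.card = k → S'.card = k → ∀ j ∈ S, ∀ i ∈ S', i ∉ S → j ∉ S' →
    p S * p S' = p (insert i (S.erase j)) * p (insert j (S'.erase i))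

theorem sum_powersetCard_succ (x : σ → ℂ) (Z : Finset σ) {i : σ} (hi : i ∈ Z) (m : ℕ) :
    ∑ t ∈ Z.powersetCard (m + 1), ∏ j ∈ t, x j =
      ∑ t ∈ (Z.erase i).powersetCard (m + 1), ∏ j ∈ t, x j +
        x i * ∑ t ∈ (Z.erase i).powersetCard m, ∏ j ∈ t, x j := by
  have hn : i ∉ Z.erase i := Finset.notMem_erase i Z
  have hsub : ∀ t ∈ (Z.erase i).powersetCard m, i ∉ t := fun t ht h =>
    hn ((Finset.mem_powersetCard.1 ht).1 h)
  conv_lhs => rw [← Finset.insert_erase hi, Finset.powersetCard_succ_insert hn]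
  rw [Finset.sum_union, Finset.sum_image, Finset.mul_sum]
  · congr 1
    exact Finset.sum_congr rfl fun t ht => Finset.prod_insert (hsub t ht)
  · intro t ht t' ht' h
    rw [← Finset.erase_insert (hsub t ht), h, Finset.erase_insert (hsub t' ht')]
  · rw [Finset.disjoint_left]
    intro t ht ht'
    obtain ⟨t', -, rfl⟩ := Finset.mem_image.1 ht'
    exact hn ((Finset.mem_powersetCard.1 ht).1 (Finset.mem_insert_self _ _))

theorem sum_sum_powersetCard_erase (x : σ → ℂ) (Z : Finset σ) (m : ℕ) :
    ∑ i ∈ Z, ∑ t ∈ (Z.erase i).powersetCard m, ∏ j ∈ t, x j =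
      ((Z.card : ℂ) - m) * ∑ t ∈ Z.powersetCard m, ∏ j ∈ t, x j := by
  rw [Finset.sum_comm' (t' := Z.powersetCard m) (s' := fun t => Z \ t), Finset.mul_sum]
  · refine Finset.sum_congr rfl fun t ht => ?_
    obtain ⟨h1, h2⟩ := Finset.mem_powersetCard.1 ht
    rw [Finset.sum_const, nsmul_eq_mul, Finset.cast_card_sdiff h1, h2]
  · intro i t
    simp only [Finset.mem_powersetCard, Finset.mem_sdiff, Finset.subset_erase]
    tauto

theorem exists_sum_powersetCard_erase_ne_zero (x : σ → ℂ) (Z : Finset σ)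
    (hx : ∀ i ∈ Z, x i ≠ 0) {m : ℕ} (hm : m < Z.card) :
    ∃ i ∈ Z, ∑ t ∈ (Z.erase i).powersetCard m, ∏ j ∈ t, x j ≠ 0 := by
  induction m with
  | zero =>
    obtain ⟨i, hi⟩ := Finset.card_pos.1 hm
    exact ⟨i, hi, by simp⟩
  | succ m ih =>
    by_contra! h
    obtain ⟨i, hi, hne⟩ := ih (by omega)
    have hs := sum_sum_powersetCard_erase x Z (m + 1)
    rw [Finset.sum_eq_zero h, eq_comm, mul_eq_zero, sub_eq_zero, Nat.cast_inj] at hs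
    have h1 := sum_powersetCard_succ x Z hi m
    rw [hs.resolve_left (by omega), h i hi, zero_add, eq_comm, mul_eq_zero] at h1
    exact h1.elim (hx i hi) hne

theorem IsExchange.exists_rank_one {k : ℕ} {p : Finset σ → ℂ} (hp : IsExchange k p)
    {S₀ : Finset σ} (h₀ : S₀.card = k) (hne : p S₀ ≠ 0) :
    ∃ a : σ → ℂ, ∀ j ∈ S₀, ∀ i ∉ S₀, p (insert i (S₀.erase j)) = p S₀ * (a i * a j) := by
  by_cases hz : ∀ j ∈ S₀, ∀ i ∉ S₀, p (insert i (S₀.erase j)) = 0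
  · exact ⟨0, fun j hj i hi => by simp [hz j hj i hi]⟩
  push Not at hz
  obtain ⟨j₀, hj₀, i₀, hi₀, hy⟩ := hz
  refine ⟨fun l => if l ∈ S₀ then p (insert i₀ (S₀.erase l)) / p S₀ else
    p (insert l (S₀.erase j₀)) / p (insert i₀ (S₀.erase j₀)), fun j hj i hi => ?_⟩
  beta_reduce
  rw [if_neg hi, if_pos hj]
  have key : p (insert i (S₀.erase j)) * p (insert i₀ (S₀.erase j₀)) =
      p (insert i₀ (S₀.erase j)) * p (insert i (S₀.erase j₀)) := by
    by_cases hii : i = i₀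
    · subst hii; rfl
    have hc : ∀ i ∉ S₀, ∀ j ∈ S₀, (insert i (S₀.erase j)).card = k := fun i hi j hj => by
      rw [Finset.card_insert_of_notMem (fun h => hi (Finset.mem_of_mem_erase h)),
        Finset.card_erase_add_one hj, h₀]
    have := hp _ _ (hc i hi j hj) (hc i₀ hi₀ j₀ hj₀) i (Finset.mem_insert_self _ _) i₀
      (Finset.mem_insert_self _ _)
      (by simp [Ne.symm hii, hi₀]) (by simp [hii, hi])
    rwa [Finset.erase_insert (fun h => hi (Finset.mem_of_mem_erase h)),
      Finset.erase_insert (fun h => hi₀ (Finset.mem_of_mem_erase h))] at this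
  field_simp
  rw [key, mul_comm]

/-- Parametrization of the orbits of the toric variety of the hypersimplex. -/
theorem IsExchange.exists_eq_prod {k : ℕ} {p : Finset σ → ℂ} (hp : IsExchange k p)
    {S₀ : Finset σ} (h₀ : S₀.card = k) (hne : p S₀ ≠ 0) :
    ∃ a : σ → ℂ, ∀ S : Finset σ, S.card = k →
      p S = p S₀ * ((∏ j ∈ S₀ \ S, a j) * ∏ i ∈ S \ S₀, a i) := by
  obtain ⟨a, ha⟩ := hp.exists_rank_one h₀ hne
  refine ⟨a, fun S hS => ?_⟩
  induction hn : (S₀ \ S).card generalizing S with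
  | zero =>
    have h1 : S₀ ⊆ S := Finset.sdiff_eq_empty_iff_subset.1 (Finset.card_eq_zero.1 hn)
    have h2 : S₀ = S := Finset.eq_of_subset_of_card_le h1 (by omega)
    simp [h2]
  | succ n ih =>
    have hcard : (S \ S₀).card = (S₀ \ S).card :=
      Finset.card_sdiff_comm (hS.trans h₀.symm)
    obtain ⟨j, hj⟩ := Finset.card_pos.1 (show 0 < (S₀ \ S).card by omega)
    obtain ⟨i, hi⟩ := Finset.card_pos.1 (show 0 < (S \ S₀).card by omega)
    rw [Finset.mem_sdiff] at hi hj
    have hc : (insert j (S.erase i)).card = k := by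
      rw [Finset.card_insert_of_notMem (fun h => hj.2 (Finset.mem_of_mem_erase h)),
        Finset.card_erase_add_one hi.1, hS]
    have hd1 : S₀ \ S = insert j (S₀ \ insert j (S.erase i)) := by
      ext l; simp only [Finset.mem_sdiff, Finset.mem_insert, Finset.mem_erase]
      by_cases hlj : l = j
      · subst hlj; simp [hj]
      · by_cases hli : l = i
        · subst hli; simp [hi, hlj]
        · simp [hlj, hli]
    have hd2 : S \ S₀ = insert i (insert j (S.erase i) \ S₀) := by
      ext l; simp only [Finset.mem_sdiff, Finset.mem_insert, Finset.mem_erase]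
      by_cases hli : l = i
      · subst hli; simp [hi]
      · by_cases hlj : l = j
        · subst hlj; simp [hj, hli]
        · simp [hlj, hli]
    have hj' : j ∉ S₀ \ insert j (S.erase i) := by simp
    have hi' : i ∉ insert j (S.erase i) \ S₀ := by
      have : i ≠ j := fun h => hi.2 (h ▸ hj.1)
      simp [this]
    have hI := ih _ hc (by
      rw [hd1, Finset.card_insert_of_notMem hj'] at hn
      omega)
    have hx := hp S₀ S h₀ hS j hj.1 i hi.1 hi.2 hj.2
    rw [ha j hj.1 i hi.2, hI] at hx
    rw [hd1, hd2, Finset.prod_insert hj', Finset.prod_insert hi']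
    apply mul_left_cancel₀ hne
    rw [hx]
    ring

/-- The only point of the toric variety of the hypersimplex with vanishing moments is zero. -/
theorem IsExchange.eq_zero [Fintype σ] {k : ℕ} (hk : 1 ≤ k) {p : Finset σ → ℂ}
    (hp : IsExchange k p)
    (h : ∀ i : σ, ∑ S ∈ (Finset.univ : Finset σ).powersetCard k with i ∈ S, p S = 0)
    (S : Finset σ) (hS : S.card = k) : p S = 0 := by
  by_contra hne
  obtain ⟨a, ha⟩ := hp.exists_eq_prod hS hne
  set Z : Finset σ := {i | a i ≠ 0} with hZ
  have hmZ : ∀ i, i ∈ Z ↔ a i ≠ 0 := fun i => by simp [hZ]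
  have hsupp : ∀ S', S'.card = k → p S' ≠ 0 → S \ Z ⊆ S' ∧ S' ⊆ S ∪ Z := by
    intro S' hS' hne'
    rw [ha S' hS', mul_ne_zero_iff, mul_ne_zero_iff, Finset.prod_ne_zero_iff,
      Finset.prod_ne_zero_iff] at hne'
    obtain ⟨-, h1, h2⟩ := hne'
    refine ⟨fun i hi => ?_, fun i hi => ?_⟩
    · rw [Finset.mem_sdiff] at hi
      by_contra hi'
      exact hi.2 ((hmZ i).2 (h1 i (Finset.mem_sdiff.2 ⟨hi.1, hi'⟩)))
    · by_cases hiS : i ∈ S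
      · exact Finset.mem_union_left _ hiS
      · exact Finset.mem_union_right _ ((hmZ i).2 (h2 i (Finset.mem_sdiff.2 ⟨hi, hiS⟩)))
  set x : σ → ℂ := fun i => if i ∈ S then (a i)⁻¹ else a i with hx
  have hxne : ∀ i ∈ Z, x i ≠ 0 := by
    intro i hi
    have := (hmZ i).1 hi
    simp only [hx]
    split_ifs
    · exact inv_ne_zero this
    · exact this
  have hval : ∀ t ⊆ Z, (t ∪ S \ Z).card = k →
      p (t ∪ S \ Z) = (p S * ∏ j ∈ S ∩ Z, a j) * ∏ i ∈ t, x i := by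
    intro t ht hc
    have e1 : S \ (t ∪ S \ Z) = (S ∩ Z) \ t := by
      ext l; simp only [Finset.mem_sdiff, Finset.mem_union, Finset.mem_inter]; tauto
    have e2 : (t ∪ S \ Z) \ S = t \ S := by
      ext l; simp only [Finset.mem_sdiff, Finset.mem_union]; tauto
    have e3 : ∏ i ∈ t, x i = (∏ i ∈ t ∩ S, (a i)⁻¹) * ∏ i ∈ t \ S, a i := by
      rw [← Finset.prod_inter_mul_prod_sdiff t S]
      congr 1
      · exact Finset.prod_congr rfl fun i hi => by
          simp [hx, (Finset.mem_inter.1 hi).2]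
      · exact Finset.prod_congr rfl fun i hi => by
          simp [hx, (Finset.mem_sdiff.1 hi).2]
    have e4 : ∏ j ∈ S ∩ Z, a j = (∏ j ∈ t ∩ S, a j) * ∏ j ∈ (S ∩ Z) \ t, a j := by
      rw [← Finset.prod_inter_mul_prod_sdiff (S ∩ Z) t]
      congr 2
      ext l; simp only [Finset.mem_inter]
      have := @ht l
      tauto
    have e5 : (∏ j ∈ t ∩ S, a j) ≠ 0 := Finset.prod_ne_zero_iff.2 fun i hi =>
      (hmZ i).1 (ht (Finset.mem_inter.1 hi).1)
    rw [ha _ hc, e1, e2, e3, e4, Finset.prod_inv_distrib]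
    field_simp
  have hsplit : (S ∩ Z).card + (S \ Z).card = k := by
    rw [Finset.card_inter_add_card_sdiff, hS]
  obtain hk' | hk' := Nat.eq_zero_or_pos (S ∩ Z).card
  · obtain ⟨i, hi⟩ := Finset.card_pos.1 (show 0 < S.card by omega)
    have hSZ : S \ Z = S := by
      rw [Finset.card_eq_zero] at hk'
      exact Finset.sdiff_eq_self_iff_disjoint.2 (Finset.disjoint_iff_inter_eq_empty.2 hk')
    have := h i
    rw [Finset.sum_eq_single S] at this
    · exact hne this
    · intro S' hS' hSS'
      by_contra hne'
      have hc := (Finset.mem_powersetCard.1 (Finset.mem_filter.1 hS').1).2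
      have h1 := (hsupp S' hc hne').1
      rw [hSZ] at h1
      exact hSS' (Finset.eq_of_subset_of_card_le h1 (by omega)).symm
    · intro h'
      exact absurd (Finset.mem_filter.2 ⟨Finset.mem_powersetCard.2 ⟨Finset.subset_univ _, hS⟩, hi⟩) h'
  · obtain ⟨m, hm⟩ : ∃ m, (S ∩ Z).card = m + 1 := ⟨(S ∩ Z).card - 1, by omega⟩
    obtain ⟨i, hi, hne'⟩ := exists_sum_powersetCard_erase_ne_zero x Z hxne (m := m) (by
      have := Finset.card_le_card (Finset.inter_subset_right : S ∩ Z ⊆ Z)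
      omega)
    refine hne' ?_
    have hC : (p S * ∏ j ∈ S ∩ Z, a j) * x i ≠ 0 := by
      refine mul_ne_zero (mul_ne_zero hne (Finset.prod_ne_zero_iff.2 fun j hj => ?_)) (hxne i hi)
      exact (hmZ j).1 (Finset.mem_inter.1 hj).2
    refine (mul_eq_zero.1 (?_ : (p S * ∏ j ∈ S ∩ Z, a j) * x i * _ = 0)).resolve_left hC
    rw [← h i, Finset.mul_sum]
    have hdis : ∀ t ⊆ Z, Disjoint t (S \ Z) := fun t ht =>
      Finset.disjoint_of_subset_left ht Finset.disjoint_sdiff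
    have hcard : ∀ t ∈ (Z.erase i).powersetCard m, (insert i t ∪ S \ Z).card = k ∧ insert i t ⊆ Z ∧
        i ∉ t := by
      intro t ht
      obtain ⟨h1, h2⟩ := Finset.mem_powersetCard.1 ht
      have h3 : insert i t ⊆ Z :=
        Finset.insert_subset hi (h1.trans (Finset.erase_subset _ _))
      have h4 : i ∉ t := fun h => Finset.notMem_erase i Z (h1 h)
      refine ⟨?_, h3, h4⟩
      rw [Finset.card_union_of_disjoint (hdis _ h3), Finset.card_insert_of_notMem h4]
      omega
    refine Finset.sum_of_injOn (fun t => insert i t ∪ S \ Z) ?_ ?_ ?_ ?_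
    · intro t ht t' ht' htt
      obtain ⟨-, h1, h2⟩ := hcard t ht
      obtain ⟨-, h1', h2'⟩ := hcard t' ht'
      have h3 : ∀ t, insert i t ⊆ Z → (insert i t ∪ S \ Z) ∩ Z = insert i t := by
        intro t ht
        ext l
        simp only [Finset.mem_inter, Finset.mem_union, Finset.mem_sdiff]
        have := @ht l
        tauto
      have h4 : insert i t = insert i t' := by
        rw [← h3 t h1, ← h3 t' h1']
        exact congrArg (· ∩ Z) htt
      rw [← Finset.erase_insert h2, h4, Finset.erase_insert h2']
    · intro t ht
      simp only [Finset.coe_filter, Set.mem_ofPred_eq, Finset.mem_powersetCard]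
      exact ⟨⟨Finset.subset_univ _, (hcard t ht).1⟩, by simp⟩
    · intro S' hS' hn
      by_contra hne''
      obtain ⟨h1, h2⟩ := Finset.mem_filter.1 hS'
      have hc := (Finset.mem_powersetCard.1 h1).2
      obtain ⟨h3, h4⟩ := hsupp S' hc hne''
      have h5 : S' ∩ Z ∪ S \ Z = S' := by
        ext l
        have := @h3 l
        have := @h4 l
        simp only [Finset.mem_inter, Finset.mem_union, Finset.mem_sdiff] at *
        tauto
      refine hn ⟨(S' ∩ Z).erase i, ?_, ?_⟩
      · have h6 : (S' ∩ Z).card + (S \ Z).card = k := by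
          rw [← Finset.card_union_of_disjoint (hdis _ Finset.inter_subset_right), h5, hc]
        rw [Finset.mem_coe, Finset.mem_powersetCard]
        refine ⟨Finset.erase_subset_erase _ Finset.inter_subset_right, ?_⟩
        rw [Finset.card_erase_of_mem (Finset.mem_inter.2 ⟨h2, hi⟩)]
        omega
      · simp only
        rw [Finset.insert_erase (Finset.mem_inter.2 ⟨h2, hi⟩), h5]
    · intro t ht
      obtain ⟨h1, h2, h3⟩ := hcard t ht
      rw [hval _ h2 h1, Finset.prod_insert h3]
      ring

theorem IsExchange.exists_eq_prod_univ [Fintype σ] {k : ℕ} (hk : 1 ≤ k) (hkd : k < Fintype.card σ)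
    {p : Finset σ → ℂ} (hp : IsExchange k p) (hne : ∀ S, S.card = k → p S ≠ 0) :
    ∃ x : σ → ℂ, ∀ S : Finset σ, S.card = k → p S = ∏ i ∈ S, x i := by
  obtain ⟨S₀, -, h₀⟩ := Finset.exists_subset_card_eq (s := (Finset.univ : Finset σ)) (n := k)
    (by simpa using hkd.le)
  obtain ⟨a, ha⟩ := hp.exists_eq_prod h₀ (hne _ h₀)
  have hmix : ∀ j ∈ S₀, ∀ i ∉ S₀, a j ≠ 0 ∧ a i ≠ 0 := by
    intro j hj i hi
    have hc : (insert i (S₀.erase j)).card = k := by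
      rw [Finset.card_insert_of_notMem (fun h => hi (Finset.mem_of_mem_erase h)),
        Finset.card_erase_add_one hj, h₀]
    have := hne _ hc
    rw [ha _ hc, mul_ne_zero_iff, mul_ne_zero_iff, Finset.prod_ne_zero_iff,
      Finset.prod_ne_zero_iff] at this
    have hij : j ≠ i := fun h => hi (h ▸ hj)
    exact ⟨this.2.1 j (by simp [hj, hij]), this.2.2 i (by simp [hi])⟩
  have hane : ∀ i, a i ≠ 0 := by
    intro i
    by_cases hi : i ∈ S₀
    · obtain ⟨l, -, hl⟩ := Finset.exists_mem_notMem_of_card_lt_card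
        (s := S₀) (t := Finset.univ) (by rw [h₀]; simpa using hkd)
      exact (hmix i hi l hl).1
    · obtain ⟨l, hl⟩ := Finset.card_pos.1 (show 0 < S₀.card by omega)
      exact (hmix l hl i hi).2
  obtain ⟨t, ht⟩ := IsAlgClosed.exists_pow_nat_eq (p S₀ * ∏ j ∈ S₀, a j) (show 0 < k by omega)
  refine ⟨fun i => t * if i ∈ S₀ then (a i)⁻¹ else a i, fun S hS => ?_⟩
  rw [Finset.prod_mul_distrib, Finset.prod_const, hS, ht, ha S hS,
    ← Finset.prod_inter_mul_prod_sdiff S S₀,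
    Finset.prod_congr (s₁ := S ∩ S₀) rfl fun i hi => if_pos (Finset.mem_inter.1 hi).2,
    Finset.prod_congr (s₁ := S \ S₀) rfl fun i hi => if_neg (Finset.mem_sdiff.1 hi).2,
    ← Finset.prod_inter_mul_prod_sdiff S₀ S a, Finset.inter_comm S₀ S, Finset.prod_inv_distrib]
  have : ∏ i ∈ S ∩ S₀, a i ≠ 0 := Finset.prod_ne_zero_iff.2 fun i _ => hane i
  field_simp

end Hypersimplex

namespace Hypersimplex

open MvPolynomial

variable {σ : Type*}

/-- The square-free monomial of a `k`-element subset, and zero for the other subsets. -/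
noncomputable def mon (k : ℕ) (S : Finset σ) : MvPolynomial σ ℂ :=
  if S.card = k then ∏ i ∈ S, X i else 0

theorem mon_of_card {k : ℕ} {S : Finset σ} (hS : S.card = k) : mon k S = ∏ i ∈ S, X i :=
  if_pos hS

theorem mon_of_card_ne {k : ℕ} {S : Finset σ} (hS : S.card ≠ k) : mon k S = 0 :=
  if_neg hS

theorem isHomogeneous_mon (k : ℕ) (S : Finset σ) : (mon k S).IsHomogeneous k := by
  unfold mon
  split_ifs with h
  · have := IsHomogeneous.prod S (fun i => (X i : MvPolynomial σ ℂ)) (fun _ => 1)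
      fun i _ => isHomogeneous_X ℂ i
    simpa [h] using this
  · exact isHomogeneous_zero _ _ _

theorem isExchange_mon [DecidableEq σ] (k : ℕ) {S S' : Finset σ} (hS : S.card = k) (hS' : S'.card = k)
    {j i : σ} (hj : j ∈ S) (hi : i ∈ S') (hiS : i ∉ S) (hjS' : j ∉ S') :
    mon k S * mon k S' = mon k (insert i (S.erase j)) * mon k (insert j (S'.erase i)) := by
  have h1 : i ∉ S.erase j := fun h => hiS (Finset.mem_of_mem_erase h)
  have h2 : j ∉ S'.erase i := fun h => hjS' (Finset.mem_of_mem_erase h)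
  rw [mon_of_card hS, mon_of_card hS', mon_of_card, mon_of_card, Finset.prod_insert h1,
    Finset.prod_insert h2, ← Finset.mul_prod_erase S _ hj, ← Finset.mul_prod_erase S' _ hi]
  · ring
  · rw [Finset.card_insert_of_notMem h2, Finset.card_erase_add_one hi, hS']
  · rw [Finset.card_insert_of_notMem h1, Finset.card_erase_add_one hj, hS]

/-- The linear span of the monomials parametrizing the toric variety of the hypersimplex. -/
noncomputable def monSpan (σ : Type*) (k : ℕ) : Submodule ℂ (MvPolynomial σ ℂ) :=
  Submodule.span ℂ (Set.range (mon k))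

theorem monSpan_pow (k n : ℕ) : monSpan σ k ^ n =
    (homogeneousSubmodule (Finset σ) ℂ n).map (aeval (mon k)).toLinearMap := by
  have h : monSpan σ k = (homogeneousSubmodule (Finset σ) ℂ 1).map (aeval (mon k)).toLinearMap := by
    rw [homogeneousSubmodule_one_eq_span_X, Submodule.map_span, ← Set.range_comp, monSpan]
    congr 2
    ext1 S
    simp
  rw [← homogeneousSubmodule_one_pow, Submodule.map_pow, h]

theorem monSpan_isHomogeneous {k n : ℕ} {p : MvPolynomial σ ℂ} (hp : p ∈ monSpan σ k ^ n) :
    p.IsHomogeneous (k * n) := by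
  rw [monSpan_pow] at hp
  obtain ⟨q, hq, rfl⟩ := hp
  exact IsHomogeneous.aeval hq _ (isHomogeneous_mon k)

variable [Fintype σ] [DecidableEq σ]

/-- The sufficient statistics of the model: the sums of the monomials divisible by a variable. -/
noncomputable def moment (k : ℕ) (i : σ) : MvPolynomial σ ℂ :=
  ∑ S ∈ (Finset.univ : Finset σ).powersetCard k with i ∈ S, mon k S

theorem moment_mem (k : ℕ) (i : σ) : moment k i ∈ monSpan σ k :=
  Submodule.sum_mem _ fun S _ => Submodule.subset_span ⟨S, rfl⟩

theorem exists_mon_pow_eq_sum {k : ℕ} (hk : 1 ≤ k) (S : Finset σ) :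
    ∃ N, ∃ q : σ → MvPolynomial (Finset σ) ℂ,
      mon k S ^ N = ∑ i, moment k i * aeval (mon k) (q i) := by
  set L : σ → MvPolynomial (Finset σ) ℂ := fun i =>
    ∑ S ∈ (Finset.univ : Finset σ).powersetCard k with i ∈ S, X S with hL
  have hmem : (X S : MvPolynomial (Finset σ) ℂ) ∈
      (RingHom.ker (aeval (mon k) : MvPolynomial (Finset σ) ℂ →ₐ[ℂ] MvPolynomial σ ℂ) ⊔
        Ideal.span (Set.range L)).radical := by
    rw [← vanishingIdeal_zeroLocus_eq_radical (K := ℂ), mem_vanishingIdeal_iff]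
    intro p hp
    rw [mem_zeroLocus_iff] at hp
    have hker : ∀ q : MvPolynomial (Finset σ) ℂ,
        aeval (mon k) q = (0 : MvPolynomial σ ℂ) → aeval p q = 0 := fun q hq =>
      hp q (Ideal.mem_sup_left hq)
    rw [aeval_X]
    by_cases hS : S.card = k
    · refine IsExchange.eq_zero hk (p := p) ?_ ?_ S hS
      · intro S S' hS hS' j hj i hi hiS hjS'
        have := hker (X S * X S' - X (insert i (S.erase j)) * X (insert j (S'.erase i)))
          (by simp [isExchange_mon k hS hS' hj hi hiS hjS'])
        simpa [sub_eq_zero] using this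
      · intro i
        simpa [hL] using hp (L i) (Ideal.mem_sup_right (Ideal.subset_span ⟨i, rfl⟩))
    · simpa using hker (X S) (by simp [mon_of_card_ne hS])
  obtain ⟨N, hN⟩ := hmem
  obtain ⟨a, ha, b, hb, hab⟩ := Submodule.mem_sup.1 hN
  obtain ⟨q, rfl⟩ := (Ideal.mem_span_range_iff_exists_fun).1 hb
  refine ⟨N, q, ?_⟩
  have := congrArg (aeval (mon k)) hab
  rw [map_add, (RingHom.mem_ker).1 ha, zero_add, map_sum, map_pow, aeval_X] at this
  rw [← this]
  refine Finset.sum_congr rfl fun i _ => ?_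
  rw [map_mul, mul_comm]
  simp [hL, moment]

theorem exists_mon_pow_mem {k : ℕ} (hk : 1 ≤ k) (S : Finset σ) :
    ∃ N, mon k S ^ (N + 1) ∈ Submodule.span ℂ (Set.range (moment (σ := σ) k)) * monSpan σ k ^ N := by
  obtain ⟨N, q, hq⟩ := exists_mon_pow_eq_sum hk S
  replace hq : mon k S ^ (N + 1) = ∑ i, moment k i * aeval (mon k) (q i * X S) := by
    rw [pow_succ, hq, Finset.sum_mul]
    exact Finset.sum_congr rfl fun i _ => by rw [map_mul, aeval_X, mul_assoc]
  refine ⟨N, ?_⟩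
  have hhom : (mon k S ^ (N + 1)).IsHomogeneous (k * (N + 1)) := (isHomogeneous_mon k S).pow _
  rw [← homogeneousComponent_eq_self hhom, hq, map_sum]
  refine Submodule.sum_mem _ fun i _ => ?_
  rw [← sum_homogeneousComponent (q i * X S), map_sum, Finset.mul_sum, map_sum]
  refine Submodule.sum_mem _ fun n _ => ?_
  have hmem : aeval (mon k) (homogeneousComponent n (q i * X S)) ∈ monSpan σ k ^ n := by
    rw [monSpan_pow]
    exact ⟨_, homogeneousComponent_mem _ _, rfl⟩
  have hprod : (moment k i * aeval (mon k) (homogeneousComponent n (q i * X S))) ∈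
      homogeneousSubmodule σ ℂ (k * (n + 1)) := by
    have h1 := monSpan_isHomogeneous (n := 1) (by rw [pow_one]; exact moment_mem k i)
    have := h1.mul (monSpan_isHomogeneous hmem)
    rwa [← mul_add, add_comm] at this
  rw [homogeneousComponent_of_mem hprod]
  split_ifs with h
  · obtain rfl : N = n := by
      have := Nat.eq_of_mul_eq_mul_left hk h
      omega
    exact Submodule.mul_mem_mul (Submodule.subset_span ⟨i, rfl⟩) hmem
  · exact zero_mem _

theorem exists_monSpan_pow_succ_le {k : ℕ} (hk : 1 ≤ k) :
    ∃ M, ∀ m, M ≤ m → monSpan σ k ^ (m + 1) ≤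
      Submodule.span ℂ (Set.range (moment (σ := σ) k)) * monSpan σ k ^ m := by
  choose N hN using exists_mon_pow_mem (σ := σ) hk
  refine ⟨∑ S, (N S + 1), fun m hm => ?_⟩
  conv_lhs => rw [monSpan_pow]
  rw [Submodule.map_le_iff_le_comap]
  intro q hq
  rw [← q.support_sum_monomial_coeff]
  refine Submodule.sum_mem _ fun e he => ?_
  rw [Submodule.mem_comap, AlgHom.toLinearMap_apply, aeval_monomial, ← Algebra.smul_def]
  refine Submodule.smul_mem _ _ ?_
  have hdeg : ∑ S, e S = m + 1 := by
    rw [← Finsupp.degree_eq_sum]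
    by_contra h
    exact (mem_support_iff.1 he) (IsHomogeneous.coeff_eq_zero hq h)
  obtain ⟨S, -, hS⟩ := Finset.exists_lt_of_sum_lt (s := Finset.univ) (f := fun S => N S)
    (g := e) (by
      rw [hdeg]
      rw [Finset.sum_add_distrib] at hm
      omega)
  rw [Finsupp.prod_fintype _ _ (fun _ => pow_zero _), ← Finset.mul_prod_erase _ _ (Finset.mem_univ S),
    ← Nat.add_sub_of_le (show N S + 1 ≤ e S from hS), pow_add, mul_assoc]
  have h2 : mon k S ^ (e S - (N S + 1)) * ∏ S' ∈ Finset.univ.erase S, mon k S' ^ e S' ∈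
      monSpan σ k ^ (m - N S) := by
    have hg : ∀ S : Finset σ, mon k S ∈ monSpan σ k := fun S => Submodule.subset_span ⟨S, rfl⟩
    have := Submodule.mul_mem_mul (Submodule.pow_mem_pow _ (hg S) (e S - (N S + 1)))
      (Submodule.prod_pow_mem_pow hg (Finset.univ.erase S) e)
    rw [← pow_add] at this
    convert this using 2
    rw [← Finset.add_sum_erase _ _ (Finset.mem_univ S)] at hdeg
    omega
  have h3 := Submodule.mul_mem_mul (hN S) h2
  rw [mul_assoc, ← pow_add] at h3
  have h4 : N S + (m - N S) = m := by
    have : e S ≤ m + 1 := hdeg ▸ Finset.single_le_sum (f := e) (fun _ _ => Nat.zero_le _)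
      (Finset.mem_univ S)
    omega
  rwa [h4] at h3

end Hypersimplex

namespace Hypersimplex

open MvPolynomial

variable {σ : Type*} [Fintype σ] [DecidableEq σ]

theorem isAlgebraic_mon {k : ℕ} (hk : 1 ≤ k) (S : Finset σ) :
    IsAlgebraic (Algebra.adjoin ℂ (Set.range (moment (σ := σ) k))) (mon k S) := by
  by_cases hS : S.card = k
  swap
  · rw [mon_of_card_ne hS]
    exact isAlgebraic_zero
  obtain ⟨M, hM⟩ := exists_monSpan_pow_succ_le (σ := σ) hk
  obtain ⟨s, hs⟩ : (monSpan σ k ^ M).FG :=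
    Submodule.FG.pow (Submodule.fg_span (Set.finite_range _)) M
  have hle : ∀ x ∈ monSpan σ k ^ M,
      x ∈ Submodule.span (Algebra.adjoin ℂ (Set.range (moment (σ := σ) k)))
        (s : Set (MvPolynomial σ ℂ)) := by
    intro x hx
    rw [← hs] at hx
    exact Submodule.span_le_restrictScalars ℂ _ _ hx
  have hmem : mon k S ∈ monSpan σ k := Submodule.subset_span ⟨S, rfl⟩
  refine (isIntegral_of_smul_mem_submodule (A := MvPolynomial σ ℂ) (M := MvPolynomial σ ℂ)
    (Submodule.span _ (s : Set (MvPolynomial σ ℂ))) ?_ ⟨s, rfl⟩ (mon k S) ?_).isAlgebraic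
  · rw [Submodule.ne_bot_iff]
    refine ⟨mon k S ^ M, hle _ (Submodule.pow_mem_pow _ hmem M), pow_ne_zero _ ?_⟩
    rw [mon_of_card hS, Finset.prod_ne_zero_iff]
    exact fun i _ => X_ne_zero i
  · intro x hx
    induction hx using Submodule.span_induction with
    | zero => simp
    | add x y _ _ hx hy => rw [smul_add]; exact add_mem hx hy
    | smul a x _ hx => rw [smul_comm]; exact Submodule.smul_mem _ _ hx
    | mem x hx =>
      have hx' : x ∈ monSpan σ k ^ M := hs ▸ Submodule.subset_span hx
      have h1 := hM M le_rfl (pow_succ' (monSpan σ k) M ▸ Submodule.mul_mem_mul hmem hx')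
      rw [smul_eq_mul]
      generalize mon k S * x = z at h1
      induction h1 using Submodule.mul_induction_on' with
      | add y _ z _ hy hz => exact add_mem hy hz
      | mem_mul_mem y hy z hz =>
        have hy' : y ∈ Algebra.adjoin ℂ (Set.range (moment (σ := σ) k)) :=
          Algebra.span_le_adjoin ℂ _ hy
        exact Submodule.smul_mem _ (⟨y, hy'⟩ : Algebra.adjoin ℂ _) (hle z hz)

theorem isAlgebraic_X {k : ℕ} (hk : 1 ≤ k) (hkd : k < Fintype.card σ) (i : σ) :
    IsAlgebraic (Algebra.adjoin ℂ (Set.range (moment (σ := σ) k))) (X i : MvPolynomial σ ℂ) := by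
  obtain ⟨S, hiS, -, hS⟩ := Finset.exists_subsuperset_card_eq (s := {i}) (t := Finset.univ)
    (Finset.subset_univ _) (by simpa using hk) (by simpa using hkd.le)
  rw [Finset.singleton_subset_iff] at hiS
  obtain ⟨l, -, hl⟩ := Finset.exists_mem_notMem_of_card_lt_card
    (s := S) (t := Finset.univ) (by rw [hS]; simpa using hkd)
  have hmon : ∀ S : Finset σ, S.card = k → mon k S ≠ (0 : MvPolynomial σ ℂ) := fun S hS => by
    rw [mon_of_card hS, Finset.prod_ne_zero_iff]
    exact fun i _ => X_ne_zero i
  have key : ∀ j ∈ S, ∃ c d : MvPolynomial σ ℂ, c ≠ 0 ∧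
      IsAlgebraic (Algebra.adjoin ℂ (Set.range (moment (σ := σ) k))) c ∧
      IsAlgebraic (Algebra.adjoin ℂ (Set.range (moment (σ := σ) k))) d ∧ X i * c = X j * d := by
    intro j hj
    by_cases hij : j = i
    · exact ⟨1, 1, one_ne_zero, isAlgebraic_one, isAlgebraic_one, by rw [hij]⟩
    have hli : l ≠ i := fun h => hl (h ▸ hiS)
    have hlj : l ≠ j := fun h => hl (h ▸ hj)
    have h1 : l ∉ (S.erase i).erase j := by simp [hl]
    have h2 : i ∉ insert l ((S.erase i).erase j) := by simp [Ne.symm hli]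
    have h3 : j ∉ insert l ((S.erase i).erase j) := by simp [Ne.symm hlj]
    have hc : (insert l ((S.erase i).erase j)).card + 1 = k := by
      rw [Finset.card_insert_of_notMem h1,
        Finset.card_erase_add_one (Finset.mem_erase.2 ⟨hij, hj⟩), Finset.card_erase_add_one hiS, hS]
    have hci : (insert i (insert l ((S.erase i).erase j))).card = k := by
      rw [Finset.card_insert_of_notMem h2, hc]
    have hcj : (insert j (insert l ((S.erase i).erase j))).card = k := by
      rw [Finset.card_insert_of_notMem h3, hc]
    refine ⟨_, _, hmon _ hcj, isAlgebraic_mon hk _,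
      isAlgebraic_mon hk (insert i (insert l ((S.erase i).erase j))), ?_⟩
    rw [mon_of_card hci, mon_of_card hcj, Finset.prod_insert h2, Finset.prod_insert h3]
    ring
  choose! c d hc hca hda hcd using key
  have hprod : (∏ j ∈ S, c j) * X i ^ k = mon k S * ∏ j ∈ S, d j := by
    rw [mon_of_card hS, ← Finset.prod_mul_distrib, ← hS, ← Finset.prod_const, ← Finset.prod_mul_distrib]
    exact Finset.prod_congr rfl fun j hj => by rw [← hcd j hj, mul_comm]
  have hp : ∀ f : σ → MvPolynomial σ ℂ,
      (∀ j ∈ S, IsAlgebraic (Algebra.adjoin ℂ (Set.range (moment (σ := σ) k))) (f j)) →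
      IsAlgebraic (Algebra.adjoin ℂ (Set.range (moment (σ := σ) k))) (∏ j ∈ S, f j) := fun f hf =>
    Subalgebra.prod_mem (Subalgebra.algebraicClosure _ _) hf
  refine IsAlgebraic.of_pow hk (IsAlgebraic.of_mul (y := ∏ j ∈ S, c j) ?_ (hp c hca) ?_)
  · exact mem_nonZeroDivisors_of_ne_zero (Finset.prod_ne_zero_iff.2 hc)
  · rw [hprod]
    exact (isAlgebraic_mon hk S).mul (hp d hda)

theorem algebraicIndependent_moment {k : ℕ} (hk : 1 ≤ k) (hkd : k < Fintype.card σ) :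
    AlgebraicIndependent ℂ (moment (σ := σ) k) := by
  have : Algebra.IsAlgebraic (Algebra.adjoin ℂ (Set.range (moment (σ := σ) k)))
      (MvPolynomial σ ℂ) := by
    refine ⟨fun p => ?_⟩
    induction p using MvPolynomial.induction_on with
    | C a =>
      exact isAlgebraic_algebraMap
        (algebraMap ℂ (Algebra.adjoin ℂ (Set.range (moment (σ := σ) k))) a)
    | add p q hp hq => exact hp.add hq
    | mul_X p i hp => exact hp.mul (isAlgebraic_X hk hkd i)
  exact (Algebra.IsAlgebraic.isTranscendenceBasis_of_le_trdeg_of_finite ℂ _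
    (by rw [MvPolynomial.trdeg_of_isDomain, Cardinal.lift_uzero])).1

end Hypersimplex

namespace Hypersimplex

open MvPolynomial
open scoped Pointwise

variable {σ : Type*} [Fintype σ] [DecidableEq σ]

/-- The lattice points of the `m`-th dilate of the hypersimplex. -/
def latticePoints (σ : Type*) [Fintype σ] [DecidableEq σ] (k m : ℕ) : Finset (σ →₀ ℕ) :=
  {α ∈ Finset.finsuppAntidiag Finset.univ (k * m) | ∀ i, α i ≤ m}

theorem mem_latticePoints {k m : ℕ} {α : σ →₀ ℕ} :
    α ∈ latticePoints σ k m ↔ ∑ i, α i = k * m ∧ ∀ i, α i ≤ m := by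
  simp [latticePoints]

theorem mem_latticePoints_one {k : ℕ} {α : σ →₀ ℕ} :
    α ∈ latticePoints σ k 1 ↔ ∃ S : Finset σ, S.card = k ∧ Finsupp.indicator S (fun _ _ => 1) = α := by
  rw [mem_latticePoints, mul_one]
  constructor
  · rintro ⟨h1, h2⟩
    have h3 : Finsupp.indicator α.support (fun _ _ => 1) = α := by
      ext i
      rw [Finsupp.indicator_apply]
      have := h2 i
      split_ifs with h
      · have := Finsupp.mem_support_iff.1 h
        omega
      · exact (Finsupp.notMem_support_iff.1 h).symm
    refine ⟨α.support, ?_, h3⟩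
    calc α.support.card = ∑ i, Finsupp.indicator α.support (fun _ _ => 1) i := by
          simp [Finsupp.indicator_apply, -Finsupp.mem_support_iff]
      _ = k := by rw [h3, h1]
  · rintro ⟨S, rfl, rfl⟩
    refine ⟨by simp [Finsupp.indicator_apply], fun i => ?_⟩
    rw [Finsupp.indicator_apply]
    split_ifs <;> simp

/-- Lattice points of dilates of the hypersimplex are sums of vertices. -/
theorem exists_add_of_mem_latticePoints {k m : ℕ} {α : σ →₀ ℕ}
    (hα : α ∈ latticePoints σ k (m + 1)) :
    ∃ β ∈ latticePoints σ k m, ∃ γ ∈ latticePoints σ k 1, β + γ = α := by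
  rw [mem_latticePoints] at hα
  obtain ⟨h1, h2⟩ := hα
  set D : Finset σ := {i | α i = m + 1} with hD
  have hDα : D ⊆ α.support := by
    intro i hi
    rw [hD, Finset.mem_filter] at hi
    rw [Finsupp.mem_support_iff]
    omega
  have hDk : D.card ≤ k := by
    have : D.card * (m + 1) ≤ k * (m + 1) := by
      rw [← h1]
      refine le_trans ?_ (Finset.sum_le_univ_sum_of_nonneg (s := D) fun _ => Nat.zero_le _)
      rw [Finset.sum_congr rfl (g := fun _ => m + 1) fun i hi => (Finset.mem_filter.1 hi).2,
        Finset.sum_const, smul_eq_mul]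
    exact Nat.le_of_mul_le_mul_right this (Nat.succ_pos m)
  have hkα : k ≤ α.support.card := by
    have : k * (m + 1) ≤ α.support.card * (m + 1) := by
      rw [← h1, ← Finset.sum_subset (Finset.subset_univ α.support)
        fun i _ hi => Finsupp.notMem_support_iff.1 hi]
      exact Finset.sum_le_card_nsmul _ _ _ fun i _ => h2 i
    exact Nat.le_of_mul_le_mul_right this (Nat.succ_pos m)
  obtain ⟨S, hDS, hSα, hS⟩ := Finset.exists_subsuperset_card_eq hDα hDk hkα
  have hle : Finsupp.indicator S (fun _ _ => 1) ≤ α := by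
    intro i
    rw [Finsupp.indicator_apply]
    split_ifs with h
    · have := Finsupp.mem_support_iff.1 (hSα h)
      omega
    · exact Nat.zero_le _
  have hγ : Finsupp.indicator S (fun _ _ => 1) ∈ latticePoints σ k 1 :=
    mem_latticePoints_one.2 ⟨S, hS, rfl⟩
  have hadd := tsub_add_cancel_of_le hle
  refine ⟨_, mem_latticePoints.2 ⟨?_, fun i => ?_⟩, _, hγ, hadd⟩
  · have h3 := (mem_latticePoints.1 hγ).1
    rw [← hadd] at h1
    simp only [Finsupp.add_apply, Finset.sum_add_distrib] at h1
    rw [h3, mul_one, mul_add, mul_one] at h1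
    omega
  · rw [Finsupp.tsub_apply, Finsupp.indicator_apply]
    have := h2 i
    split_ifs with h
    · omega
    · have : α i ≠ m + 1 := fun h' => h (hDS (by simp [hD, h']))
      omega

theorem nsmul_insert_latticePoints (k n : ℕ) :
    n • (insert 0 (latticePoints σ k 1) : Set (σ →₀ ℕ)) =
      ((Finset.range (n + 1)).biUnion (latticePoints σ k) : Finset (σ →₀ ℕ)) := by
  have h0 : (0 : σ →₀ ℕ) ∈ latticePoints σ k 0 := mem_latticePoints.2 (by simp)
  induction n with
  | zero =>
    ext α
    simp only [zero_nsmul, Set.mem_zero, zero_add, Finset.range_one, Finset.singleton_biUnion,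
      Finset.mem_coe]
    refine ⟨fun h => h ▸ h0, fun h => ?_⟩
    ext i
    simpa using (mem_latticePoints.1 h).2 i
  | succ n ih =>
    rw [succ_nsmul, ih]
    ext α
    simp only [Set.mem_add, Finset.coe_biUnion, Set.mem_iUnion, Finset.mem_coe, Finset.mem_range,
      Set.mem_insert_iff, exists_prop]
    constructor
    · rintro ⟨β, ⟨m, hm, hβ⟩, γ, rfl | hγ, rfl⟩
      · exact ⟨m, by omega, by rwa [add_zero]⟩
      · refine ⟨m + 1, by omega, ?_⟩
        rw [mem_latticePoints] at *
        refine ⟨?_, fun i => add_le_add (hβ.2 i) (hγ.2 i)⟩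
        simp only [Finsupp.add_apply, Finset.sum_add_distrib]
        rw [hβ.1, hγ.1]
        ring
    · rintro ⟨m, hm, hα⟩
      cases m with
      | zero => exact ⟨α, ⟨0, by omega, hα⟩, 0, Or.inl rfl, add_zero _⟩
      | succ m =>
        obtain ⟨β, hβ, γ, hγ, rfl⟩ := exists_add_of_mem_latticePoints hα
        exact ⟨β, ⟨m, by omega, hβ⟩, γ, Or.inr hγ, rfl⟩

theorem one_sup_monSpan (k : ℕ) :
    1 ⊔ monSpan σ k = restrictSupport ℂ (insert 0 (latticePoints σ k 1) : Set (σ →₀ ℕ)) := by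
  have hmon : ∀ S : Finset σ, S.card = k →
      mon k S = monomial (Finsupp.indicator S (fun _ _ => 1)) (1 : ℂ) := by
    intro S hS
    rw [mon_of_card hS, monomial_eq, C_1, one_mul, Finsupp.prod_fintype _ _ (fun _ => pow_zero _)]
    simp [Finsupp.indicator_apply, Finset.prod_ite_mem]
  rw [restrictSupport_eq_span, Set.image_insert_eq, Submodule.span_insert]
  congr 1
  · rw [Submodule.one_eq_span]
    rfl
  · refine le_antisymm (Submodule.span_le.2 ?_) (Submodule.span_mono ?_)
    · rintro _ ⟨S, rfl⟩
      by_cases hS : S.card = k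
      · exact Submodule.subset_span ⟨_, mem_latticePoints_one.2 ⟨S, hS, rfl⟩, (hmon S hS).symm⟩
      · rw [mon_of_card_ne hS]
        exact zero_mem _
    · rintro _ ⟨α, hα, rfl⟩
      obtain ⟨S, hS, rfl⟩ := mem_latticePoints_one.1 hα
      exact ⟨S, hmon S hS⟩

theorem finrank_one_sup_monSpan_pow {k : ℕ} (hk : 1 ≤ k) (n : ℕ) :
    Module.finrank ℂ ↥((1 ⊔ monSpan σ k) ^ n) =
      ∑ m ∈ Finset.range (n + 1), (latticePoints σ k m).card := by
  rw [one_sup_monSpan, ← restrictSupport_nsmul, finrank_restrictSupport,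
    nsmul_insert_latticePoints, Set.ncard_coe_finset, Finset.card_biUnion]
  intro m _ m' _ hmm'
  rw [Function.onFun, Finset.disjoint_left]
  intro α hα hα'
  rw [mem_latticePoints] at hα hα'
  exact hmm' (Nat.eq_of_mul_eq_mul_left hk (hα.1.symm.trans hα'.1))

end Hypersimplex

namespace Hypersimplex

open PowerSeries in
theorem card_latticePoints {σ : Type*} [Fintype σ] [DecidableEq σ] {n : ℕ}
    (hn : Fintype.card σ = n + 1) (k m : ℕ) :
    ((latticePoints σ k m).card : ℝ) = ∑ j ∈ Finset.range (n + 2), (-1) ^ j * ((n + 1).choose j : ℝ) *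
      if (m + 1) * j ≤ k * m then ((n + (k * m - (m + 1) * j)).choose n : ℝ) else 0 := by
  set f : ℝ⟦X⟧ := mk fun l => if l ≤ m then 1 else 0 with hf
  have h1 : ((latticePoints σ k m).card : ℝ) = coeff (k * m) (f ^ (n + 1)) := by
    rw [← hn, ← Finset.card_univ, ← Finset.prod_const, coeff_prod, latticePoints,
      Finset.card_filter, Nat.cast_sum]
    refine Finset.sum_congr rfl fun α _ => ?_
    simp only [hf, coeff_mk, Finset.prod_ite_zero, Finset.prod_const_one, Finset.mem_univ,
      true_implies]
    split_ifs <;> simp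
  have h2 : f = (1 - X ^ (m + 1)) * mk 1 := by
    ext l
    rw [hf, coeff_mk, sub_mul, one_mul, map_sub, coeff_X_pow_mul', coeff_mk]
    simp only [Pi.one_apply, coeff_mk]
    split_ifs <;> first | omega | simp
  rw [h1, h2, mul_pow, mk_one_pow_eq_mk_choose_add, sub_eq_add_neg, add_comm, add_pow,
    Finset.sum_mul, map_sum]
  refine Finset.sum_congr rfl fun j _ => ?_
  rw [one_pow, mul_one, neg_pow, ← pow_mul]
  have h3 : ((-1 : ℝ⟦X⟧) ^ j * X ^ ((m + 1) * j) * ((n + 1).choose j : ℝ⟦X⟧)) *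
      mk (fun l => ((n + l).choose n : ℝ)) = C ((-1) ^ j * ((n + 1).choose j : ℝ)) *
        (X ^ ((m + 1) * j) * mk (fun l => ((n + l).choose n : ℝ))) := by
    simp only [map_mul, map_pow, map_neg, map_one, map_natCast]
    ring
  rw [h3, coeff_C_mul, coeff_X_pow_mul', coeff_mk]

open Filter Topology Asymptotics

theorem tendsto_choose_div_pow {a : ℕ → ℕ} {c : ℝ} (hc : 0 < c)
    (ha : Tendsto (fun m => (a m : ℝ) / m) atTop (𝓝 c)) (n : ℕ) :
    Tendsto (fun m => ((a m).choose n : ℝ) / (m : ℝ) ^ n) atTop (𝓝 (c ^ n / n.factorial)) := by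
  have hat : Tendsto a atTop atTop := by
    rw [← tendsto_natCast_atTop_iff (R := ℝ)]
    refine (ha.pos_mul_atTop hc tendsto_natCast_atTop_atTop).congr' ?_
    filter_upwards [eventually_gt_atTop 0] with m hm
    have : (m : ℝ) ≠ 0 := by positivity
    field_simp
  have h1 := ((isEquivalent_choose n).comp_tendsto hat).div
    (IsEquivalent.refl (u := fun m : ℕ => (m : ℝ) ^ n))
  refine h1.symm.tendsto_nhds ?_
  refine ((ha.pow n).div_const (n.factorial : ℝ)).congr fun m => ?_
  simp only [Function.comp, Pi.div_apply, div_pow]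
  ring

/-- The Eulerian number counting the normalized volume of the hypersimplex. -/
def eulerian (n k : ℕ) : ℤ :=
  ∑ j ∈ Finset.range k, (-1) ^ j * ((n + 1).choose j : ℤ) * ((k : ℤ) - j) ^ n

theorem tendsto_card_latticePoints {σ : Type*} [Fintype σ] [DecidableEq σ] {n k : ℕ}
    (hn : Fintype.card σ = n + 1) (hk : 1 ≤ k) (hkn : k ≤ n) :
    Tendsto (fun m => ((latticePoints σ k m).card : ℝ) / (m : ℝ) ^ n) atTop
      (𝓝 (eulerian n k / n.factorial)) := by
  have hterm : ∀ j ∈ Finset.range (n + 2), Tendsto (fun m : ℕ =>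
      ((-1) ^ j * ((n + 1).choose j : ℝ) *
        if (m + 1) * j ≤ k * m then ((n + (k * m - (m + 1) * j)).choose n : ℝ) else 0) /
        (m : ℝ) ^ n) atTop
      (𝓝 ((-1) ^ j * ((n + 1).choose j : ℝ) *
        if j < k then ((k : ℝ) - j) ^ n / n.factorial else 0)) := by
    intro j _
    simp only [mul_div_assoc]
    refine Tendsto.const_mul _ ?_
    split_ifs with hj
    · have hc : (0 : ℝ) < k - j := by
        rw [sub_pos]
        exact_mod_cast hj
      refine (tendsto_choose_div_pow hc (a := fun m => n + (k * m - (m + 1) * j)) ?_ n).congr' ?_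
      · have h1 : Tendsto (fun m : ℕ => ((n : ℝ) - j) / m + (k - j)) atTop (𝓝 (0 + (k - j))) :=
          (tendsto_const_div_atTop_nhds_zero_nat _).add_const _
        rw [zero_add] at h1
        refine h1.congr' ?_
        filter_upwards [eventually_ge_atTop (k + 1)] with m hm
        have h2 : (m + 1) * j ≤ k * m := by nlinarith
        have h3 : (m : ℝ) ≠ 0 := by
          have : m ≠ 0 := by omega
          exact_mod_cast this
        rw [Nat.cast_add, Nat.cast_sub h2]
        push_cast
        field_simp
        ring
      · filter_upwards [eventually_ge_atTop k] with m hm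
        have h2 : (m + 1) * j ≤ k * m := by nlinarith
        rw [if_pos h2]
    · refine tendsto_const_nhds.congr' ?_
      filter_upwards [eventually_gt_atTop 0] with m hm
      rw [if_neg (by nlinarith), zero_div]
  have hlim : ∑ j ∈ Finset.range (n + 2), (-1) ^ j * ((n + 1).choose j : ℝ) *
      (if j < k then ((k : ℝ) - j) ^ n / n.factorial else 0) = eulerian n k / n.factorial := by
    rw [eulerian, ← Finset.sum_subset (Finset.range_subset_range.2 (show k ≤ n + 2 by omega))]
    · push_cast
      rw [Finset.sum_div]
      refine Finset.sum_congr rfl fun j hj => ?_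
      rw [if_pos (Finset.mem_range.1 hj)]
      ring
    · intro j _ hj
      rw [if_neg (by simpa using hj), mul_zero]
  rw [← hlim]
  refine (tendsto_finsetSum _ hterm).congr fun m => ?_
  rw [card_latticePoints hn, Finset.sum_div]

theorem tendsto_add_div_self (b : ℕ) :
    Tendsto (fun m : ℕ => ((m + b : ℕ) : ℝ) / m) atTop (𝓝 1) := by
  have h : Tendsto (fun m : ℕ => (b : ℝ) / m + 1) atTop (𝓝 (0 + 1)) :=
    (tendsto_const_div_atTop_nhds_zero_nat _).add_const _
  rw [zero_add] at h
  refine h.congr' ?_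
  filter_upwards [eventually_gt_atTop 0] with m hm
  have h3 : (m : ℝ) ≠ 0 := by positivity
  push_cast
  field_simp
  ring

theorem tendsto_choose_div_choose (b c n : ℕ) :
    Tendsto (fun m : ℕ => ((m + b).choose n : ℝ) / ((m + c).choose n : ℝ)) atTop (𝓝 1) := by
  have h := (tendsto_choose_div_pow one_pos (tendsto_add_div_self b) n).div
    (tendsto_choose_div_pow one_pos (tendsto_add_div_self c) n) (by positivity)
  rw [div_self (by positivity)] at h
  refine h.congr' ?_
  filter_upwards [eventually_gt_atTop 0] with m hm
  have h3 : (m : ℝ) ≠ 0 := by positivity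
  simp only [Pi.div_apply]
  field_simp

theorem tendsto_sum_card_latticePoints {σ : Type*} [Fintype σ] [DecidableEq σ] {n k : ℕ}
    (hn : Fintype.card σ = n + 1) (hk : 1 ≤ k) (hkn : k ≤ n) :
    Tendsto (fun N => (∑ m ∈ Finset.range (N + 1), ((latticePoints σ k m).card : ℝ)) /
      ((N + (n + 1)).choose (n + 1) : ℝ)) atTop (𝓝 (eulerian n k)) := by
  have hpos : ∀ m : ℕ, (0 : ℝ) < ((m + n).choose n : ℝ) := fun m => by
    exact_mod_cast Nat.choose_pos (Nat.le_add_left n m)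
  have hratio : Tendsto (fun m => ((latticePoints σ k m).card : ℝ) / ((m + n).choose n : ℝ)) atTop
      (𝓝 (eulerian n k)) := by
    have h := (tendsto_card_latticePoints (σ := σ) hn hk hkn).div
      (tendsto_choose_div_pow one_pos (tendsto_add_div_self n) n) (by positivity)
    have e : (eulerian n k / n.factorial : ℝ) / (1 ^ n / n.factorial) = eulerian n k := by
      have : (n.factorial : ℝ) ≠ 0 := by positivity
      field_simp
      ring
    rw [e] at h
    refine h.congr' ?_
    filter_upwards [eventually_gt_atTop 0] with m hm
    have h3 : (m : ℝ) ≠ 0 := by positivity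
    simp only [Pi.div_apply]
    field_simp
  have hlittle : (fun m => ((latticePoints σ k m).card : ℝ) - eulerian n k * ((m + n).choose n : ℝ))
      =o[atTop] fun m => ((m + n).choose n : ℝ) := by
    rw [isLittleO_iff_tendsto fun m h => absurd h (hpos m).ne']
    have := hratio.sub_const (eulerian n k : ℝ)
    rw [sub_self] at this
    refine this.congr fun m => ?_
    have := (hpos m).ne'
    field_simp
  have hsum : ∀ N, ∑ m ∈ Finset.range (N + 1), ((m + n).choose n : ℝ) =
      ((N + (n + 1)).choose (n + 1) : ℝ) := fun N => by
    rw [← add_assoc]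
    exact_mod_cast Nat.sum_range_add_choose N n
  have hdiv : Tendsto (fun N => ∑ m ∈ Finset.range N, ((m + n).choose n : ℝ)) atTop atTop := by
    refine tendsto_atTop_mono (fun N => ?_) tendsto_natCast_atTop_atTop
    have : ∑ m ∈ Finset.range N, (1 : ℝ) ≤ ∑ m ∈ Finset.range N, ((m + n).choose n : ℝ) :=
      Finset.sum_le_sum fun m _ => by exact_mod_cast Nat.choose_pos (Nat.le_add_left n m)
    simpa using this
  have h := (hlittle.sum_range (fun m => (hpos m).le) hdiv).comp_tendsto (tendsto_add_atTop_nat 1)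
  have h2 := h.tendsto_div_nhds_zero.add_const (eulerian n k : ℝ)
  rw [zero_add] at h2
  refine h2.congr fun N => ?_
  simp only [Function.comp]
  rw [Finset.sum_sub_distrib, ← Finset.mul_sum, hsum]
  have : ((N + (n + 1)).choose (n + 1) : ℝ) ≠ 0 := by
    exact_mod_cast (Nat.choose_pos (Nat.le_add_left _ N)).ne'
  field_simp
  ring

/-- A growth rate squeezed between shifted binomial coefficients is the Eulerian number. -/
theorem eq_eulerian_of_growth {σ : Type*} [Fintype σ] [DecidableEq σ] {n k r : ℕ}
    (hn : Fintype.card σ = n + 1) (hk : 1 ≤ k) (hkn : k ≤ n)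
    (hlow : ∃ E, ∀ N, r * (N + (n + 1)).choose (n + 1) ≤
      ∑ m ∈ Finset.range (N + E + 1), (latticePoints σ k m).card)
    (hup : ∃ E, ∀ N, ∑ m ∈ Finset.range (N + 1), (latticePoints σ k m).card ≤
      r * (N + E + (n + 1)).choose (n + 1)) : (r : ℤ) = eulerian n k := by
  obtain ⟨E, hE⟩ := hlow
  obtain ⟨F, hF⟩ := hup
  have hT := tendsto_sum_card_latticePoints (σ := σ) hn hk hkn
  have hpos : ∀ N : ℕ, (0 : ℝ) < ((N + (n + 1)).choose (n + 1) : ℝ) := fun N => by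
    exact_mod_cast Nat.choose_pos (Nat.le_add_left _ N)
  have h1 : (r : ℝ) ≤ eulerian n k := by
    have h := (hT.comp (tendsto_add_atTop_nat E)).mul
      (tendsto_choose_div_choose (E + (n + 1)) (n + 1) (n + 1))
    rw [mul_one] at h
    refine ge_of_tendsto' h fun N => ?_
    simp only [Function.comp]
    rw [← add_assoc N E (n + 1), div_mul_div_cancel₀ (hpos _).ne', le_div_iff₀ (hpos N)]
    exact_mod_cast hE N
  have h2 : (eulerian n k : ℝ) ≤ r := by
    have h := (tendsto_choose_div_choose (F + (n + 1)) (n + 1) (n + 1)).const_mul (r : ℝ)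
    rw [mul_one] at h
    refine le_of_tendsto_of_tendsto' hT h fun N => ?_
    rw [← mul_div_assoc, div_le_div_iff_of_pos_right (hpos N), ← add_assoc N F (n + 1)]
    exact_mod_cast hF N
  exact_mod_cast le_antisymm h1 h2

end Hypersimplex

namespace Hypersimplex

open MvPolynomial

/-- The homogeneous coordinate ring of the toric variety of the hypersimplex. -/
noncomputable abbrev toricRing (σ : Type*) (k : ℕ) : Subalgebra ℂ (MvPolynomial σ ℂ) :=
  Algebra.adjoin ℂ (Set.range (mon k))

/-- A monomial as an element of the toric ring. -/
noncomputable def toricMon {σ : Type*} (k : ℕ) (S : Finset σ) : toricRing σ k :=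
  ⟨mon k S, Algebra.subset_adjoin ⟨S, rfl⟩⟩

theorem one_sup_pow_succ_le {R : Type*} [CommRing R] [Algebra ℂ R] {V Θ : Submodule ℂ R} {m : ℕ}
    (h : V ^ (m + 1) ≤ Θ * V ^ m) : (1 ⊔ V) ^ (m + 1) ≤ (1 ⊔ Θ) * (1 ⊔ V) ^ m := by
  have h1 : ∀ m : ℕ, V * (1 ⊔ V) ^ m ≤ (1 ⊔ V) ^ m ⊔ V ^ (m + 1) := by
    intro m
    induction m with
    | zero => simp
    | succ m ih =>
      calc V * (1 ⊔ V) ^ (m + 1) = V * (1 ⊔ V) ^ m ⊔ V * (V * (1 ⊔ V) ^ m) := by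
            rw [pow_succ', Submodule.sup_mul, one_mul, Submodule.mul_sup]
        _ ≤ V * (1 ⊔ V) ^ m ⊔ V * ((1 ⊔ V) ^ m ⊔ V ^ (m + 1)) :=
            sup_le_sup_left (mul_le_mul' le_rfl ih) _
        _ = V * (1 ⊔ V) ^ m ⊔ V ^ (m + 1 + 1) := by
            rw [Submodule.mul_sup, ← sup_assoc, sup_idem, pow_succ' V (m + 1)]
        _ ≤ _ := by
            rw [pow_succ' (1 ⊔ V) m]
            exact sup_le_sup_right (mul_le_mul' le_sup_right le_rfl) _
  rw [pow_succ', Submodule.sup_mul, Submodule.sup_mul, one_mul]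
  refine sup_le le_sup_left ((h1 m).trans (sup_le_sup_left (h.trans ?_) _))
  exact mul_le_mul' le_rfl (pow_le_pow_left' le_sup_right m)

theorem exists_mem_one_sup_span_pow {R : Type*} [CommRing R] [Algebra ℂ R] {A : Set R} {s : R}
    (hs : s ∈ Algebra.adjoin ℂ A) : ∃ m, s ∈ (1 ⊔ Submodule.span ℂ A) ^ m := by
  induction hs using Algebra.adjoin_induction with
  | mem x hx =>
    exact ⟨1, by rw [pow_one]; exact Submodule.mem_sup_right (Submodule.subset_span hx)⟩
  | algebraMap c => exact ⟨0, by rw [pow_zero]; exact Submodule.mem_one.2 ⟨c, rfl⟩⟩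
  | add x y hx hy ihx ihy =>
    obtain ⟨a, ha⟩ := ihx
    obtain ⟨b, hb⟩ := ihy
    refine ⟨max a b, ?_⟩
    exact add_mem (Submodule.pow_le_pow_of_one_le le_sup_left (le_max_left a b) ha)
      (Submodule.pow_le_pow_of_one_le le_sup_left (le_max_right a b) hb)
  | mul x y hx hy ihx ihy =>
    obtain ⟨a, ha⟩ := ihx
    obtain ⟨b, hb⟩ := ihy
    exact ⟨a + b, by rw [pow_add]; exact Submodule.mul_mem_mul ha hb⟩

variable {σ : Type*} [Fintype σ] [DecidableEq σ]

/-- A moment as an element of the toric ring. -/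
noncomputable def toricMoment (k : ℕ) (i : σ) : toricRing σ k :=
  ∑ S ∈ (Finset.univ : Finset σ).powersetCard k with i ∈ S, toricMon k S

theorem coe_toricMoment (k : ℕ) (i : σ) : (toricMoment k i : MvPolynomial σ ℂ) = moment k i := by
  simp [toricMoment, moment, toricMon]

/-- For generic values of the moments, the number of points of the toric variety is the Eulerian
number, and all of these points lie in the torus. -/
theorem exists_generic_card {n k : ℕ} (hk : 1 ≤ k) (hkn : k ≤ n) :
    ∃ h : MvPolynomial (Fin (n + 1)) ℂ, h ≠ 0 ∧ ∀ b, eval b h ≠ 0 →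
      (∃ r : ℕ, {φ : toricRing (Fin (n + 1)) k →ₐ[ℂ] ℂ | ∀ i, φ (toricMoment k i) = b i}.encard = r ∧
        (r : ℤ) = eulerian n k) ∧
      ∀ φ : toricRing (Fin (n + 1)) k →ₐ[ℂ] ℂ, (∀ i, φ (toricMoment k i) = b i) →
        ∀ S, S.card = k → φ (toricMon k S) ≠ 0 := by
  set V : Submodule ℂ (toricRing (Fin (n + 1)) k) := Submodule.span ℂ (Set.range (toricMon k)) with hV
  have hinj : Function.Injective (toricRing (Fin (n + 1)) k).val.toLinearMap := Subtype.val_injective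
  have hmapV : V.map (toricRing (Fin (n + 1)) k).val.toLinearMap = monSpan (Fin (n + 1)) k := by
    rw [hV, Submodule.map_span, ← Set.range_comp]
    rfl
  have hmapW : ∀ m, ((1 ⊔ V) ^ m).map (toricRing (Fin (n + 1)) k).val.toLinearMap = (1 ⊔ monSpan (Fin (n + 1)) k) ^ m := by
    intro m
    rw [Submodule.map_pow, Submodule.map_sup, Submodule.map_one, hmapV]
  have hfin : ∀ m, Module.finrank ℂ ↥((1 ⊔ V) ^ m) =
      ∑ j ∈ Finset.range (m + 1), (latticePoints (Fin (n + 1)) k j).card := by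
    intro m
    rw [← finrank_one_sup_monSpan_pow hk, ← hmapW]
    exact (Submodule.equivMapOfInjective _ hinj _).finrank_eq
  have hθ : AlgebraicIndependent ℂ (toricMoment (σ := Fin (n + 1)) k) := by
    refine AlgebraicIndependent.of_comp (toricRing (Fin (n + 1)) k).val ?_
    convert algebraicIndependent_moment (σ := Fin (n + 1)) hk (by simpa using hkn) using 1
    ext1 i
    exact coe_toricMoment k i
  have hmem : ∀ i, toricMoment k i ∈ V := fun i =>
    sum_mem fun S _ => Submodule.subset_span ⟨S, rfl⟩
  have hgen : ∀ s : toricRing (Fin (n + 1)) k, ∃ m, s ∈ (1 ⊔ V) ^ m := by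
    intro s
    obtain ⟨m, hm⟩ := exists_mem_one_sup_span_pow s.2
    change _ ∈ (1 ⊔ monSpan (Fin (n + 1)) k) ^ m at hm
    rw [← hmapW] at hm
    obtain ⟨t, ht, hts⟩ := hm
    exact ⟨m, hinj hts ▸ ht⟩
  obtain ⟨M, hM⟩ := exists_monSpan_pow_succ_le (σ := Fin (n + 1)) hk
  have hM' : ∀ m, M ≤ m → (1 ⊔ V) ^ (m + 1) ≤
      (1 ⊔ Submodule.span ℂ (Set.range (toricMoment k))) * (1 ⊔ V) ^ m := by
    intro m hm
    refine one_sup_pow_succ_le ?_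
    rw [← Submodule.map_le_map_iff_of_injective hinj, Submodule.map_mul, Submodule.map_pow,
      Submodule.map_pow, hmapV, Submodule.map_span, ← Set.range_comp]
    refine (hM m hm).trans_eq ?_
    congr 3
    ext1 i
    exact (coe_toricMoment k i).symm
  have hs : ∏ S ∈ (Finset.univ : Finset (Fin (n + 1))).powersetCard k, toricMon k S ≠ 0 := by
    rw [Finset.prod_ne_zero_iff]
    intro S hS h0
    have h1 : mon k S = 0 := congrArg Subtype.val h0
    rw [mon_of_card (Finset.mem_powersetCard.1 hS).2, Finset.prod_eq_zero_iff] at h1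
    obtain ⟨i, -, hi⟩ := h1
    exact X_ne_zero i hi
  have hW : FiniteDimensional ℂ ↥(1 ⊔ V) := by
    refine Module.Finite.iff_fg.2 (Submodule.FG.sup ?_ (Submodule.fg_span (Set.finite_range _)))
    rw [Submodule.one_eq_span]
    exact Submodule.fg_span_singleton 1
  obtain ⟨r, ⟨h, hh, hr⟩, ⟨E, hE⟩, F, hF⟩ := exists_generic_card_and_growth hθ (W := 1 ⊔ V)
    le_sup_left (fun i => Submodule.mem_sup_right (hmem i)) hgen hM' hs
  refine ⟨h, hh, fun b hb => ⟨⟨r, (hr b hb).1, ?_⟩, fun φ hφ S hS h0 => (hr b hb).2 φ hφ ?_⟩⟩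
  · refine eq_eulerian_of_growth (σ := Fin (n + 1)) (by simp) hk hkn ⟨E, fun N => ?_⟩ ⟨F, fun N => ?_⟩
    · rw [← hfin]
      exact hE N
    · rw [← hfin]
      exact hF N
  · rw [map_prod]
    exact Finset.prod_eq_zero (Finset.mem_powersetCard.2 ⟨Finset.subset_univ S, hS⟩) h0

end Hypersimplex

namespace Hypersimplex

/-- The `0/1` vectors of length `n` with `k` or `k - 1` ones. -/
abbrev Vertex (n k : ℕ) : Type :=
  {α : Fin n → Fin 2 // (∑ i, (α i : ℕ)) = k ∨ (∑ i, (α i : ℕ)) = k - 1}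

variable {n k : ℕ}

/-- The vertex of the hypersimplex in `ℝ ^ (n + 1)` lying above a vertex of its projection. -/
def Vertex.lift (α : Vertex n k) : Fin (n + 1) → ℕ :=
  Fin.snoc (fun i => (α.1 i : ℕ)) (k - ∑ i, (α.1 i : ℕ))

@[simp]
theorem Vertex.lift_castSucc (α : Vertex n k) (i : Fin n) : α.lift i.castSucc = (α.1 i : ℕ) := by
  simp [Vertex.lift]

@[simp]
theorem Vertex.lift_last (α : Vertex n k) : α.lift (Fin.last n) = k - ∑ i, (α.1 i : ℕ) := by
  simp [Vertex.lift]

theorem Vertex.lift_le_one (α : Vertex n k) (i : Fin (n + 1)) : α.lift i ≤ 1 := by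
  induction i using Fin.lastCases with
  | last =>
    rw [Vertex.lift_last]
    have := α.2
    omega
  | cast i =>
    rw [Vertex.lift_castSucc]
    omega

theorem Vertex.sum_lift (α : Vertex n k) : ∑ i, α.lift i = k := by
  rw [Fin.sum_univ_castSucc, Vertex.lift_last]
  simp only [Vertex.lift_castSucc]
  have := α.2
  omega

/-- The support of a vertex of the hypersimplex. -/
def Vertex.toFinset (α : Vertex n k) : Finset (Fin (n + 1)) := {i | α.lift i = 1}

theorem Vertex.lift_eq_ite (α : Vertex n k) (i : Fin (n + 1)) :
    α.lift i = if i ∈ α.toFinset then 1 else 0 := by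
  have := α.lift_le_one i
  simp only [Vertex.toFinset, Finset.mem_filter_univ]
  split_ifs <;> omega

theorem Vertex.card_toFinset (α : Vertex n k) : α.toFinset.card = k := by
  refine Eq.trans ?_ α.sum_lift
  simp [Vertex.lift_eq_ite]

theorem Vertex.toFinset_injective : Function.Injective (Vertex.toFinset (n := n) (k := k)) := by
  intro α β h
  ext i
  rw [← Vertex.lift_castSucc, ← Vertex.lift_castSucc, Vertex.lift_eq_ite, Vertex.lift_eq_ite, h]

theorem Vertex.exists_toFinset_eq {S : Finset (Fin (n + 1))} (hS : S.card = k) :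
    ∃ α : Vertex n k, α.toFinset = S := by
  set f : Fin n → Fin 2 := fun i => if i.castSucc ∈ S then 1 else 0 with hf
  have hf' : ∀ i, (f i : ℕ) = if i.castSucc ∈ S then 1 else 0 := fun i => by
    rw [hf]
    dsimp only
    split_ifs <;> rfl
  have h1 : ∑ i, (f i : ℕ) + (if Fin.last n ∈ S then 1 else 0) = k := by
    rw [← hS, Finset.sum_congr rfl fun i _ => hf' i,
      ← Fin.sum_univ_castSucc fun i => if i ∈ S then 1 else 0]
    simp
  refine ⟨⟨f, ?_⟩, ?_⟩
  · split_ifs at h1 <;> omega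
  · ext i
    simp only [Vertex.toFinset, Finset.mem_filter_univ]
    induction i using Fin.lastCases with
    | last =>
      rw [Vertex.lift_last]
      split_ifs at h1 with h <;> simp only [h, iff_true, iff_false] <;> omega
    | cast i =>
      rw [Vertex.lift_castSucc, hf']
      split_ifs with h <;> simp [h]

theorem Vertex.sum_toFinset {M : Type*} [AddCommMonoid M] (f : Finset (Fin (n + 1)) → M)
    (i : Fin (n + 1)) :
    ∑ S ∈ (Finset.univ : Finset (Fin (n + 1))).powersetCard k with i ∈ S, f S =
      ∑ α : Vertex n k, if i ∈ α.toFinset then f α.toFinset else 0 := by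
  have h : (Finset.univ : Finset (Fin (n + 1))).powersetCard k =
      Finset.univ.map ⟨Vertex.toFinset (n := n) (k := k), Vertex.toFinset_injective⟩ := by
    ext S
    simp only [Finset.mem_powersetCard_univ, Finset.mem_map, Finset.mem_univ, true_and,
      Function.Embedding.coeFn_mk]
    exact ⟨Vertex.exists_toFinset_eq, fun ⟨α, hα⟩ => hα ▸ α.card_toFinset⟩
  rw [Finset.sum_filter, h, Finset.sum_map]
  rfl

/-- The sums of the coordinates of `w` over the vertices containing `i`. -/
def marginal {R : Type*} [CommSemiring R] (w : Vertex n k → R) (i : Fin (n + 1)) : R :=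
  ∑ α, (α.lift i : R) * w α

theorem marginal_castSucc {R : Type*} [CommSemiring R] (w : Vertex n k → R) (i : Fin n) :
    marginal w i.castSucc = ∑ α, ((α.1 i : ℕ) : R) * w α := by
  simp [marginal]

theorem sum_marginal {R : Type*} [CommSemiring R] (w : Vertex n k → R) :
    ∑ i, marginal w i = k * ∑ α, w α := by
  simp only [marginal]
  rw [Finset.sum_comm, Finset.mul_sum]
  refine Finset.sum_congr rfl fun α _ => ?_
  rw [← Finset.sum_mul, ← Nat.cast_sum, α.sum_lift]

theorem marginal_eq_iff {R : Type*} [CommRing R] [IsDomain R] [CharZero R] (hk : k ≠ 0)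
    (w w' : Vertex n k → R) : (∀ i, marginal w i = marginal w' i) ↔
      (∀ i : Fin n, ∑ α, ((α.1 i : ℕ) : R) * w α = ∑ α, ((α.1 i : ℕ) : R) * w' α) ∧
        ∑ α, w α = ∑ α, w' α := by
  have hk' : (k : R) ≠ 0 := Nat.cast_ne_zero.2 hk
  simp only [← marginal_castSucc]
  constructor
  · intro h
    refine ⟨fun i => h _, mul_left_cancel₀ hk' ?_⟩
    rw [← sum_marginal, ← sum_marginal]
    exact Finset.sum_congr rfl fun i _ => h i
  · rintro ⟨h1, h2⟩ i
    have h3 : ∑ i, marginal w i = ∑ i, marginal w' i := by rw [sum_marginal, sum_marginal, h2]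
    rw [Fin.sum_univ_castSucc, Fin.sum_univ_castSucc, Finset.sum_congr rfl fun i _ => h1 i] at h3
    induction i using Fin.lastCases with
    | last => exact add_left_cancel h3
    | cast i => exact h1 i

end Hypersimplex

namespace Hypersimplex

open MvPolynomial

theorem prod_zpow_eq_one_of_prod_pow_eq {ι : Type*} [Fintype ι] {p : ι → ℂ} (hp : ∀ j, p j ≠ 0)
    {v : ι → ℤ} (h : ∏ j, p j ^ (max (v j) 0).toNat = ∏ j, p j ^ (max (-v j) 0).toNat) :
    ∏ j, p j ^ v j = 1 := by
  have h1 : ∏ j, p j ^ (max (-v j) 0).toNat ≠ 0 :=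
    Finset.prod_ne_zero_iff.2 fun j _ => pow_ne_zero _ (hp j)
  refine mul_right_cancel₀ h1 ?_
  rw [one_mul]
  refine Eq.trans ?_ h
  rw [← Finset.prod_mul_distrib]
  refine Finset.prod_congr rfl fun j _ => ?_
  rw [← zpow_natCast, ← zpow_natCast, ← zpow_add₀ (hp j)]
  congr 1
  omega

variable {n k : ℕ}

theorem map_toricMoment (φ : toricRing (Fin (n + 1)) k →ₐ[ℂ] ℂ) (i : Fin (n + 1)) :
    φ (toricMoment k i) = marginal (fun α : Vertex n k => φ (toricMon k α.toFinset)) i := by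
  rw [toricMoment, map_sum, Vertex.sum_toFinset]
  simp [marginal, Vertex.lift_eq_ite]

theorem prod_toricMon_pow (a : Vertex n k → ℕ) :
    ((∏ α, toricMon k α.toFinset ^ a α : toricRing (Fin (n + 1)) k) : MvPolynomial (Fin (n + 1)) ℂ) =
      ∏ i, X i ^ marginal a i := by
  have h : ∀ α : Vertex n k, (mon k α.toFinset : MvPolynomial (Fin (n + 1)) ℂ) =
      ∏ i, X i ^ α.lift i := fun α => by
    rw [mon_of_card α.card_toFinset]
    simp [Vertex.lift_eq_ite, Finset.prod_ite_mem]
  simp only [SubmonoidClass.coe_finsetProd, SubmonoidClass.coe_pow, toricMon, h, ← Finset.prod_pow,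
    ← pow_mul]
  rw [Finset.prod_comm]
  refine Finset.prod_congr rfl fun i _ => ?_
  rw [Finset.prod_pow_eq_pow_sum]
  rfl

/-- The likelihood equations are conditions on the marginals. -/
theorem likelihood_iff (hk : 1 ≤ k) {u : Vertex n k → ℂ} (hu : ∑ α, u α ≠ 0) (p : Vertex n k → ℂ) :
    (∑ α, 1 * p α = 1 ∧ ∀ i : Fin n, (∑ α, u α) * (∑ α, (((α.1 i : ℕ) : ℤ) : ℂ) * (1 * p α)) =
      ∑ α, (((α.1 i : ℕ) : ℤ) : ℂ) * u α) ↔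
      ∀ i, marginal (fun α => (∑ β, u β) * p α) i = marginal u i := by
  rw [marginal_eq_iff (by omega), and_comm]
  simp only [one_mul, Int.cast_natCast, mul_left_comm _ (∑ β, u β), ← Finset.mul_sum,
    mul_eq_left₀ hu]

theorem isExchange_of_mem_mlSolutions (hk : 1 ≤ k) {u p : Vertex n k → ℂ}
    (hp : p ∈ mlSolutions (fun (i : Fin n) (α : Vertex n k) => ((α.1 i : ℕ) : ℤ)) (fun _ => 1) u)
    {q : Finset (Fin (n + 1)) → ℂ} {c : ℂ} (hq : ∀ α : Vertex n k, q α.toFinset = c * p α) :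
    IsExchange k q := by
  intro S S' hS hS' j hj i hi hiS hjS'
  have hT : (insert i (S.erase j)).card = k := by
    rw [Finset.card_insert_of_notMem fun h => hiS (Finset.mem_of_mem_erase h),
      Finset.card_erase_add_one hj, hS]
  have hT' : (insert j (S'.erase i)).card = k := by
    rw [Finset.card_insert_of_notMem fun h => hjS' (Finset.mem_of_mem_erase h),
      Finset.card_erase_add_one hi, hS']
  obtain ⟨α, rfl⟩ := Vertex.exists_toFinset_eq hS
  obtain ⟨α', rfl⟩ := Vertex.exists_toFinset_eq hS'
  obtain ⟨β, hβ⟩ := Vertex.exists_toFinset_eq hT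
  obtain ⟨β', hβ'⟩ := Vertex.exists_toFinset_eq hT'
  set v : Vertex n k → ℤ :=
    Pi.single α 1 + Pi.single α' 1 - Pi.single β 1 - Pi.single β' 1 with hv
  have hmarg : ∀ l, marginal v l = marginal (0 : Vertex n k → ℤ) l := by
    intro l
    have h : ((α.lift l : ℤ) + α'.lift l - β.lift l - β'.lift l) = 0 := by
      simp only [Vertex.lift_eq_ite, hβ, hβ', Finset.mem_insert, Finset.mem_erase]
      have hij : i ≠ j := fun h => hiS (h ▸ hj)
      by_cases hli : l = i
      · subst hli
        simp [hi, hiS, hij]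
      · by_cases hlj : l = j
        · subst hlj
          simp [hj, hjS', hli]
        · simp [hli, hlj]
    rw [← sub_eq_zero, ← h]
    simp [marginal, hv, mul_sub, mul_add, Finset.sum_sub_distrib, Finset.sum_add_distrib,
      Pi.single_apply]
  obtain ⟨h1, h2⟩ := (marginal_eq_iff (by omega) _ _).1 hmarg
  obtain ⟨hp0, hbin, -⟩ := hp
  have h3 := prod_zpow_eq_one_of_prod_pow_eq hp0
    (hbin v (fun i => by simpa using h1 i) (by simpa using h2))
  have hsingle : ∀ γ : Vertex n k, ∏ δ, p δ ^ (Pi.single γ 1 : Vertex n k → ℤ) δ = p γ := by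
    intro γ
    simp [Pi.single_apply]
  have h4 : ∀ δ, p δ ^ v δ = p δ ^ (Pi.single α 1 : Vertex n k → ℤ) δ *
      p δ ^ (Pi.single α' 1 : Vertex n k → ℤ) δ / p δ ^ (Pi.single β 1 : Vertex n k → ℤ) δ /
      p δ ^ (Pi.single β' 1 : Vertex n k → ℤ) δ := fun δ => by
    simp only [hv, Pi.sub_apply, Pi.add_apply]
    rw [zpow_sub₀ (hp0 δ), zpow_sub₀ (hp0 δ), zpow_add₀ (hp0 δ)]
  simp only [h4, Finset.prod_div_distrib, Finset.prod_mul_distrib, hsingle] at h3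
  rw [div_div, div_eq_one_iff_eq (mul_ne_zero (hp0 _) (hp0 _))] at h3
  rw [← hβ, ← hβ', hq, hq, hq, hq]
  linear_combination c ^ 2 * h3

theorem mlSolutions_eq_image (hk : 1 ≤ k) (hkn : k ≤ n) {u : Vertex n k → ℂ} (hu : ∑ α, u α ≠ 0)
    (hne : ∀ φ : toricRing (Fin (n + 1)) k →ₐ[ℂ] ℂ, (∀ i, φ (toricMoment k i) = marginal u i) →
      ∀ S, S.card = k → φ (toricMon k S) ≠ 0) :
    mlSolutions (fun (i : Fin n) (α : Vertex n k) => ((α.1 i : ℕ) : ℤ)) (fun _ => 1) u =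
      (fun φ α => (∑ β, u β)⁻¹ * φ (toricMon k α.toFinset)) ''
        {φ : toricRing (Fin (n + 1)) k →ₐ[ℂ] ℂ | ∀ i, φ (toricMoment k i) = marginal u i} := by
  ext p
  rw [Set.mem_image]
  constructor
  · intro hp
    set q : Finset (Fin (n + 1)) → ℂ := Function.extend Vertex.toFinset (fun α => (∑ β, u β) * p α) 0
    have hq : ∀ α : Vertex n k, q α.toFinset = (∑ β, u β) * p α :=
      Vertex.toFinset_injective.extend_apply _ _
    have hq0 : ∀ S, S.card = k → q S ≠ 0 := by
      intro S hS
      obtain ⟨α, rfl⟩ := Vertex.exists_toFinset_eq hS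
      rw [hq]
      exact mul_ne_zero hu (hp.1 α)
    obtain ⟨x, hx⟩ := (isExchange_of_mem_mlSolutions hk hp hq).exists_eq_prod_univ hk
      (by simpa using hkn) hq0
    have hφ : ∀ α : Vertex n k, ((aeval x).comp (toricRing (Fin (n + 1)) k).val)
        (toricMon k α.toFinset) = (∑ β, u β) * p α := by
      intro α
      rw [← hq, hx _ α.card_toFinset]
      simp [toricMon, mon_of_card α.card_toFinset]
    refine ⟨(aeval x).comp (toricRing (Fin (n + 1)) k).val, fun i => ?_, ?_⟩
    · rw [map_toricMoment, ← (likelihood_iff hk hu p).1 hp.2.2]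
      simp only [hφ]
    · ext1 α
      rw [hφ, inv_mul_cancel_left₀ hu]
  · rintro ⟨φ, hφ, rfl⟩
    refine ⟨fun α => mul_ne_zero (inv_ne_zero hu) (hne φ hφ _ α.card_toFinset), fun v hv1 hv2 => ?_,
      (likelihood_iff hk hu _).2 fun i => ?_⟩
    · have h1 : ∀ i, marginal (fun α => (((max (v α) 0).toNat : ℕ) : ℤ)) i =
          marginal (fun α => (((max (-v α) 0).toNat : ℕ) : ℤ)) i := by
        have h2 : ∀ α, v α = (((max (v α) 0).toNat : ℕ) : ℤ) - ((max (-v α) 0).toNat : ℕ) :=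
          fun α => by omega
        rw [marginal_eq_iff (by omega)]
        constructor
        · intro i
          rw [← sub_eq_zero, ← Finset.sum_sub_distrib]
          simp only [← mul_sub, ← h2]
          exact hv1 i
        · rw [← sub_eq_zero, ← Finset.sum_sub_distrib]
          simp only [← h2]
          exact hv2
      have h3 := ((marginal_eq_iff (by omega) _ _).1 h1).2
      have h4 : (∏ α : Vertex n k, toricMon k α.toFinset ^ (max (v α) 0).toNat) =
          ∏ α : Vertex n k, toricMon k α.toFinset ^ (max (-v α) 0).toNat := by
        refine Subtype.ext ?_
        rw [prod_toricMon_pow, prod_toricMon_pow]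
        refine Finset.prod_congr rfl fun i _ => ?_
        congr 1
        have := h1 i
        simp only [marginal] at this ⊢
        exact_mod_cast this
      have h5 := congrArg φ h4
      simp only [map_prod, map_pow] at h5
      simp only [mul_pow, Finset.prod_mul_distrib, Finset.prod_pow_eq_pow_sum]
      rw [h5]
      congr 2
      exact_mod_cast h3
    · rw [← hφ, map_toricMoment]
      simp only [mul_inv_cancel_left₀ hu]

end Hypersimplex

namespace Hypersimplex

open MvPolynomial

variable {n k : ℕ}

theorem marginal_surjective (hk : 1 ≤ k) (hkn : k ≤ n) :
    Function.Surjective (marginal : (Vertex n k → ℂ) → Fin (n + 1) → ℂ) := by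
  let L : (Vertex n k → ℂ) →ₗ[ℂ] Fin (n + 1) → ℂ :=
    { toFun := marginal
      map_add' := fun w w' => by
        ext i
        simp [marginal, mul_add, Finset.sum_add_distrib]
      map_smul' := fun c w => by
        ext i
        simp [marginal, Finset.mul_sum, mul_left_comm] }
  change Function.Surjective L
  rw [← LinearMap.range_eq_top]
  by_contra hne
  obtain ⟨f, hf0, hf⟩ := Submodule.exists_le_ker_of_lt_top _ (lt_top_iff_ne_top.2 hne)
  set l : Fin (n + 1) → ℂ := fun i => f (Pi.single i 1) with hl
  have hfl : ∀ x, f x = ∑ i, x i * l i := fun x => by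
    rw [LinearMap.pi_apply_eq_sum_univ f x]
    refine Finset.sum_congr rfl fun i _ => ?_
    rw [smul_eq_mul, hl]
    congr 2
    ext j
    simp [Pi.single_apply, eq_comm]
  have hS : ∀ S : Finset (Fin (n + 1)), S.card = k → ∑ i ∈ S, l i = 0 := by
    intro S hS
    obtain ⟨α, rfl⟩ := Vertex.exists_toFinset_eq hS
    have h1 : f (L (Pi.single α 1)) = 0 := hf ⟨_, rfl⟩
    rw [hfl] at h1
    rw [← h1]
    simp [L, marginal, Vertex.lift_eq_ite, Pi.single_apply]
  have hl_eq : ∀ i j, l i = l j := by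
    intro i j
    by_cases hij : i = j
    · rw [hij]
    obtain ⟨S, hiS, hSj, hSk⟩ := Finset.exists_subsuperset_card_eq
      (s := {i}) (t := Finset.univ.erase j) (n := k) (by simpa using hij) (by simpa using hk)
      (by simpa using hkn)
    rw [Finset.singleton_subset_iff] at hiS
    have hjS : j ∉ S := fun h => by simpa using hSj h
    have hjS' : j ∉ S.erase i := fun h => hjS (Finset.mem_of_mem_erase h)
    have h1 := hS S hSk
    have h2 := hS (insert j (S.erase i)) (by
      rw [Finset.card_insert_of_notMem hjS', Finset.card_erase_add_one hiS, hSk])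
    rw [← Finset.add_sum_erase _ _ hiS] at h1
    rw [Finset.sum_insert hjS'] at h2
    exact add_right_cancel (h1.trans h2.symm)
  have hl0 : ∀ i, l i = 0 := by
    intro i
    obtain ⟨S, -, hSk⟩ := Finset.exists_subset_card_eq (s := (Finset.univ : Finset (Fin (n + 1))))
      (n := k) (by simpa using hkn.trans (Nat.le_succ n))
    have h1 := hS S hSk
    rw [Finset.sum_congr rfl fun j _ => hl_eq j i, Finset.sum_const, hSk, nsmul_eq_mul] at h1
    exact (mul_eq_zero.1 h1).resolve_left (Nat.cast_ne_zero.2 (by omega))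
  refine hf0 (LinearMap.ext fun x => ?_)
  rw [hfl]
  simp [hl0]

theorem exists_ncard_mlSolutions (hk : 1 ≤ k) (hkn : k ≤ n) :
    ∃ G : MvPolynomial (Vertex n k) ℂ, G ≠ 0 ∧ ∀ u : Vertex n k → ℂ, eval u G ≠ 0 →
      (mlSolutions (fun (i : Fin n) (α : Vertex n k) => ((α.1 i : ℕ) : ℤ)) (fun _ => 1) u).Finite ∧
      ((mlSolutions (fun (i : Fin n) (α : Vertex n k) => ((α.1 i : ℕ) : ℤ))
        (fun _ => 1) u).ncard : ℤ) = eulerian n k := by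
  obtain ⟨h, hh, hb⟩ := exists_generic_card hk hkn
  have heval : ∀ u : Vertex n k → ℂ, eval u (aeval (marginal X) h * ∑ α, X α) =
      eval (marginal u) h * ∑ α, u α := by
    intro u
    have h1 : ((aeval u).comp (aeval (marginal (X : Vertex n k → MvPolynomial (Vertex n k) ℂ)))) =
        aeval (R := ℂ) (marginal u) := by
      ext i
      simp [marginal]
    have h2 := DFunLike.congr_fun h1 h
    rw [AlgHom.comp_apply] at h2
    rw [map_mul, map_sum]
    simp only [eval_X]
    congr 1
  refine ⟨aeval (marginal X) h * ∑ α, X α, fun h0 => ?_, fun u hu => ?_⟩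
  · have hX : (∑ i, X i : MvPolynomial (Fin (n + 1)) ℂ) ≠ 0 := fun h1 => by
      have h2 := congrArg (eval (Pi.single 0 1)) h1
      simp at h2
    refine mul_ne_zero hh hX (MvPolynomial.funext fun b => ?_)
    obtain ⟨u, rfl⟩ := marginal_surjective hk hkn b
    have h3 := heval u
    rw [h0, map_zero] at h3
    rw [map_mul, map_sum, map_zero]
    simp only [eval_X]
    rw [sum_marginal, mul_left_comm, ← h3, mul_zero]
  · rw [heval] at hu
    obtain ⟨⟨r, hr, hr'⟩, hne⟩ := hb _ (left_ne_zero_of_mul hu)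
    have hu' := right_ne_zero_of_mul hu
    rw [mlSolutions_eq_image hk hkn hu' hne]
    have hinj : Function.Injective fun (φ : toricRing (Fin (n + 1)) k →ₐ[ℂ] ℂ) (α : Vertex n k) =>
        (∑ β, u β)⁻¹ * φ (toricMon k α.toFinset) := by
      intro φ ψ h1
      refine AlgHom.adjoin_ext ?_
      rintro _ ⟨S, rfl⟩
      by_cases hS : S.card = k
      · obtain ⟨α, rfl⟩ := Vertex.exists_toFinset_eq hS
        exact mul_left_cancel₀ (inv_ne_zero hu') (congrFun h1 α)
      · have h2 : (⟨mon k S, Algebra.subset_adjoin ⟨S, rfl⟩⟩ : toricRing (Fin (n + 1)) k) = 0 :=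
          Subtype.ext (mon_of_card_ne hS)
        rw [h2, map_zero, map_zero]
    refine ⟨(Set.finite_of_encard_eq_coe hr).image _, ?_⟩
    rw [Set.ncard_image_of_injective _ hinj, Set.ncard, hr, ← hr']
    rfl

end Hypersimplex

/-- The ML degree of the toric variety of the hypersimplex with trivial scaling
equals its normalized volume, the Eulerian number
`A(d-1, k-1) = ∑_{j<k} (-1)^j C(d,j) (k-j)^{d-1}`. -/
theorem ml_degree_hypersimplex (d k : ℕ) (hd : 2 ≤ d) (hk : 1 ≤ k) (hkd : k ≤ d - 1) :
    ∃ G : MvPolynomial (HypIndex d k) ℂ, G ≠ 0 ∧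
      ∀ u : HypIndex d k → ℂ, MvPolynomial.eval u G ≠ 0 →
        (mlSolutions (hypA d k) (fun _ => 1) u).Finite ∧
        ((mlSolutions (hypA d k) (fun _ => 1) u).ncard : ℤ) =
          ∑ j ∈ Finset.range k,
            (-1 : ℤ) ^ j * (d.choose j : ℤ) * ((k : ℤ) - (j : ℤ)) ^ (d - 1) := by
  obtain ⟨n, rfl⟩ : ∃ n, d = n + 1 := ⟨d - 1, by omega⟩
  exact Hypersimplex.exists_ncard_mlSolutions hk hkd
end

section
/- Let d ≥ 2 and let A be the Veronese matrix for k = 2 of the context with trivial scaling c = (1,1,…,1). Then there is a nonzero polynomial G ∈ ℂ[u] such that for every u ∈ ℂ^n with G(u) ≠ 0 the likelihood system for (A,(1,…,1),u) has exactly 2^{d−1} solutions. (The ML degree of the second Veronese Ver(d−1,2) with trivial scaling equals its degree 2^{d−1}, for every d ≥ 2.) -/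
open scoped BigOperators

/-- Column indices of the second Veronese `Ver(d-1,2)`: exponent vectors `α ∈ ℕ^{d-1}`
with `α₁ + ⋯ + α_{d-1} ≤ 2`. -/
abbrev Ver2Index (d : ℕ) : Type :=
  {α : Fin (d - 1) → Fin 3 // ∑ i, (α i : ℕ) ≤ 2}

/-- The matrix of the second Veronese `Ver(d-1,2)`. -/
def ver2A (d : ℕ) : Fin (d - 1) → Ver2Index d → ℤ :=
  fun i α => ((α.1 i : ℕ) : ℤ)

open MvPolynomial in
/-- A polynomial map from affine `|J|`-space to itself sends every hypersurface into a
hypersurface. -/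
theorem exists_hypersurface_of_image {J : Type*} [Fintype J] (g : J → MvPolynomial J ℂ)
    {f : MvPolynomial J ℂ} (hf : f ≠ 0) :
    ∃ G : MvPolynomial J ℂ, G ≠ 0 ∧
      ∀ x : J → ℂ, eval x f = 0 → eval (fun i => eval x (g i)) G = 0 := by
  classical
  let h : Option J → MvPolynomial J ℂ := fun o => o.elim f g
  have hdep : ¬ AlgebraicIndependent ℂ h := by
    intro hind
    have h1 := hind.lift_cardinalMk_le_trdeg
    rw [MvPolynomial.trdeg_of_isDomain] at h1
    simp only [Cardinal.mk_fintype, Fintype.card_option, Cardinal.lift_natCast] at h1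
    have h2 : Fintype.card J + 1 ≤ Fintype.card J := by exact_mod_cast h1
    omega
  obtain ⟨H, hH, hH0⟩ : ∃ H : MvPolynomial (Option J) ℂ, aeval h H = 0 ∧ H ≠ 0 := by
    by_contra hcon
    push Not at hcon
    exact hdep ((injective_iff_map_eq_zero _).2 hcon)
  have key : ∀ P : Polynomial (MvPolynomial J ℂ),
      aeval h ((optionEquivLeft ℂ J).symm P) = Polynomial.eval₂ (aeval g).toRingHom f P := by
    intro P
    induction P using Polynomial.induction_on' with
    | add p q hp hq => rw [map_add, map_add, Polynomial.eval₂_add, hp, hq]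
    | monomial n a =>
      rw [← Polynomial.C_mul_X_pow_eq_monomial]
      simp only [map_mul, map_pow, optionEquivLeft_symm_X, aeval_X,
        Polynomial.eval₂_mul, Polynomial.eval₂_pow, Polynomial.eval₂_X, Polynomial.eval₂_C]
      congr 1
      induction a using MvPolynomial.induction_on with
      | C a => simp [optionEquivLeft_symm_C_C, algebraMap_eq]
      | add p q hp hq => simp only [map_add, hp, hq]
      | mul_X p i hp => simp_all [h]
  set P := optionEquivLeft ℂ J H with hP
  have hP0 : P ≠ 0 := by simpa [hP] using hH0
  have hPe : Polynomial.eval₂ (aeval g).toRingHom f P = 0 := by rw [← key]; simpa [hP] using hH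
  obtain ⟨Q, hQ, hnd⟩ := Polynomial.exists_eq_pow_rootMultiplicity_mul_and_not_dvd P hP0 0
  have hQe : Polynomial.eval₂ (aeval g).toRingHom f Q = 0 := by
    rw [hQ, Polynomial.eval₂_mul, Polynomial.eval₂_pow] at hPe
    simpa [hf] using hPe
  refine ⟨Q.coeff 0, ?_, ?_⟩
  · rw [map_zero, sub_zero, Polynomial.X_dvd_iff] at hnd
    exact hnd
  · intro x hx
    have h3 := congrArg (eval x) hQe
    rw [Polynomial.hom_eval₂, hx, Polynomial.eval₂_at_zero, map_zero] at h3
    rw [← h3]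
    simp only [AlgHom.toRingHom_eq_coe, RingHom.coe_comp, Function.comp_apply, RingHom.coe_coe]
    have h4 : (eval x : MvPolynomial J ℂ →+* ℂ) (aeval g (Q.coeff 0))
        = eval₂Hom (RingHom.id ℂ) (fun i => eval x (g i)) (Q.coeff 0) := by
      rw [aeval_def, MvPolynomial.eval₂_comp_left (eval x)]
      simp [Function.comp_def, algebraMap_eq, eval₂Hom]
      congr 1
      ext; simp
    rw [h4]
    rfl

open MvPolynomial in
theorem coeff_aeval_C_mul_X {K : Type*} [Fintype K] (δ : K → ℂ) (p : MvPolynomial K ℂ)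
    (m : K →₀ ℕ) :
    coeff m (aeval (fun k => C (δ k) * X k : K → MvPolynomial K ℂ) p) =
      (∏ k, δ k ^ m k) * coeff m p := by
  classical
  induction p using MvPolynomial.induction_on' with
  | monomial n a =>
    have : aeval (fun k => C (δ k) * X k : K → MvPolynomial K ℂ) (monomial n a) =
        monomial n ((∏ k, δ k ^ n k) * a) := by
      rw [aeval_monomial, Finsupp.prod_fintype _ _ (by simp), monomial_eq,
        Finsupp.prod_fintype _ _ (by simp)]
      simp only [mul_pow, Finset.prod_mul_distrib, algebraMap_eq, C_mul, map_prod, C_pow]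
      ring
    rw [this, coeff_monomial, coeff_monomial]
    split_ifs with h
    · rw [h]
    · simp
  | add p q hp hq => simp only [map_add, coeff_add, hp, hq, mul_add]

open MvPolynomial in
/-- A form of degree `2 N` that is even in each variable is a form of degree `N` in the squares
of the variables. -/
theorem exists_expand_two_eq {K : Type*} [Fintype K] {Φ : MvPolynomial K ℂ} {N : ℕ}
    (hhom : Φ.IsHomogeneous (2 * N))
    (hinv : ∀ δ : K → ℤˣ,
      aeval (fun k => C ((δ k : ℤ) : ℂ) * X k : K → MvPolynomial K ℂ) Φ = Φ) :
    ∃ H : MvPolynomial K ℂ, H.IsHomogeneous N ∧ expand 2 H = Φ := by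
  classical
  have heven : ∀ m : K →₀ ℕ, coeff m Φ ≠ 0 → ∀ k, Even (m k) := by
    intro m hm k
    by_contra hk
    rw [Nat.not_even_iff_odd] at hk
    have h1 := congrArg (coeff m) (hinv (Function.update 1 k (-1)))
    rw [coeff_aeval_C_mul_X, Finset.prod_eq_single k] at h1
    · simp only [Function.update_self, Units.val_neg, Units.val_one, Int.cast_neg, Int.cast_one,
        hk.neg_one_pow, neg_mul, one_mul] at h1
      exact hm (self_eq_neg.1 h1.symm)
    · intro b _ hb
      simp [Function.update_of_ne hb]
    · simp
  have hhalf : ∀ m ∈ Φ.support, 2 • (m.mapRange (· / 2) (by simp) : K →₀ ℕ) = m := by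
    intro m hm
    ext k
    have := heven m (mem_support_iff.1 hm) k
    simp only [Finsupp.smul_apply, Finsupp.mapRange_apply, smul_eq_mul]
    exact Nat.two_mul_div_two_of_even this
  refine ⟨∑ m ∈ Φ.support, monomial (m.mapRange (· / 2) (by simp)) (coeff m Φ), ?_, ?_⟩
  · refine IsHomogeneous.sum _ _ _ fun m hm => isHomogeneous_monomial _ ?_
    have h1 := hhom (mem_support_iff.1 hm)
    rw [← hhalf m hm] at h1
    replace h1 : Finsupp.weight (fun _ => 1) (2 • (m.mapRange (· / 2) (by simp) : K →₀ ℕ)) = 2 * N := h1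
    rw [← Finsupp.degree_eq_weight_one] at h1
    simp only [map_nsmul, smul_eq_mul] at h1
    omega
  · conv_rhs => rw [Φ.as_sum]
    rw [map_sum]
    refine Finset.sum_congr rfl fun m hm => ?_
    rw [expand_monomial, hhalf m hm]

open MvPolynomial in
theorem natDegree_aeval_line_le {K : Type*} [Fintype K] {H : MvPolynomial K ℂ} {N : ℕ}
    (hH : H.IsHomogeneous N) (α β : K → ℂ) :
    (aeval (fun k => Polynomial.C (α k) + Polynomial.C (β k) * Polynomial.X) H).natDegree ≤ N ∧
    (aeval (fun k => Polynomial.C (α k) + Polynomial.C (β k) * Polynomial.X) H).coeff N =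
      eval β H := by
  classical
  have hlin : ∀ k, (Polynomial.C (α k) + Polynomial.C (β k) * Polynomial.X).natDegree ≤ 1 := by
    intro k
    compute_degree
  have hdeg : ∀ m ∈ H.support, ∑ k, m k = N := by
    intro m hm
    have h1 := hH (mem_support_iff.1 hm)
    replace h1 : Finsupp.weight (fun _ => 1) m = N := h1
    rw [← Finsupp.degree_eq_weight_one, Finsupp.degree_eq_sum] at h1
    exact h1
  have hpow : ∀ (m : K →₀ ℕ) k,
      ((Polynomial.C (α k) + Polynomial.C (β k) * Polynomial.X) ^ m k).natDegree ≤ m k := by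
    intro m k
    simpa using Polynomial.natDegree_pow_le_of_le (m k) (hlin k)
  have hprod : ∀ (m : K →₀ ℕ) (s : Finset K),
      (∏ k ∈ s, (Polynomial.C (α k) + Polynomial.C (β k) * Polynomial.X) ^ m k).natDegree
        ≤ ∑ k ∈ s, m k ∧
      (∏ k ∈ s, (Polynomial.C (α k) + Polynomial.C (β k) * Polynomial.X) ^ m k).coeff
        (∑ k ∈ s, m k) = ∏ k ∈ s, β k ^ m k := by
    intro m s
    induction s using Finset.induction_on with
    | empty => simp
    | insert a s ha ih =>
      rw [Finset.prod_insert ha, Finset.sum_insert ha, Finset.prod_insert ha]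
      refine ⟨Polynomial.natDegree_mul_le_of_le (hpow m a) ih.1, ?_⟩
      rw [Polynomial.coeff_mul_add_eq_of_natDegree_le (hpow m a) ih.1, ih.2]
      congr 1
      have := Polynomial.coeff_pow_of_natDegree_le (m := m a) (hlin a)
      rw [mul_one] at this
      rw [this]
      simp
  have hsum : aeval (fun k => Polynomial.C (α k) + Polynomial.C (β k) * Polynomial.X) H =
      ∑ m ∈ H.support, Polynomial.C (coeff m H) *
        ∏ k, (Polynomial.C (α k) + Polynomial.C (β k) * Polynomial.X) ^ m k := by
    conv_lhs => rw [H.as_sum]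
    rw [map_sum]
    refine Finset.sum_congr rfl fun m _ => ?_
    rw [aeval_monomial, Finsupp.prod_fintype _ _ (by simp)]
    rfl
  rw [hsum]
  constructor
  · refine Polynomial.natDegree_sum_le_of_forall_le _ _ fun m hm => ?_
    refine (Polynomial.natDegree_C_mul_le _ _).trans ?_
    rw [← hdeg m hm]
    exact (hprod m _).1
  · rw [Polynomial.finsetSum_coeff, eval_eq']
    refine Finset.sum_congr rfl fun m hm => ?_
    rw [Polynomial.coeff_C_mul]
    conv_lhs => rw [← hdeg m hm]
    rw [(hprod m _).2]

open MvPolynomial in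
/-- The product of the `2 ^ |J|` linear forms `c y₀ - ∑ ± yᵢ` is a form in the squares of the
variables. -/
theorem exists_signed_norm_form {J : Type*} [Fintype J] [DecidableEq J] [Nonempty J]
    (c : ℂ) :
    ∃ H : MvPolynomial (Option J) ℂ, H.IsHomogeneous (2 ^ (Fintype.card J - 1)) ∧
      ∀ {A : Type} [CommRing A] [Algebra ℂ A] (y : Option J → A), aeval (fun k => y k ^ 2) H =
        ∏ ε : J → ℤˣ, (algebraMap ℂ A c * y none - ∑ i, ((ε i : ℤ) : A) * y (some i)) := by
  classical
  let ℓ : (J → ℤˣ) → MvPolynomial (Option J) ℂ := fun ε =>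
    C c * X none - ∑ i, C ((ε i : ℤ) : ℂ) * X (some i)
  have hJ : 2 * 2 ^ (Fintype.card J - 1) = 2 ^ Fintype.card J := by
    rw [← pow_succ', Nat.sub_add_cancel Fintype.card_pos]
  have hcard : Fintype.card (J → ℤˣ) = 2 ^ Fintype.card J := by simp
  obtain ⟨H, hH, hHe⟩ := exists_expand_two_eq (Φ := ∏ ε, ℓ ε)
    (N := 2 ^ (Fintype.card J - 1)) (by
      have : 2 * 2 ^ (Fintype.card J - 1) = ∑ _ε : J → ℤˣ, 1 := by
        rw [hJ, ← hcard]; simp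
      rw [this]
      refine IsHomogeneous.prod _ _ _ fun ε _ => ?_
      refine IsHomogeneous.sub ?_ (IsHomogeneous.sum _ _ _ fun i _ => ?_)
      · simpa using (isHomogeneous_C _ c).mul (isHomogeneous_X ℂ (none : Option J))
      · exact zero_add 1 ▸ (isHomogeneous_C _ _).mul (isHomogeneous_X ℂ (some i))) (by
      intro δ
      have hstep : ∀ ε : J → ℤˣ,
          aeval (fun k => C ((δ k : ℤ) : ℂ) * X k : Option J → MvPolynomial (Option J) ℂ) (ℓ ε)
            = C ((δ none : ℤ) : ℂ) * ℓ (ε * fun i => δ (some i) * δ none) := by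
        intro ε
        have hsq : ((δ none : ℤ) : ℂ) * ((δ none : ℤ) : ℂ) = 1 := by
          rcases Int.units_eq_one_or (δ none) with h | h <;> simp [h]
        simp only [ℓ, map_sub, map_mul, map_sum, aeval_X, aeval_C, algebraMap_eq, mul_sub,
          Finset.mul_sum]
        congr 1
        · ring
        · refine Finset.sum_congr rfl fun i _ => ?_
          simp only [Pi.mul_apply, Units.val_mul, Int.cast_mul, C_mul]
          have hsq' : (C ((δ none : ℤ) : ℂ) * C ((δ none : ℤ) : ℂ) : MvPolynomial (Option J) ℂ)
              = 1 := by rw [← C_mul, hsq, C_1]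
          linear_combination (-(C ((ε i : ℤ) : ℂ) * C ((δ (some i) : ℤ) : ℂ) * X (some i))) * hsq'
      rw [map_prod, Finset.prod_congr rfl fun ε _ => hstep ε, Finset.prod_mul_distrib,
        Finset.prod_const, Finset.card_univ, hcard, ← hJ, pow_mul]
      have hsq : (C ((δ none : ℤ) : ℂ) : MvPolynomial (Option J) ℂ) ^ 2 = 1 := by
        rcases Int.units_eq_one_or (δ none) with h | h <;> simp [h]
      rw [hsq, one_pow, one_mul]
      exact Fintype.prod_equiv (Equiv.mulRight fun i => δ (some i) * δ none) _ _ fun ε => rfl)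
  refine ⟨H, hH, ?_⟩
  intro A _ _ y
  have h1 := congrArg (aeval y) hHe
  rw [aeval_expand] at h1
  rw [show (fun k => y k ^ 2) = y ^ 2 from rfl, h1, map_prod]
  refine Finset.prod_congr rfl fun ε _ => ?_
  simp [ℓ]

/-- The genericity conditions on `B` under which the system `xᵢ (xᵢ + ∑ x) = Bᵢ` is
shown to have the expected number of solutions. -/
structure IsGenericData {J : Type*} [Fintype J] (B : J → ℂ) : Prop where
  ne_zero : ∀ i, B i ≠ 0
  sum_ne_zero : ∑ i, B i ≠ 0
  sum_sqrt_ne_zero : ∀ β : J → ℂ, (∀ i, β i ^ 2 = B i) → ∑ i, β i ≠ 0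
  sum_solution_ne_zero : ∀ x : J → ℂ, (∀ i, x i * (x i + ∑ j, x j) = B i) → ∑ j, x j ≠ 0
  partial_sum_ne_zero : ∀ x : J → ℂ, (∀ i, x i * (x i + ∑ j, x j) = B i) →
    ∀ D : Finset J, D.Nonempty → ∑ i ∈ D, (2 * x i + ∑ j, x j) ≠ 0
  jacobian_ne_zero : ∀ x : J → ℂ, (∀ i, x i * (x i + ∑ j, x j) = B i) →
    ∑ i, B i / (2 * x i + ∑ j, x j) ≠ 0

open MvPolynomial in
theorem exists_isGenericData (J : Type*) [Fintype J] [Nonempty J] :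
    ∃ G : MvPolynomial J ℂ, G ≠ 0 ∧ ∀ B : J → ℂ, eval B G ≠ 0 → IsGenericData B := by
  classical
  have hn : (Fintype.card J : ℂ) ≠ 0 := Nat.cast_ne_zero.2 Fintype.card_ne_zero
  have hn2 : (2 + Fintype.card J : ℂ) ≠ 0 := by norm_cast; omega
  have hn1 : (1 + Fintype.card J : ℂ) ≠ 0 := by norm_cast; omega
  have hsum0 : (∑ i, X i : MvPolynomial J ℂ) ≠ 0 := by
    intro h
    have := congrArg (eval (fun _ => (1 : ℂ))) h
    simp at this
  obtain ⟨G₁, hG₁, h₁⟩ := exists_hypersurface_of_image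
    (fun i => X i ^ 2 : J → MvPolynomial J ℂ) hsum0
  let g : J → MvPolynomial J ℂ := fun i => X i * (X i + ∑ j, X j)
  let y : J → MvPolynomial J ℂ := fun i => 2 * X i + ∑ j, X j
  let f₂ : MvPolynomial J ℂ := ∏ D : {D : Finset J // D.Nonempty}, ∑ i ∈ D.1, y i
  let f₃ : MvPolynomial J ℂ := ∑ i, g i * ∏ j ∈ Finset.univ.erase i, y j
  have hf₂ : f₂ ≠ 0 := by
    refine Finset.prod_ne_zero_iff.2 fun D _ h => ?_
    have := congrArg (eval (fun _ => (1 : ℂ))) h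
    have hD : (D.1.card : ℂ) ≠ 0 := Nat.cast_ne_zero.2 D.2.card_pos.ne'
    simp only [y, map_sum, map_add, map_mul, eval_X, map_ofNat, map_zero, Finset.sum_const,
      Finset.card_univ, nsmul_eq_mul, mul_one] at this
    exact mul_ne_zero hD hn2 this
  have hf₃ : f₃ ≠ 0 := by
    intro h
    have := congrArg (eval (fun _ => (1 : ℂ))) h
    simp [f₃, g, y, map_prod, hn2, hn1] at this
  obtain ⟨G₂, hG₂, h₂⟩ := exists_hypersurface_of_image g
    (mul_ne_zero hsum0 (mul_ne_zero hf₂ hf₃))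
  refine ⟨(∏ i, X i) * (∑ i, X i) * G₁ * G₂, ?_, ?_⟩
  · exact mul_ne_zero (mul_ne_zero (mul_ne_zero
      (Finset.prod_ne_zero_iff.2 fun i _ => X_ne_zero i) hsum0) hG₁) hG₂
  intro B hB
  simp only [map_mul, mul_ne_zero_iff] at hB
  obtain ⟨⟨⟨hB1, hB2⟩, hB3⟩, hB4⟩ := hB
  have hx : ∀ x : J → ℂ, (∀ i, x i * (x i + ∑ j, x j) = B i) →
      eval x (∑ i, X i) ≠ 0 ∧ eval x f₂ ≠ 0 ∧ eval x f₃ ≠ 0 := by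
    intro x hx
    by_contra hcon
    have h0 : eval x ((∑ i, X i) * (f₂ * f₃)) = 0 := by
      rw [map_mul, map_mul]
      by_contra h
      simp only [mul_eq_zero, not_or] at h
      exact hcon h
    have h3 := h₂ x h0
    have : (fun i => eval x (g i)) = B := by
      funext i
      rw [← hx i]
      simp [g]
    exact hB4 (this ▸ h3)
  have hpart : ∀ x : J → ℂ, (∀ i, x i * (x i + ∑ j, x j) = B i) →
      ∀ D : Finset J, D.Nonempty → ∑ i ∈ D, (2 * x i + ∑ j, x j) ≠ 0 := by
    intro x hxx D hD
    have h3 := (hx x hxx).2.1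
    simp only [f₂, map_prod] at h3
    have h4 := Finset.prod_ne_zero_iff.1 h3 ⟨D, hD⟩ (Finset.mem_univ _)
    simpa [y] using h4
  refine ⟨fun i => ?_, by simpa using hB2, ?_, fun x hxx => by simpa using (hx x hxx).1, hpart, ?_⟩
  · rw [map_prod] at hB1
    simpa using Finset.prod_ne_zero_iff.1 hB1 i (Finset.mem_univ _)
  · intro β hβ h0
    have h3 := h₁ β (by simpa using h0)
    have : (fun i => eval β (X i ^ 2 : MvPolynomial J ℂ)) = B := by
      funext i
      simp [hβ]
    exact hB3 (this ▸ h3)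
  · intro x hxx h0
    apply (hx x hxx).2.2
    have hy : ∀ i, 2 * x i + ∑ j, x j ≠ 0 := fun i => by
      simpa using hpart x hxx {i} (Finset.singleton_nonempty i)
    have h5 : eval x f₃ = (∑ i, B i / (2 * x i + ∑ j, x j)) * ∏ i, (2 * x i + ∑ j, x j) := by
      simp only [f₃, map_sum, map_mul, map_prod, Finset.sum_mul]
      refine Finset.sum_congr rfl fun i _ => ?_
      rw [← Finset.mul_prod_erase Finset.univ _ (Finset.mem_univ i), ← mul_assoc,
        div_mul_cancel₀ _ (hy i), ← hxx i]
      simp [g, y]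
    rw [h5, h0, zero_mul]

/-- The projective form of the likelihood equations of the second Veronese. -/
def projectiveSolutions {J : Type*} [Fintype J] (B : J → ℂ) : Set (J → ℂ) :=
  {q | ∑ i, q i = 1 ∧ ∃ W, ∀ i, q i * (q i + 1) = B i * W}

theorem ne_zero_of_projective_solution {J : Type*} [Fintype J] {B q : J → ℂ} {W : ℂ}
    (hq : ∑ i, q i = 1) (hW : ∀ i, q i * (q i + 1) = B i * W) : W ≠ 0 := by
  rintro rfl
  have hre : ∀ i, (q i).re ≤ 0 := by
    intro i
    have h := hW i
    rw [mul_zero, mul_eq_zero] at h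
    rcases h with h | h
    · simp [h]
    · rw [eq_neg_of_add_eq_zero_left h]; simp
  have h1 := congrArg Complex.re hq
  rw [Complex.re_sum, Complex.one_re] at h1
  have := Finset.sum_nonpos fun i (_ : i ∈ Finset.univ) => hre i
  linarith

namespace IsGenericData

variable {J : Type*} [Fintype J] {B q : J → ℂ} {W : ℂ}

theorem exists_affine_solution (hq : ∑ i, q i = 1) (hW : ∀ i, q i * (q i + 1) = B i * W) :
    ∃ r : ℂ, r ≠ 0 ∧ ∃ x : J → ℂ, (∀ i, x i * (x i + ∑ j, x j) = B i) ∧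
      ∀ i, 2 * q i + 1 = r * (2 * x i + ∑ j, x j) := by
  have hW0 := ne_zero_of_projective_solution hq hW
  obtain ⟨r, hr⟩ := IsAlgClosed.exists_pow_nat_eq W (n := 2) (by norm_num)
  have hr0 : r ≠ 0 := by
    rintro rfl
    exact hW0 (by simpa using hr.symm)
  have hS : ∑ j, q j / r = 1 / r := by rw [← Finset.sum_div, hq]
  refine ⟨r, hr0, fun i => q i / r, fun i => ?_, fun i => ?_⟩
  · rw [hS]
    have := hW i
    rw [← hr] at this
    field_simp
    linear_combination this
  · rw [hS]
    field_simp

theorem partial_sum_projective_ne_zero (hB : IsGenericData B) (hq : ∑ i, q i = 1)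
    (hW : ∀ i, q i * (q i + 1) = B i * W) {D : Finset J} (hD : D.Nonempty) :
    ∑ i ∈ D, (2 * q i + 1) ≠ 0 := by
  obtain ⟨r, hr, x, hx, hxq⟩ := exists_affine_solution hq hW
  simp only [hxq, ← Finset.mul_sum]
  exact mul_ne_zero hr (hB.partial_sum_ne_zero x hx D hD)

theorem jacobian_projective_ne_zero (hB : IsGenericData B) (hq : ∑ i, q i = 1)
    (hW : ∀ i, q i * (q i + 1) = B i * W) : ∑ i, B i / (2 * q i + 1) ≠ 0 := by
  obtain ⟨r, hr, x, hx, hxq⟩ := exists_affine_solution hq hW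
  have : ∑ i, B i / (2 * q i + 1) = (∑ i, B i / (2 * x i + ∑ j, x j)) / r := by
    rw [Finset.sum_div]
    refine Finset.sum_congr rfl fun i _ => ?_
    rw [hxq, div_div, mul_comm]
  rw [this]
  exact div_ne_zero (hB.jacobian_ne_zero x hx) hr

theorem projective_solution_ext (hB : IsGenericData B) {q' : J → ℂ} (hq : ∑ i, q i = 1)
    (hW : ∀ i, q i * (q i + 1) = B i * W) (hq' : ∑ i, q' i = 1)
    (hW' : ∀ i, q' i * (q' i + 1) = B i * W) : q = q' := by
  classical
  by_contra hne
  obtain ⟨i₀, hi₀⟩ := Function.ne_iff.1 hne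
  refine hB.partial_sum_projective_ne_zero hq hW
    (D := Finset.univ.filter fun i => q i ≠ q' i) ⟨i₀, by simpa using hi₀⟩ ?_
  have h : ∀ i, (if q i ≠ q' i then 2 * q i + 1 else 0) = q i - q' i := by
    intro i
    split_ifs with h
    · have h1 : (q i - q' i) * (q i + q' i + 1) = 0 := by linear_combination hW i - hW' i
      have h2 := (mul_eq_zero.1 h1).resolve_left (sub_ne_zero.2 h)
      linear_combination h2
    · rw [not_not.1 h, sub_self]
  rw [Finset.sum_filter, Finset.sum_congr rfl fun i _ => h i, Finset.sum_sub_distrib, hq, hq',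
    sub_self]

theorem ncard_projectiveSolutions [Nonempty J] (hB : IsGenericData B) :
    (projectiveSolutions B).ncard = 2 ^ (Fintype.card J - 1) := by
  classical
  obtain ⟨H, hH, hform⟩ := exists_signed_norm_form (J := J) (Fintype.card J + 2)
  let α : Option J → ℂ := fun _ => 1
  let β : Option J → ℂ := fun o => o.elim 0 fun i => 4 * B i
  let P : Polynomial ℂ :=
    MvPolynomial.aeval (fun k => Polynomial.C (α k) + Polynomial.C (β k) * Polynomial.X) H
  have hP : ∀ {A : Type} [CommRing A] [Algebra ℂ A] (w : A) (z : J → A),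
      (∀ i, z i ^ 2 = 1 + algebraMap ℂ A (4 * B i) * w) → Polynomial.aeval w P =
        ∏ ε : J → ℤˣ, (algebraMap ℂ A (Fintype.card J + 2) - ∑ i, ((ε i : ℤ) : A) * z i) := by
    intro A _ _ w z hz
    have h1 := hform (A := A) (fun o => o.elim 1 z)
    simp only [Option.elim_none, Option.elim_some, mul_one] at h1
    rw [← h1, ← AlgHom.comp_apply]
    congr 1
    apply MvPolynomial.algHom_ext
    rintro (_ | i)
    · simp [α, β]
    · simp [α, β, hz]
  obtain ⟨hdeg, hcoeff⟩ := natDegree_aeval_line_le hH α β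
  have hlead : MvPolynomial.eval β H ≠ 0 := by
    choose s hs using fun i => IsAlgClosed.exists_pow_nat_eq (B i) (n := 2) (by norm_num)
    have h1 := hform (A := ℂ) (fun o => o.elim 0 fun i => 2 * s i)
    have h2 : (fun k => (fun o : Option J => o.elim (0 : ℂ) fun i => 2 * s i) k ^ 2) = β := by
      funext k
      rcases k with _ | i
      · simp [β]
      · simp only [β, Option.elim_some, mul_pow, hs]
        norm_num
    rw [h2, MvPolynomial.aeval_eq_eval] at h1
    change MvPolynomial.eval β H = _ at h1
    rw [h1]
    refine Finset.prod_ne_zero_iff.2 fun ε _ => ?_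
    have h3 := hB.sum_sqrt_ne_zero (fun i => ((ε i : ℤ) : ℂ) * s i) (fun i => by
      rw [mul_pow, hs]
      rcases Int.units_eq_one_or (ε i) with h | h <;> simp [h])
    have h4 : (algebraMap ℂ ℂ (Fintype.card J + 2) * (none : Option J).elim 0 (fun i => 2 * s i)
        - ∑ i, ((ε i : ℤ) : ℂ) * (some i).elim 0 (fun i => 2 * s i)) =
        -2 * ∑ i, ((ε i : ℤ) : ℂ) * s i := by
      simp only [Option.elim_none, Option.elim_some, mul_zero, zero_sub, Finset.mul_sum,
        ← Finset.sum_neg_distrib]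
      exact Finset.sum_congr rfl fun i _ => by ring
    rw [h4]
    exact mul_ne_zero (by norm_num) h3
  have hPdeg : P.natDegree = 2 ^ (Fintype.card J - 1) :=
    le_antisymm hdeg (Polynomial.le_natDegree_of_ne_zero (by rw [hcoeff]; exact hlead))
  have hP0 : P ≠ 0 := by
    intro h
    rw [← hcoeff] at hlead
    exact hlead (by change P.coeff _ = 0; rw [h, Polynomial.coeff_zero])
  have hsq : ∀ {q : J → ℂ} {W : ℂ}, (∀ i, q i * (q i + 1) = B i * W) →
      ∀ i, (2 * q i + 1) ^ 2 = 1 + algebraMap ℂ ℂ (4 * B i) * W := by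
    intro q W hW i
    simp only [Algebra.algebraMap_self, RingHom.id_apply]
    linear_combination 4 * hW i
  have hsum : ∀ {q : J → ℂ}, ∑ i, q i = 1 → ∑ i, (2 * q i + 1) = (Fintype.card J + 2 : ℂ) := by
    intro q hq
    rw [Finset.sum_add_distrib, ← Finset.mul_sum, hq]
    simp
    ring
  have hroot : ∀ {q : J → ℂ} {W : ℂ}, ∑ i, q i = 1 → (∀ i, q i * (q i + 1) = B i * W) →
      P.IsRoot W := by
    intro q W hq hW
    rw [Polynomial.IsRoot, ← Polynomial.coe_aeval_eq_eval, hP W _ (hsq hW)]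
    refine Finset.prod_eq_zero (Finset.mem_univ 1) ?_
    simp only [Pi.one_apply, Units.val_one, Int.cast_one, one_mul, hsum hq]
    simp
  have hlift : ∀ {W : ℂ}, P.IsRoot W →
      ∃ q : J → ℂ, ∑ i, q i = 1 ∧ ∀ i, q i * (q i + 1) = B i * W := by
    intro W hW
    choose s hs using fun i => IsAlgClosed.exists_pow_nat_eq (1 + 4 * B i * W) (n := 2)
      (by norm_num)
    rw [Polynomial.IsRoot, ← Polynomial.coe_aeval_eq_eval, hP W s (by simpa using hs),
      Finset.prod_eq_zero_iff] at hW
    obtain ⟨ε, -, hε⟩ := hW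
    simp only [Algebra.algebraMap_self, RingHom.id_apply] at hε
    refine ⟨fun i => (((ε i : ℤ) : ℂ) * s i - 1) / 2, ?_, fun i => ?_⟩
    · rw [← Finset.sum_div, Finset.sum_sub_distrib, ← sub_eq_zero.1 hε]
      simp
    · have h2 : (((ε i : ℤ) : ℂ) * s i) ^ 2 = 1 + 4 * B i * W := by
        rw [mul_pow, hs]
        rcases Int.units_eq_one_or (ε i) with h | h <;> simp [h]
      linear_combination h2 / 4
  have hsimple : ∀ {q : J → ℂ} {W : ℂ}, ∑ i, q i = 1 → (∀ i, q i * (q i + 1) = B i * W) →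
      ¬ P.derivative.IsRoot W := by
    intro q W hq hW hder
    let z : J → ℂ := fun i => 2 * q i + 1
    have hz : ∀ i, z i ≠ 0 := fun i => by
      simpa using hB.partial_sum_projective_ne_zero hq hW (Finset.singleton_nonempty i)
    let ζ : J → DualNumber ℂ := fun i =>
      TrivSqZeroExt.inl (z i) + TrivSqZeroExt.inr (2 * B i / z i)
    have h1 := hP (algebraMap ℂ (DualNumber ℂ) W + DualNumber.eps) ζ (by
      intro i
      have := hsq hW i
      simp only [Algebra.algebraMap_self, RingHom.id_apply] at this
      have hzi := hz i
      ext
      · simpa [ζ, z, TrivSqZeroExt.algebraMap_eq_inl] using this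
      · simp [ζ, TrivSqZeroExt.algebraMap_eq_inl, TrivSqZeroExt.snd_pow]
        field_simp
        ring)
    rw [Polynomial.aeval_add_of_sq_eq_zero _ _ _ (by rw [pow_two, DualNumber.eps_mul_eps]),
      Polynomial.aeval_algebraMap_apply, Polynomial.aeval_algebraMap_apply,
      Polynomial.coe_aeval_eq_eval, (hroot hq hW).eq_zero, hder.eq_zero, map_zero, zero_mul,
      add_zero, ← Finset.mul_prod_erase _ _ (Finset.mem_univ 1)] at h1
    have h2 : (algebraMap ℂ (DualNumber ℂ) (Fintype.card J + 2) -
        ∑ i, (((1 : J → ℤˣ) i : ℤ) : DualNumber ℂ) * ζ i) =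
        TrivSqZeroExt.inr (-2 * ∑ i, B i / z i) := by
      ext
      · simp [ζ, TrivSqZeroExt.fst_sum, z, hsum hq, TrivSqZeroExt.algebraMap_eq_inl]
      · simp [ζ, TrivSqZeroExt.snd_sum, TrivSqZeroExt.algebraMap_eq_inl, Finset.mul_sum,
          mul_div_assoc]
    rw [h2] at h1
    have h3 := congrArg TrivSqZeroExt.snd h1
    simp only [TrivSqZeroExt.snd_zero, TrivSqZeroExt.snd_mul, TrivSqZeroExt.fst_inr, zero_smul,
      TrivSqZeroExt.snd_inr, zero_add, MulOpposite.smul_eq_mul_unop, MulOpposite.unop_op] at h3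
    have h4 := (mul_eq_zero.1 h3.symm).resolve_left
      (mul_ne_zero (by norm_num) (hB.jacobian_projective_ne_zero hq hW))
    rw [← TrivSqZeroExt.fstHom_apply (R := ℂ) ℂ, map_prod] at h4
    obtain ⟨ε, hε, h5⟩ := Finset.prod_eq_zero_iff.1 h4
    have hε1 : ε ≠ 1 := Finset.ne_of_mem_erase hε
    obtain ⟨i₀, hi₀⟩ := Function.ne_iff.1 hε1
    have h6 : (Fintype.card J + 2 : ℂ) - ∑ i, ((ε i : ℤ) : ℂ) * z i = 0 := by
      simpa [ζ, TrivSqZeroExt.fst_sum, TrivSqZeroExt.algebraMap_eq_inl] using h5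
    refine hB.partial_sum_projective_ne_zero hq hW
      (D := Finset.univ.filter fun i => ε i ≠ 1) ⟨i₀, by simpa using hi₀⟩ ?_
    have h7 : ∀ i, (if ε i ≠ 1 then 2 * q i + 1 else 0) =
        (z i - ((ε i : ℤ) : ℂ) * z i) / 2 := by
      intro i
      rcases Int.units_eq_one_or (ε i) with h | h
      · simp [h]
      · simp only [h, z, Units.val_neg, Units.val_one, Int.cast_neg, Int.cast_one]
        rw [if_pos (by decide)]
        ring
    rw [Finset.sum_filter, Finset.sum_congr rfl fun i _ => h7 i, ← Finset.sum_div,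
      Finset.sum_sub_distrib, hsum hq, h6, zero_div]
  have hnodup : P.roots.Nodup := by
    rw [Multiset.nodup_iff_count_le_one]
    intro W
    rw [Polynomial.count_roots]
    by_contra h
    obtain ⟨h1, h2⟩ := (Polynomial.one_lt_rootMultiplicity_iff_isRoot hP0).1 (not_le.1 h)
    obtain ⟨q, hq, hW⟩ := hlift h1
    exact hsimple hq hW h2
  have hcard : P.roots.toFinset.card = 2 ^ (Fintype.card J - 1) := by
    rw [Multiset.toFinset_card_of_nodup hnodup, ← hPdeg]
    exact (IsAlgClosed.splits P).natDegree_eq_card_roots.symm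
  rw [← hcard, ← Set.ncard_coe_finset]
  have hWval : ∀ {q : J → ℂ} {W : ℂ}, (∀ i, q i * (q i + 1) = B i * W) →
      (∑ i, q i * (q i + 1)) / ∑ i, B i = W := by
    intro q W hW
    rw [Finset.sum_congr rfl fun i _ => hW i, ← Finset.sum_mul,
      mul_div_cancel_left₀ _ hB.sum_ne_zero]
  refine Set.ncard_congr (fun q _ => (∑ i, q i * (q i + 1)) / ∑ i, B i) ?_ ?_ ?_
  · rintro q ⟨hq, W, hW⟩
    rw [hWval hW, Finset.mem_coe, Multiset.mem_toFinset, Polynomial.mem_roots hP0]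
    exact hroot hq hW
  · rintro q q' ⟨hq, W, hW⟩ ⟨hq', W', hW'⟩ h
    rw [hWval hW, hWval hW'] at h
    subst h
    exact hB.projective_solution_ext hq hW hq' hW'
  · intro W hW
    rw [Finset.mem_coe, Multiset.mem_toFinset, Polynomial.mem_roots hP0] at hW
    obtain ⟨q, hq, hqW⟩ := hlift hW
    exact ⟨q, ⟨hq, W, hqW⟩, hWval hqW⟩

end IsGenericData

theorem zpow_sum_of_ne_zero {ι : Type*} {a : ℂ} (ha : a ≠ 0) (s : Finset ι) (f : ι → ℤ) :
    a ^ (∑ i ∈ s, f i) = ∏ i ∈ s, a ^ f i := by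
  classical
  induction s using Finset.induction_on with
  | empty => simp
  | insert i s hi ih => rw [Finset.sum_insert hi, Finset.prod_insert hi, zpow_add₀ ha, ih]

theorem prod_pow_toNat_eq_iff {ι : Type*} [Fintype ι] {p : ι → ℂ} (hp : ∀ j, p j ≠ 0)
    (v : ι → ℤ) :
    (∏ j, p j ^ (max (v j) 0).toNat) = (∏ j, p j ^ (max (-v j) 0).toNat) ↔
      ∏ j, p j ^ v j = 1 := by
  have h : ∀ j, p j ^ v j = p j ^ (max (v j) 0).toNat / p j ^ (max (-v j) 0).toNat := by
    intro j
    rw [← zpow_natCast, ← zpow_natCast, ← zpow_sub₀ (hp j)]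
    congr 1
    omega
  rw [Finset.prod_congr rfl fun j _ => h j, Finset.prod_div_distrib, div_eq_one_iff_eq]
  exact Finset.prod_ne_zero_iff.2 fun j _ => pow_ne_zero _ (hp j)

/-- The homogenized exponent vector of a column of the second Veronese matrix. -/
def ver2Exp {d : ℕ} (α : Ver2Index d) (o : Option (Fin (d - 1))) : ℕ :=
  o.elim (2 - ∑ i, (α.1 i : ℕ)) fun i => (α.1 i : ℕ)

/-- The quadratic monomial in the homogeneous coordinates `q` attached to a column of the second
Veronese matrix. -/
def ver2Monomial {d : ℕ} (q : Option (Fin (d - 1)) → ℂ) (α : Ver2Index d) : ℂ :=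
  ∏ o, q o ^ ver2Exp α o

/-- The homogenized sufficient statistics of the data `u`. -/
def ver2Stat {d : ℕ} (u : Ver2Index d → ℂ) (o : Option (Fin (d - 1))) : ℂ :=
  ∑ α, (ver2Exp α o : ℂ) * u α

section

variable {d : ℕ}

theorem sum_ver2Exp (α : Ver2Index d) : ∑ o, ver2Exp α o = 2 := by
  have := α.2
  rw [Fintype.sum_option]
  simp only [ver2Exp, Option.elim_none, Option.elim_some]
  omega

theorem ver2Exp_injective : Function.Injective (ver2Exp (d := d)) := by
  intro α β h
  ext i
  exact congrFun h (some i)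

theorem exists_ver2Exp_eq (f : Option (Fin (d - 1)) → ℕ) (hf : ∑ o, f o = 2) :
    ∃ α : Ver2Index d, ver2Exp α = f := by
  rw [Fintype.sum_option] at hf
  have hle : ∀ i, f (some i) < 3 := by
    intro i
    have := Finset.single_le_sum (f := fun i => f (some i)) (fun _ _ => Nat.zero_le _)
      (Finset.mem_univ i)
    omega
  refine ⟨⟨fun i => ⟨f (some i), hle i⟩, by simp only; omega⟩, ?_⟩
  funext o
  rcases o with _ | i
  · simp only [ver2Exp, Option.elim_none]
    omega
  · rfl

/-- The column of the second Veronese matrix corresponding to the monomial `q o * q j`. -/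
noncomputable def ver2Pair (o j : Option (Fin (d - 1))) : Ver2Index d :=
  (exists_ver2Exp_eq (Pi.single o 1 + Pi.single j 1) (by
    simp [Finset.sum_add_distrib])).choose

theorem ver2Exp_pair (o j : Option (Fin (d - 1))) :
    ver2Exp (ver2Pair o j : Ver2Index d) = Pi.single o 1 + Pi.single j 1 :=
  (exists_ver2Exp_eq (d := d) (Pi.single o 1 + Pi.single j 1) (by
    simp [Finset.sum_add_distrib])).choose_spec

theorem ver2Monomial_pair (q : Option (Fin (d - 1)) → ℂ) (o j : Option (Fin (d - 1))) :
    ver2Monomial q (ver2Pair o j : Ver2Index d) = q o * q j := by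
  simp only [ver2Monomial, ver2Exp_pair, Pi.add_apply, pow_add, Finset.prod_mul_distrib,
    Pi.single_apply, pow_ite, pow_one, pow_zero, Finset.prod_ite_eq', Finset.mem_univ, if_true]

theorem ver2Pair_injective (o : Option (Fin (d - 1))) :
    Function.Injective (ver2Pair (d := d) o) := by
  intro j k h
  have h1 := congrArg ver2Exp h
  rw [ver2Exp_pair, ver2Exp_pair, add_right_inj] at h1
  have h2 := congrFun h1 j
  rw [Pi.single_eq_same, Pi.single_apply] at h2
  by_contra hjk
  rw [if_neg hjk] at h2
  exact one_ne_zero h2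

theorem exists_eq_ver2Pair {α : Ver2Index d} {o : Option (Fin (d - 1))} (h : ver2Exp α o ≠ 0) :
    ∃ j, ver2Pair o j = α := by
  have hdec : ver2Exp α = Pi.single o 1 + (ver2Exp α - Pi.single o 1) := by
    funext k
    rw [Pi.add_apply, Pi.sub_apply, Pi.single_apply]
    split_ifs with hk
    · subst hk
      omega
    · omega
  have hsum := sum_ver2Exp α
  rw [hdec] at hsum
  simp only [Pi.add_apply, Finset.sum_add_distrib] at hsum
  rw [Finset.sum_pi_single' o 1 Finset.univ, if_pos (Finset.mem_univ o)] at hsum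
  obtain ⟨j, hj⟩ : ∃ j, (ver2Exp α - Pi.single o 1 : Option (Fin (d - 1)) → ℕ) j ≠ 0 := by
    by_contra hcon
    push Not at hcon
    simp [hcon] at hsum
  refine ⟨j, ver2Exp_injective ?_⟩
  rw [ver2Exp_pair, hdec]
  congr 1
  rw [← Finset.add_sum_erase _ _ (Finset.mem_univ j)] at hsum
  funext k
  rw [Pi.single_apply]
  split_ifs with hk
  · subst hk
    omega
  · have := Finset.single_le_sum
      (f := fun k => (ver2Exp α - Pi.single o 1 : Option (Fin (d - 1)) → ℕ) k)
      (fun _ _ => Nat.zero_le _) (Finset.mem_erase.2 ⟨hk, Finset.mem_univ k⟩)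
    omega

theorem ver2Stat_monomial (q : Option (Fin (d - 1)) → ℂ) (o : Option (Fin (d - 1))) :
    ver2Stat (d := d) (ver2Monomial q) o = q o * (q o + ∑ j, q j) := by
  have h1 : ∑ j, ((ver2Exp (ver2Pair o j : Ver2Index d) o : ℕ) : ℂ) *
      ver2Monomial q (ver2Pair o j : Ver2Index d) = ver2Stat (d := d) (ver2Monomial q) o := by
    refine Finset.sum_of_injOn (ver2Pair o) (ver2Pair_injective o).injOn (by simp) ?_
      fun _ _ => rfl
    intro α _ hα
    have : ver2Exp α o = 0 := by
      by_contra h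
      obtain ⟨j, hj⟩ := exists_eq_ver2Pair h
      exact hα ⟨j, by simp, hj⟩
    rw [this, Nat.cast_zero, zero_mul]
  rw [← h1]
  simp only [ver2Monomial_pair, ver2Exp_pair, Pi.add_apply, Pi.single_eq_same, Pi.single_apply,
    Nat.cast_add, Nat.cast_one, Nat.cast_ite, Nat.cast_zero, add_mul, one_mul, ite_mul, zero_mul,
    Finset.sum_add_distrib, Finset.sum_ite_eq, Finset.mem_univ, if_true, ← Finset.mul_sum]
  ring

theorem sum_ver2Stat (u : Ver2Index d → ℂ) : ∑ o, ver2Stat u o = 2 * ∑ α, u α := by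
  simp only [ver2Stat]
  rw [Finset.sum_comm, Finset.mul_sum]
  refine Finset.sum_congr rfl fun α _ => ?_
  rw [← Finset.sum_mul]
  congr 1
  exact_mod_cast sum_ver2Exp α

theorem ver2_kernel_iff (v : Ver2Index d → ℤ) :
    ((∀ i, ∑ j, ver2A d i j * v j = 0) ∧ ∑ j, v j = 0) ↔
      ∀ o, ∑ α, (ver2Exp α o : ℤ) * v α = 0 := by
  have hsum : ∑ o, ∑ α, (ver2Exp α o : ℤ) * v α = 2 * ∑ α, v α := by
    rw [Finset.sum_comm, Finset.mul_sum]
    refine Finset.sum_congr rfl fun α _ => ?_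
    rw [← Finset.sum_mul]
    congr 1
    exact_mod_cast sum_ver2Exp α
  constructor
  · rintro ⟨h1, h2⟩ (_ | i)
    · rw [Fintype.sum_option, h2, Finset.sum_eq_zero (f := fun i => ∑ α, (ver2Exp α (some i) : ℤ) * v α)
        fun i _ => h1 i] at hsum
      simpa using hsum
    · exact h1 i
  · intro h
    refine ⟨fun i => h (some i), ?_⟩
    rw [Finset.sum_eq_zero fun o _ => h o] at hsum
    omega

theorem ver2_linear_iff {u p : Ver2Index d → ℂ} (hu : ∑ α, u α ≠ 0) :
    ((∑ j, (1 : ℂ) * p j = 1) ∧ (∀ i, (∑ j, u j) * (∑ j, (ver2A d i j : ℂ) * (1 * p j)) =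
      ∑ j, (ver2A d i j : ℂ) * u j)) ↔ ∀ o, (∑ α, u α) * ver2Stat p o = ver2Stat u o := by
  have hi : ∀ (i : Fin (d - 1)) (w : Ver2Index d → ℂ),
      ∑ j, (ver2A d i j : ℂ) * w j = ver2Stat w (some i) := by
    intro i w
    simp only [ver2Stat, ver2A, ver2Exp, Option.elim_some, Int.cast_natCast]
  have hp := sum_ver2Stat p
  have hu' := sum_ver2Stat u
  simp only [one_mul, hi]
  constructor
  · rintro ⟨h1, h2⟩ (_ | i)
    · rw [Fintype.sum_option] at hp hu'
      rw [h1] at hp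
      have h3 := Finset.sum_congr (rfl : (Finset.univ : Finset (Fin (d - 1))) = _)
        fun i _ => h2 i
      rw [← Finset.mul_sum] at h3
      linear_combination (∑ α, u α) * hp - hu' - h3
    · exact h2 i
  · intro h
    refine ⟨?_, fun i => h (some i)⟩
    rw [← Finset.sum_congr rfl fun o _ => h o, ← Finset.mul_sum, hp] at hu'
    apply mul_left_cancel₀ hu
    linear_combination hu' / 2

theorem mem_mlSolutions_ver2_iff {u p : Ver2Index d → ℂ} (hu : ∑ α, u α ≠ 0) :
    p ∈ mlSolutions (ver2A d) (fun _ => 1) u ↔ (∀ α, p α ≠ 0) ∧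
      (∀ v : Ver2Index d → ℤ, (∀ o, ∑ α, (ver2Exp α o : ℤ) * v α = 0) → ∏ α, p α ^ v α = 1) ∧
      ∀ o, (∑ α, u α) * ver2Stat p o = ver2Stat u o := by
  rw [← ver2_linear_iff hu]
  simp only [mlSolutions, Set.mem_ofPred_eq]
  refine and_congr_right fun hp => and_congr_left fun _ => forall_congr' fun v => ?_
  rw [← ver2_kernel_iff, prod_pow_toNat_eq_iff hp, and_imp]

theorem ver2_toric_parametrization {p : Ver2Index d → ℂ} (hp : ∀ α, p α ≠ 0)
    (h : ∀ v : Ver2Index d → ℤ, (∀ o, ∑ α, (ver2Exp α o : ℤ) * v α = 0) → ∏ α, p α ^ v α = 1)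
    (α : Ver2Index d) :
    p α = ver2Monomial (fun o => p (ver2Pair none o)) α / p (ver2Pair none none) := by
  classical
  have h1 := h (fun β => (if β = α then 1 else 0) + (if β = ver2Pair none none then 1 else 0) -
    ∑ o, if β = ver2Pair none o then (ver2Exp α o : ℤ) else 0) (by
      intro o
      simp only [mul_sub, mul_add, mul_ite, mul_one, mul_zero, Finset.sum_sub_distrib,
        Finset.sum_add_distrib, Finset.sum_ite_eq', Finset.mem_univ, if_true, Finset.mul_sum]
      rw [Finset.sum_comm]
      simp only [Finset.sum_ite_eq', Finset.mem_univ, if_true, ver2Exp_pair, Pi.add_apply,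
        Nat.cast_add, add_mul, Finset.sum_add_distrib, ← Finset.mul_sum]
      have h2 : ∑ i, (ver2Exp α i : ℤ) = 2 := by exact_mod_cast sum_ver2Exp α
      have h3 : ∑ x, (((Pi.single x 1 : Option (Fin (d - 1)) → ℕ) o : ℕ) : ℤ) * (ver2Exp α x : ℤ)
          = ver2Exp α o := by
        simp [Pi.single_apply]
      rw [h2, h3]
      ring)
  simp only [zpow_sub₀ (hp _), zpow_add₀ (hp _), zpow_sum_of_ne_zero (hp _),
    Finset.prod_div_distrib, Finset.prod_mul_distrib] at h1
  rw [Finset.prod_comm] at h1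
  have hite : ∀ (a : ℂ) (P : Prop) [Decidable P] (n : ℤ),
      a ^ (if P then n else 0) = if P then a ^ n else 1 := by
    intro a P _ n
    split_ifs <;> simp
  simp only [hite, zpow_one, Finset.prod_ite_eq', Finset.mem_univ, if_true,
    zpow_natCast] at h1
  rw [eq_div_iff (hp _)]
  exact eq_of_div_eq_one h1

/-- The point of the second Veronese, normalized to have coordinate sum one, with homogeneous
coordinates `q` of coordinate sum one. -/
noncomputable def ver2Point (q : Option (Fin (d - 1)) → ℂ) (α : Ver2Index d) : ℂ :=
  ver2Monomial q α / ((∑ o, q o * (q o + 1)) / 2)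

theorem ver2Stat_div (p : Ver2Index d → ℂ) (c : ℂ) (o : Option (Fin (d - 1))) :
    ver2Stat (fun α => p α / c) o = ver2Stat p o / c := by
  simp only [ver2Stat, Finset.sum_div, mul_div_assoc]

theorem ver2Monomial_div (x : Option (Fin (d - 1)) → ℂ) (c : ℂ) (α : Ver2Index d) :
    ver2Monomial (fun o => x o / c) α = ver2Monomial x α / c ^ 2 := by
  simp only [ver2Monomial, div_pow, Finset.prod_div_distrib, Finset.prod_pow_eq_pow_sum,
    sum_ver2Exp]

theorem ver2Point_mem_mlSolutions {u : Ver2Index d → ℂ} (hu : IsGenericData (ver2Stat u))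
    {q : Option (Fin (d - 1)) → ℂ} (hq : q ∈ projectiveSolutions (ver2Stat u)) :
    ver2Point q ∈ mlSolutions (ver2A d) (fun _ => 1) u := by
  obtain ⟨hq1, W, hW⟩ := hq
  have hW0 := ne_zero_of_projective_solution hq1 hW
  have hus := hu.sum_ne_zero
  rw [sum_ver2Stat] at hus
  have hu0 : ∑ α, u α ≠ 0 := right_ne_zero_of_mul hus
  have hk : (∑ o, q o * (q o + 1)) / 2 = (∑ α, u α) * W := by
    rw [Finset.sum_congr rfl fun o _ => hW o, ← Finset.sum_mul, sum_ver2Stat]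
    ring
  have hk0 := mul_ne_zero hu0 hW0
  have hqo : ∀ o, q o ≠ 0 := by
    intro o h
    have := hW o
    rw [h, zero_mul] at this
    exact mul_ne_zero (hu.ne_zero o) hW0 this.symm
  rw [mem_mlSolutions_ver2_iff hu0]
  refine ⟨fun α => ?_, fun v hv => ?_, fun o => ?_⟩
  · rw [ver2Point, hk]
    exact div_ne_zero (Finset.prod_ne_zero_iff.2 fun o _ => pow_ne_zero _ (hqo o)) hk0
  · have hv0 := ((ver2_kernel_iff v).2 hv).2
    simp only [ver2Point, hk, div_zpow, Finset.prod_div_distrib, ver2Monomial,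
      ← Finset.prod_zpow]
    rw [← zpow_sum_of_ne_zero hk0, hv0, zpow_zero, div_one, Finset.prod_comm]
    refine Finset.prod_eq_one fun o _ => ?_
    have : ∀ α, (q o ^ ver2Exp α o) ^ v α = q o ^ ((ver2Exp α o : ℤ) * v α) := by
      intro α
      rw [zpow_mul, zpow_natCast]
    rw [Finset.prod_congr rfl fun α _ => this α, ← zpow_sum_of_ne_zero (hqo o), hv o, zpow_zero]
  · have h1 : ver2Stat (d := d) (ver2Point q) o = q o * (q o + 1) / ((∑ α, u α) * W) := by
      rw [← hq1, ← ver2Stat_monomial, ← ver2Stat_div, ← hk]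
      rfl
    rw [h1, hW]
    field_simp

theorem exists_ver2Point_eq {u : Ver2Index d → ℂ} (hu : IsGenericData (ver2Stat u))
    {p : Ver2Index d → ℂ} (hp : p ∈ mlSolutions (ver2A d) (fun _ => 1) u) :
    ∃ q ∈ projectiveSolutions (ver2Stat u), ver2Point q = p := by
  have hus := hu.sum_ne_zero
  rw [sum_ver2Stat] at hus
  have hu0 : ∑ α, u α ≠ 0 := right_ne_zero_of_mul hus
  rw [mem_mlSolutions_ver2_iff hu0] at hp
  obtain ⟨hp0, htor, hlin⟩ := hp
  set x : Option (Fin (d - 1)) → ℂ := fun o => p (ver2Pair none o) with hx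
  set s := p (ver2Pair none none) with hs
  have hs0 : s ≠ 0 := hp0 _
  have hpx : p = fun α => ver2Monomial x α / s :=
    funext (ver2_toric_parametrization hp0 htor)
  have heq : ∀ o, (∑ α, u α) * (x o * (x o + ∑ j, x j)) = ver2Stat u o * s := by
    intro o
    have h1 := hlin o
    rw [hpx, ver2Stat_div, ver2Stat_monomial] at h1
    rw [← h1]
    field_simp
  have hX : ∑ j, x j ≠ 0 := by
    obtain ⟨r, hr⟩ := IsAlgClosed.exists_pow_nat_eq ((∑ α, u α) / s) (n := 2) (by norm_num)
    have h2 := hu.sum_solution_ne_zero (fun o => r * x o) (fun o => by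
      rw [← Finset.mul_sum]
      have h3 : r * x o * (r * x o + r * ∑ j, x j) = r ^ 2 * (x o * (x o + ∑ j, x j)) := by ring
      rw [h3, hr, div_mul_eq_mul_div, heq, mul_div_cancel_right₀ _ hs0])
    rw [← Finset.mul_sum] at h2
    exact right_ne_zero_of_mul h2
  set X := ∑ j, x j
  have hW : ∀ o, x o / X * (x o / X + 1) = ver2Stat u o * (s / ((∑ α, u α) * X ^ 2)) := by
    intro o
    have := heq o
    field_simp
    linear_combination this
  refine ⟨fun o => x o / X, ⟨by rw [← Finset.sum_div, div_self hX], _, hW⟩, ?_⟩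
  rw [hpx]
  funext α
  rw [ver2Point, ver2Monomial_div, Finset.sum_congr rfl fun o _ => hW o, ← Finset.sum_mul,
    sum_ver2Stat]
  field_simp

theorem ver2Point_injOn {u : Ver2Index d → ℂ} (hu : IsGenericData (ver2Stat u)) :
    Set.InjOn (ver2Point (d := d)) (projectiveSolutions (ver2Stat u)) := by
  have key : ∀ q ∈ projectiveSolutions (ver2Stat u), ∀ o,
      q o = ver2Point (d := d) q (ver2Pair none o) /
        ∑ j, ver2Point (d := d) q (ver2Pair none j) := by
    rintro q ⟨hq1, W, hW⟩ o
    have hW0 := ne_zero_of_projective_solution hq1 hW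
    have hk : (∑ o, q o * (q o + 1)) / 2 ≠ 0 := by
      rw [Finset.sum_congr rfl fun o _ => hW o, ← Finset.sum_mul]
      exact div_ne_zero (mul_ne_zero hu.sum_ne_zero hW0) (by norm_num)
    have hq0 : q none ≠ 0 := by
      intro h
      have := hW none
      rw [h, zero_mul] at this
      exact mul_ne_zero (hu.ne_zero none) hW0 this.symm
    simp only [ver2Point, ver2Monomial_pair]
    rw [← Finset.sum_div, ← Finset.mul_sum, hq1, mul_one, div_div_div_cancel_right₀ hk,
      mul_div_cancel_left₀ _ hq0]
  intro q hq q' hq' h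
  funext o
  rw [key q hq o, key q' hq' o, h]

theorem ver2Stat_surjective : Function.Surjective (ver2Stat (d := d)) := by
  classical
  intro B
  refine ⟨fun α => ∑ j, if α = ver2Pair j j then B j / 2 else 0, ?_⟩
  funext o
  simp only [ver2Stat, Finset.mul_sum, mul_ite, mul_zero]
  rw [Finset.sum_comm]
  simp only [Finset.sum_ite_eq', Finset.mem_univ, if_true, ver2Exp_pair]
  rw [Finset.sum_eq_single o]
  · simp only [Pi.add_apply, Pi.single_eq_same]
    push_cast
    ring
  · intro j _ hj
    simp [Pi.single_eq_of_ne' hj]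
  · simp

end

/-- For every `d ≥ 2`, the ML degree of the second Veronese `Ver(d-1,2)` with trivial
scaling `c = (1,…,1)` equals its degree `2^(d-1)`. -/
theorem ml_degree_second_veronese (d : ℕ) (hd : 2 ≤ d) :
    ∃ G : MvPolynomial (Ver2Index d) ℂ, G ≠ 0 ∧
      ∀ u : Ver2Index d → ℂ, MvPolynomial.eval u G ≠ 0 →
        (mlSolutions (ver2A d) (fun _ => 1) u).Finite ∧
        (mlSolutions (ver2A d) (fun _ => 1) u).ncard = 2 ^ (d - 1) := by
  obtain ⟨G, hG, hgen⟩ := exists_isGenericData (Option (Fin (d - 1)))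
  let ψ : Option (Fin (d - 1)) → MvPolynomial (Ver2Index d) ℂ := fun o =>
    ∑ α, MvPolynomial.C (ver2Exp α o : ℂ) * MvPolynomial.X α
  have heval : ∀ u : Ver2Index d → ℂ, MvPolynomial.eval u (MvPolynomial.bind₁ ψ G) =
      MvPolynomial.eval (ver2Stat u) G := by
    intro u
    have h := MvPolynomial.eval₂Hom_bind₁ (RingHom.id ℂ) u ψ G
    have hψ : (fun i => MvPolynomial.eval₂Hom (RingHom.id ℂ) u (ψ i)) = ver2Stat u := by
      funext o
      change MvPolynomial.eval u (ψ o) = _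
      simp [ψ, ver2Stat]
    rw [hψ] at h
    exact h
  refine ⟨MvPolynomial.bind₁ ψ G, fun h0 => hG (MvPolynomial.funext fun B => ?_), fun u hu => ?_⟩
  · obtain ⟨u, rfl⟩ := ver2Stat_surjective B
    rw [← heval, h0, map_zero, map_zero]
  rw [heval] at hu
  have hB := hgen _ hu
  have himage : mlSolutions (ver2A d) (fun _ => 1) u =
      ver2Point '' projectiveSolutions (ver2Stat u) := by
    ext p
    constructor
    · exact exists_ver2Point_eq hB
    · rintro ⟨q, hq, rfl⟩
      exact ver2Point_mem_mlSolutions hB hq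
  have hcard : (mlSolutions (ver2A d) (fun _ => 1) u).ncard = 2 ^ (d - 1) := by
    rw [himage, (ver2Point_injOn hB).ncard_image, hB.ncard_projectiveSolutions]
    simp
  exact ⟨Set.finite_of_ncard_ne_zero (by rw [hcard]; positivity), hcard⟩
end

section
/- Let d ≥ 2 and k ≥ 1 be integers and let b_0, b_1, …, b_{d−1} ∈ ℂ* be nonzero, and set L(θ) = b_0 + b_1θ_1 + ⋯ + b_{d−1}θ_{d−1}. Then for generic u ∈ ℂ^Λ there is exactly one θ ∈ (ℂ*)^{d−1} such that L(θ) ≠ 0 and (Au)_i · L(θ)^k = u_+ · k · b_i · θ_i · L(θ)^{k−1} for all i = 1,…,d−1. (If the symmetric coefficient tensor of a scaled Veronese Ver(d−1,k) has tensor rank one, i.e. f = L^k, then the ML degree of the scaled Veronese is one.) -/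
open scoped BigOperators

/-- Column indices of the Veronese `Ver(d-1,k)`: exponent vectors `α ∈ ℕ^{d-1}`
with `α₁ + ⋯ + α_{d-1} ≤ k`. -/
abbrev VerIndex (d k : ℕ) : Type :=
  {α : Fin (d - 1) → Fin (k + 1) // ∑ i, (α i : ℕ) ≤ k}

/-- A polynomial `∑ a, c a * X a` with some nonzero coefficient is nonzero. -/
lemma MvPolynomial.sum_C_mul_X_ne_zero {σ R : Type*} [Fintype σ] [CommSemiring R]
    {c : σ → R} {a : σ} (ha : c a ≠ 0) :
    (∑ x, C (c x) * X x : MvPolynomial σ R) ≠ 0 := by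
  classical
  intro h
  apply ha
  simpa [Pi.single_apply] using congrArg (eval (Pi.single a 1)) h

/-- The likelihood equations `aᵢ Lᵏ = s k bᵢ θᵢ Lᵏ⁻¹` of the `k`-th power of an affine form
`L = b₀ + ∑ bᵢ θᵢ` have exactly one solution in the torus off the hypersurface `L = 0`. -/
lemma existsUnique_likelihood_pow_affine {ι F : Type*} [Fintype ι] [Field F]
    {k : ℕ} (hk : (k : F) ≠ 0) {b₀ s : F} {a b : ι → F} (hb₀ : b₀ ≠ 0) (hb : ∀ i, b i ≠ 0)
    (hs : s ≠ 0) (ha : ∀ i, a i ≠ 0) (hD : s * k - ∑ i, a i ≠ 0) :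
    ∃! θ : ι → F, (∀ i, θ i ≠ 0) ∧ (b₀ + ∑ i, b i * θ i) ≠ 0 ∧
      ∀ i, a i * (b₀ + ∑ j, b j * θ j) ^ k =
        s * (k : F) * b i * θ i * (b₀ + ∑ j, b j * θ j) ^ (k - 1) := by
  have hk' : k ≠ 0 := by rintro rfl; simp at hk
  have reduce (L t x : F) (hL : L ≠ 0) : x * L ^ k = t * L ^ (k - 1) ↔ x * L = t := by
    rw [← pow_sub_one_mul hk' L, mul_comm (L ^ (k - 1)) L, ← mul_assoc]
    exact mul_left_inj' (pow_ne_zero _ hL)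
  set D := s * k - ∑ i, a i with hDdef
  refine ⟨fun i => a i * b₀ / (b i * D), ⟨fun i => ?_, ?_⟩, ?_⟩
  · exact div_ne_zero (mul_ne_zero (ha i) hb₀) (mul_ne_zero (hb i) hD)
  · have hL : b₀ + ∑ i, b i * (a i * b₀ / (b i * D)) = s * k * b₀ / D := by
      have hterm (i : ι) : b i * (a i * b₀ / (b i * D)) = a i * (b₀ / D) := by
        have := hb i
        field_simp
      simp only [hterm, ← Finset.sum_mul]
      field_simp
      rw [hDdef]
      ring
    have hL0 : s * k * b₀ / D ≠ 0 := div_ne_zero (mul_ne_zero (mul_ne_zero hs hk) hb₀) hD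
    simp only [hL]
    refine ⟨hL0, fun i => (reduce _ _ _ hL0).2 ?_⟩
    have := hb i
    field_simp
  · rintro θ ⟨-, hL, h⟩
    have h' (i : ι) := (reduce _ _ _ hL).1 (h i)
    set L := b₀ + ∑ i, b i * θ i with hLdef
    have hsum : (∑ i, a i) * L = s * k * ∑ i, b i * θ i := by
      rw [Finset.sum_mul, Finset.mul_sum]
      exact Finset.sum_congr rfl fun i _ => by rw [h' i]; ring
    have hLD : L * D = s * k * b₀ := by
      rw [hDdef]
      linear_combination s * k * hLdef - hsum
    funext i
    rw [eq_div_iff (mul_ne_zero (hb i) hD)]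
    refine mul_left_cancel₀ (mul_ne_zero hs hk) ?_
    linear_combination a i * hLD - D * h' i

/-- If the coefficient tensor of a scaled Veronese `Ver(d-1,k)` has tensor rank one,
i.e. `f = L^k` for a linear form `L = b₀ + b₁θ₁ + ⋯ + b_{d-1}θ_{d-1}` with all `bᵢ`
nonzero, then the ML degree is one: for generic `u` there is exactly one torus point
`θ` with `L(θ) ≠ 0` solving the likelihood equations
`(Au)ᵢ L(θ)^k = u₊ k bᵢ θᵢ L(θ)^(k-1)`. -/
theorem ml_degree_one_of_rank_one_veronese (d k : ℕ) (hd : 2 ≤ d) (hk : 1 ≤ k)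
    (b₀ : ℂ) (b : Fin (d - 1) → ℂ) (hb₀ : b₀ ≠ 0) (hb : ∀ i, b i ≠ 0) :
    ∃ G : MvPolynomial (VerIndex d k) ℂ, G ≠ 0 ∧
      ∀ u : VerIndex d k → ℂ, MvPolynomial.eval u G ≠ 0 →
        ∃! θ : Fin (d - 1) → ℂ, (∀ i, θ i ≠ 0) ∧
          (b₀ + ∑ i, b i * θ i) ≠ 0 ∧
          ∀ i : Fin (d - 1),
            (∑ α : VerIndex d k, ((α.1 i : ℕ) : ℂ) * u α) *
                (b₀ + ∑ i', b i' * θ i') ^ k =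
              (∑ α : VerIndex d k, u α) * (k : ℂ) * b i * θ i *
                (b₀ + ∑ i', b i' * θ i') ^ (k - 1) := by
  classical
  have hkC : (k : ℂ) ≠ 0 := Nat.cast_ne_zero.2 (by omega)
  let zeroIdx : VerIndex d k := ⟨0, by simp⟩
  let unitIdx (i : Fin (d - 1)) : VerIndex d k :=
    ⟨Pi.single i ⟨1, by omega⟩, by simpa [Pi.single_apply, apply_ite Fin.val] using hk⟩
  let linForm (c : VerIndex d k → ℂ) : MvPolynomial (VerIndex d k) ℂ :=
    ∑ α, MvPolynomial.C (c α) * MvPolynomial.X α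
  refine ⟨linForm (fun _ => 1) * linForm (fun α => k - ∑ i, ((α.1 i : ℕ) : ℂ)) *
    ∏ i, linForm (fun α => ((α.1 i : ℕ) : ℂ)), ?_, fun u hu => ?_⟩
  · refine mul_ne_zero (mul_ne_zero ?_ ?_) (Finset.prod_ne_zero_iff.2 fun i _ => ?_)
    · exact MvPolynomial.sum_C_mul_X_ne_zero (a := zeroIdx) one_ne_zero
    · exact MvPolynomial.sum_C_mul_X_ne_zero (a := zeroIdx) (by simpa [zeroIdx] using hkC)
    · exact MvPolynomial.sum_C_mul_X_ne_zero (a := unitIdx i) (by simp [unitIdx])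
  · simp only [linForm, map_mul, map_prod, map_sum, MvPolynomial.eval_C, MvPolynomial.eval_X,
      one_mul, mul_ne_zero_iff, Finset.prod_ne_zero_iff, Finset.mem_univ, true_imp_iff] at hu
    obtain ⟨⟨hs, hD⟩, ha⟩ := hu
    refine existsUnique_likelihood_pow_affine hkC hb₀ hb hs ha ?_
    convert hD using 1
    simp only [sub_mul, Finset.sum_sub_distrib, Finset.sum_mul]
    rw [Finset.sum_comm]
    congr 1
    exact Finset.sum_congr rfl fun _ _ => mul_comm _ _
end

section
/- Let m, n ≥ 1, let c be an m×n complex matrix with all entries nonzero and of rank one (equivalently c_{ij}c_{kl} = c_{il}c_{kj} for all i,k,j,l), and let u be an m×n real matrix with all entries positive; write u_{i+} = Σ_j u_{ij}, u_{+j} = Σ_i u_{ij} and u_{++} = Σ_{i,j} u_{ij}. Then there is exactly one m×n complex matrix p satisfying: (a) c_{il}c_{kj}·p_{ij}p_{kl} = c_{ij}c_{kl}·p_{il}p_{kj} for all 1 ≤ i,k ≤ m and 1 ≤ j,l ≤ n; (b) Σ_j p_{ij} = u_{i+}/u_{++} for all i; and (c) Σ_i p_{ij} = u_{+j}/u_{++}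 for all j; namely p_{ij} = u_{i+}·u_{+j}/u_{++}². (If the scaling matrix c of the scaled Segre embedding of ℙ^{m−1}×ℙ^{n−1} has rank one, then its ML degree is one.) -/
open scoped BigOperators

/-- If all `2 × 2` minors of `p` through the entry `(i, j)` vanish, that entry times the
total sum is the product of its row sum and its column sum. -/
theorem mul_sum_sum_eq_sum_mul_sum_of_minors {ι κ R : Type*} [Fintype ι] [Fintype κ]
    [CommSemiring R] (p : ι → κ → R) (i : ι) (j : κ)
    (hp : ∀ k l, p i j * p k l = p i l * p k j) :
    p i j * ∑ k, ∑ l, p k l = (∑ l, p i l) * ∑ k, p k j := by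
  simp_rw [Finset.mul_sum, hp, Finset.sum_mul]

/-- If the scaling matrix `c` of the scaled Segre embedding of `ℙ^{m-1} × ℙ^{n-1}`
has rank one (equivalently `c i j * c k l = c i l * c k j` for all `i,k,j,l`), then
for positive data `u` the likelihood equations have exactly one solution, namely
`p i j = u_{i+} u_{+j} / u_{++}²` — the ML degree is one. -/
theorem ml_degree_one_of_rank_one_segre (m n : ℕ) (hm : 1 ≤ m) (hn : 1 ≤ n)
    (c : Fin m → Fin n → ℂ) (hc : ∀ i j, c i j ≠ 0)
    (hrank : ∀ i k j l, c i j * c k l = c i l * c k j)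
    (u : Fin m → Fin n → ℝ) (hu : ∀ i j, 0 < u i j) :
    ∀ p : Fin m → Fin n → ℂ,
      ((∀ i k j l, c i l * c k j * (p i j * p k l) = c i j * c k l * (p i l * p k j)) ∧
        (∀ i, ∑ j, p i j = (((∑ j', u i j') / (∑ i', ∑ j', u i' j') : ℝ) : ℂ)) ∧
        (∀ j, ∑ i, p i j = (((∑ i', u i' j) / (∑ i', ∑ j', u i' j') : ℝ) : ℂ))) ↔
      (∀ i j, p i j =
        ((((∑ j', u i j') * (∑ i', u i' j)) / (∑ i', ∑ j', u i' j') ^ 2 : ℝ) : ℂ)) := by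
  have hs : (∑ i', ∑ j', u i' j') ≠ 0 := by
    refine (Finset.sum_pos (fun i _ => Finset.sum_pos (fun j _ => hu i j) ?_) ?_).ne'
    · exact ⟨⟨0, hn⟩, Finset.mem_univ _⟩
    · exact ⟨⟨0, hm⟩, Finset.mem_univ _⟩
  intro p
  constructor
  · rintro ⟨hminor, hrow, hcol⟩ i j
    have htotal : ∑ k, ∑ l, p k l = 1 := by
      simp_rw [hrow]
      rw [← Complex.ofReal_sum, ← Finset.sum_div, div_self hs, Complex.ofReal_one]
    have hp : ∀ k l, p i j * p k l = p i l * p k j := fun k l => by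
      have h := hminor i k j l
      rw [hrank i k j l] at h
      exact mul_left_cancel₀ (mul_ne_zero (hc i l) (hc k j)) h
    rw [← mul_one (p i j), ← htotal, mul_sum_sum_eq_sum_mul_sum_of_minors p i j hp,
      hrow, hcol, ← Complex.ofReal_mul, div_mul_div_comm, sq]
  · intro h
    refine ⟨fun i k j l => ?_, fun i => ?_, fun j => ?_⟩
    · rw [hrank i k j l]
      simp only [h]
      push_cast
      ring
    · simp_rw [h]
      rw [← Complex.ofReal_sum, ← Finset.sum_div, ← Finset.mul_sum,
        Finset.sum_comm (f := fun j i' => u i' j), sq, mul_div_mul_right _ _ hs]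
    · simp_rw [h]
      rw [← Complex.ofReal_sum, ← Finset.sum_div, ← Finset.sum_mul, sq,
        mul_div_mul_left _ _ hs]
end
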